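/- arXiv:1309.2167 — 3 statements merged into one kernel-verified Lean document; each statement's English description precedes it below -/
import Mathlib

section
/- Let r ≥ 1 and suppose there exist 0 < α < β such that f is strictly decreasing on (α, β) and strictly increasing on (β, ∞) (so f has a local minimum at β > 0). Then there exists an injective holomorphic function F on ℂ ∖ (−∞, f(β)] such that: F is real-valued and strictly increasing on (f(β), ∞) and maps (f(β), ∞) onto (β, ∞); f(F(w)) = w for every w ∈ ℂ ∖ (−∞, f(β)]; and Im F(z) > 0 whenever Im z > 0. In other words, the inverse of f on (f(β),∞) extends to a univalent Pick function on the cut plane ℂ ∖ (−∞, f(β)]. -/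
open Complex

/-- The entire genus-2 function
`f(z) = z^r e^{az²+bz} ∏_k (1 + z/λ_k) e^{−z/λ_k + z²/(2λ_k²)}`. -/
noncomputable def genus2fun (r : ℕ) (a b : ℝ) (lam : ℕ → ℝ) (z : ℂ) : ℂ :=
  z ^ r * Complex.exp ((a : ℂ) * z ^ 2 + (b : ℂ) * z) *
    ∏' k : ℕ, ((1 + z / (lam k : ℂ)) *
      Complex.exp (-z / (lam k : ℂ) + z ^ 2 / (2 * (lam k : ℂ) ^ 2)))

/-- The logarithm of one factor of the canonical product of genus two. -/
noncomputable def genus2logFactor (l : ℝ) (z : ℂ) : ℂ :=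
  Complex.log (1 + z / l) + (-z / l + z ^ 2 / (2 * (l : ℂ) ^ 2))

/-- The branch of the logarithm of `genus2fun` in the right half plane which is real on the positive axis. -/
noncomputable def genus2log (r : ℕ) (a b : ℝ) (lam : ℕ → ℝ) (z : ℂ) : ℂ :=
  r * Complex.log z + (a * z ^ 2 + b * z) + ∑' k, genus2logFactor (lam k) z

/-- The logarithmic derivative of `genus2fun`. -/
noncomputable def genus2logDeriv (r : ℕ) (a b : ℝ) (lam : ℕ → ℝ) (z : ℂ) : ℂ :=
  r / z + (2 * a * z + b) + ∑' k, z ^ 2 / ((lam k : ℂ) ^ 2 * (lam k + z))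

lemma ofReal_add_ne_zero_of_neg_lt_re {l : ℝ} {z : ℂ} (h : -l < z.re) : (l : ℂ) + z ≠ 0 := by
  intro h0
  have := congrArg Complex.re h0
  simp at this
  linarith

lemma one_add_div_re_pos {l : ℝ} (hl : 0 < l) {z : ℂ} (h : -l < z.re) :
    0 < (1 + z / (l : ℂ)).re := by
  have h1 : (1 + z / (l : ℂ)).re = (l + z.re) / l := by
    simp [Complex.div_ofReal_re]
    field_simp
  rw [h1]
  exact div_pos (by linarith) hl

lemma hasDerivAt_genus2logFactor {l : ℝ} (hl : 0 < l) {z : ℂ} (h : -l < z.re) :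
    HasDerivAt (genus2logFactor l) (z ^ 2 / ((l : ℂ) ^ 2 * (l + z))) z := by
  have hl0 : (l : ℂ) ≠ 0 := by exact_mod_cast hl.ne'
  have hlz := ofReal_add_ne_zero_of_neg_lt_re h
  have hs : 1 + z / (l : ℂ) ∈ Complex.slitPlane := Or.inl (one_add_div_re_pos hl h)
  have h1 : HasDerivAt (fun z : ℂ => 1 + z / (l : ℂ)) (1 / l) z :=
    ((hasDerivAt_id z).div_const (l : ℂ)).const_add 1
  have h2 : HasDerivAt (fun z : ℂ => -z / (l : ℂ)) (-1 / l) z :=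
    (hasDerivAt_id z).neg.div_const (l : ℂ)
  have h3 : HasDerivAt (fun z : ℂ => z ^ 2 / (2 * (l : ℂ) ^ 2)) (2 * z / (2 * (l : ℂ) ^ 2)) z := by
    simpa using (hasDerivAt_pow 2 z).div_const (2 * (l : ℂ) ^ 2)
  refine ((h1.clog hs).add (h2.add h3)).congr_deriv ?_
  have h4 : 1 + z / (l : ℂ) ≠ 0 := Complex.slitPlane_ne_zero hs
  have h5 : 1 + z / (l : ℂ) = (l + z) / l := by field_simp
  rw [h5]
  field_simp
  ring

lemma exp_genus2logFactor {l : ℝ} (hl : 0 < l) {z : ℂ} (h : -l < z.re) :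
    Complex.exp (genus2logFactor l z) = (1 + z / (l : ℂ)) *
      Complex.exp (-z / (l : ℂ) + z ^ 2 / (2 * (l : ℂ) ^ 2)) := by
  have hs : 1 + z / (l : ℂ) ∈ Complex.slitPlane := Or.inl (one_add_div_re_pos hl h)
  rw [genus2logFactor, Complex.exp_add, Complex.exp_log (Complex.slitPlane_ne_zero hs)]

lemma genus2logFactor_conj {l : ℝ} (hl : 0 < l) {z : ℂ} (h : -l < z.re) :
    genus2logFactor l (starRingEnd ℂ z) = starRingEnd ℂ (genus2logFactor l z) := by
  have hs : (1 + z / (l : ℂ)).arg ≠ Real.pi :=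
    (Complex.arg_lt_pi_iff.2 (Or.inl (one_add_div_re_pos hl h).le)).ne
  simp only [genus2logFactor, map_add, ← Complex.log_conj _ hs]
  simp [Complex.conj_ofNat]

section

variable {lam : ℕ → ℝ}

lemma norm_genus2logDeriv_term_le (hpos : ∀ k, 0 < lam k) (hmono : Monotone lam) {R : ℝ} (k : ℕ)
    {z : ℂ} (h : -(lam 0 / 2) < z.re) (hz : ‖z‖ ≤ R) :
    ‖z ^ 2 / ((lam k : ℂ) ^ 2 * (lam k + z))‖ ≤ 2 * R ^ 2 * (1 / lam k ^ 3) := by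
  have hk := hpos k
  have h0 : lam 0 ≤ lam k := hmono (Nat.zero_le k)
  have h1 : lam k / 2 ≤ ‖(lam k : ℂ) + z‖ := by
    refine le_trans ?_ (Complex.re_le_norm _)
    simp
    linarith
  rw [norm_div, norm_mul, norm_pow, norm_pow, Complex.norm_real, Real.norm_of_nonneg hk.le]
  calc ‖z‖ ^ 2 / (lam k ^ 2 * ‖(lam k : ℂ) + z‖) ≤ R ^ 2 / (lam k ^ 2 * (lam k / 2)) := by
        gcongr
    _ = 2 * R ^ 2 * (1 / lam k ^ 3) := by field_simp

lemma genus2logFactor_series (hpos : ∀ k, 0 < lam k) (hmono : Monotone lam)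
    (hsum : Summable (fun k => 1 / lam k ^ 3)) {z : ℂ} (hz : 0 < z.re) :
    Summable (fun k => genus2logFactor (lam k) z) ∧
    HasDerivAt (fun z => ∑' k, genus2logFactor (lam k) z)
      (∑' k, z ^ 2 / ((lam k : ℂ) ^ 2 * (lam k + z))) z := by
  have h0 := hpos 0
  set R := ‖z‖ + 1
  let t : Set ℂ := {w | -(lam 0 / 2) < w.re} ∩ Metric.ball 0 R
  have hu : Summable (fun k => 2 * R ^ 2 * (1 / lam k ^ 3)) := hsum.mul_left _
  have ht : IsOpen t := (isOpen_lt continuous_const Complex.continuous_re).inter Metric.isOpen_ball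
  have htc : IsPreconnected t :=
    ((convex_halfSpace_re_gt _).inter (convex_ball _ _)).isPreconnected
  have hg : ∀ n y, y ∈ t → HasDerivAt (genus2logFactor (lam n))
      (y ^ 2 / ((lam n : ℂ) ^ 2 * (lam n + y))) y := fun n y hy =>
    hasDerivAt_genus2logFactor (hpos n) (by
      have := hmono (Nat.zero_le n)
      have h1 : -(lam 0 / 2) < y.re := hy.1
      linarith)
  have hg' : ∀ n y, y ∈ t → ‖y ^ 2 / ((lam n : ℂ) ^ 2 * (lam n + y))‖ ≤
      2 * R ^ 2 * (1 / lam n ^ 3) := fun n y hy =>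
    norm_genus2logDeriv_term_le hpos hmono n hy.1 (mem_ball_zero_iff.1 hy.2).le
  have h0t : (0 : ℂ) ∈ t := ⟨by simpa using h0, by simp [R]; positivity⟩
  have hg0 : Summable (fun n => genus2logFactor (lam n) 0) := by
    simp [genus2logFactor, summable_zero]
  have hzt : z ∈ t := ⟨by simp; linarith, by simp [R]⟩
  exact ⟨summable_of_summable_hasDerivAt_of_isPreconnected hu ht htc hg hg' h0t hg0 hzt,
    hasDerivAt_tsum_of_isPreconnected hu ht htc hg hg' h0t hg0 hzt⟩

lemma summable_genus2logDeriv_term (hpos : ∀ k, 0 < lam k) (hmono : Monotone lam)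
    (hsum : Summable (fun k => 1 / lam k ^ 3)) {z : ℂ} (hz : 0 < z.re) :
    Summable (fun k => z ^ 2 / ((lam k : ℂ) ^ 2 * (lam k + z))) :=
  .of_norm_bounded (hsum.mul_left (2 * ‖z‖ ^ 2)) fun k =>
    norm_genus2logDeriv_term_le hpos hmono k (by linarith [hpos 0]) le_rfl

variable {r : ℕ} {a b : ℝ}

lemma hasDerivAt_genus2log (hpos : ∀ k, 0 < lam k) (hmono : Monotone lam)
    (hsum : Summable (fun k => 1 / lam k ^ 3)) {z : ℂ} (hz : 0 < z.re) :
    HasDerivAt (genus2log r a b lam) (genus2logDeriv r a b lam z) z := by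
  have h1 : HasDerivAt (fun z => (r : ℂ) * Complex.log z) (r / z) z := by
    simpa [div_eq_mul_inv] using (Complex.hasDerivAt_log (Or.inl hz)).const_mul (r : ℂ)
  have h2 : HasDerivAt (fun z : ℂ => (a : ℂ) * z ^ 2 + b * z) (2 * a * z + b) z := by
    refine (((hasDerivAt_pow 2 z).const_mul (a : ℂ)).add
      ((hasDerivAt_id z).const_mul (b : ℂ))).congr_deriv ?_
    simp
    ring
  exact (h1.add h2).add (genus2logFactor_series hpos hmono hsum hz).2

lemma exp_genus2log (hpos : ∀ k, 0 < lam k) (hmono : Monotone lam)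
    (hsum : Summable (fun k => 1 / lam k ^ 3)) {z : ℂ} (hz : 0 < z.re) :
    Complex.exp (genus2log r a b lam z) = genus2fun r a b lam z := by
  have hz0 : z ≠ 0 := by rintro rfl; simp at hz
  rw [genus2log, Complex.exp_add, Complex.exp_add, Complex.exp_nat_mul, Complex.exp_log hz0,
    genus2fun, ← (genus2logFactor_series hpos hmono hsum hz).1.hasSum.cexp.tprod_eq]
  congr 1
  exact tprod_congr fun k => exp_genus2logFactor (hpos k) (by linarith [hpos k])

lemma genus2log_conj (hpos : ∀ k, 0 < lam k) {z : ℂ} (hz : 0 < z.re) :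
    genus2log r a b lam (starRingEnd ℂ z) = starRingEnd ℂ (genus2log r a b lam z) := by
  have hs : z.arg ≠ Real.pi := (Complex.arg_lt_pi_iff.2 (Or.inl hz.le)).ne
  have h1 : ∑' k, genus2logFactor (lam k) (starRingEnd ℂ z) =
      starRingEnd ℂ (∑' k, genus2logFactor (lam k) z) := by
    rw [Complex.conj_tsum]
    exact tsum_congr fun k => genus2logFactor_conj (hpos k) (by linarith [hpos k])
  simp only [genus2log, map_add, h1, map_mul, ← Complex.log_conj _ hs]
  simp

/-- The second divided difference of `genus2logDeriv` at two zeros `γ`, `β` and a moving point. -/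
noncomputable def genus2quot (r : ℕ) (lam : ℕ → ℝ) (γ β : ℝ) (z : ℂ) : ℂ :=
  ((r / (γ * β) : ℝ) : ℂ) / z + ∑' k, ((1 / ((lam k + γ) * (lam k + β)) : ℝ) : ℂ) / (lam k + z)

lemma summable_genus2quot_term (hpos : ∀ k, 0 < lam k)
    (hsum : Summable (fun k => 1 / lam k ^ 3)) {γ β : ℝ} (hγ : 0 < γ) (hβ : 0 < β)
    {z : ℂ} (hz : 0 < z.re) :
    Summable (fun k => ((1 / ((lam k + γ) * (lam k + β)) : ℝ) : ℂ) / (lam k + z)) := by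
  refine .of_norm_bounded hsum fun k => ?_
  have hk := hpos k
  have h1 : lam k ≤ ‖(lam k : ℂ) + z‖ := by
    refine le_trans ?_ (Complex.re_le_norm _)
    simp
    linarith
  rw [norm_div, Complex.norm_real, Real.norm_of_nonneg (by positivity), div_div, pow_succ, pow_two]
  gcongr <;> linarith

/-- Newton interpolation of `genus2logDeriv` at two of its zeros. -/
lemma genus2logDeriv_eq (hpos : ∀ k, 0 < lam k) (hmono : Monotone lam)
    (hsum : Summable (fun k => 1 / lam k ^ 3)) {γ β : ℝ} (hγ : 0 < γ) (hγβ : γ < β)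
    (hDγ : genus2logDeriv r a b lam γ = 0) (hDβ : genus2logDeriv r a b lam β = 0)
    {z : ℂ} (hz : 0 < z.re) :
    genus2logDeriv r a b lam z = (z - γ) * (z - β) * genus2quot r lam γ β z := by
  have hβ : 0 < β := hγ.trans hγβ
  have hγ0 : (γ : ℂ) ≠ 0 := by exact_mod_cast hγ.ne'
  have hβ0 : (β : ℂ) ≠ 0 := by exact_mod_cast hβ.ne'
  have hz0 : z ≠ 0 := by rintro rfl; simp at hz
  have hd : (β : ℂ) - γ ≠ 0 := by exact_mod_cast (sub_pos.2 hγβ).ne'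
  have sz := summable_genus2logDeriv_term hpos hmono hsum hz
  have sγ := summable_genus2logDeriv_term hpos hmono hsum (z := (γ : ℂ)) (by simpa using hγ)
  have sβ := summable_genus2logDeriv_term hpos hmono hsum (z := (β : ℂ)) (by simpa using hβ)
  have sq := summable_genus2quot_term hpos hsum hγ hβ hz
  have key : ∑' k, z ^ 2 / ((lam k : ℂ) ^ 2 * (lam k + z)) =
      (∑' k, (γ : ℂ) ^ 2 / ((lam k : ℂ) ^ 2 * (lam k + γ))) * ((β - z) / (β - γ)) +
      (∑' k, (β : ℂ) ^ 2 / ((lam k : ℂ) ^ 2 * (lam k + β))) * ((z - γ) / (β - γ)) +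
      (z - γ) * (z - β) *
        ∑' k, ((1 / ((lam k + γ) * (lam k + β)) : ℝ) : ℂ) / (lam k + z) := by
    rw [← tsum_mul_right, ← tsum_mul_right, ← tsum_mul_left,
      ← (sγ.mul_right _).tsum_add (sβ.mul_right _),
      ← ((sγ.mul_right _).add (sβ.mul_right _)).tsum_add (sq.mul_left _)]
    refine tsum_congr fun k => ?_
    have hk := hpos k
    have h1 : (lam k : ℂ) ≠ 0 := by exact_mod_cast hk.ne'
    have h2 : (lam k : ℂ) + γ ≠ 0 := by exact_mod_cast (add_pos hk hγ).ne'
    have h3 : (lam k : ℂ) + β ≠ 0 := by exact_mod_cast (add_pos hk hβ).ne'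
    have h4 := ofReal_add_ne_zero_of_neg_lt_re (l := lam k) (z := z) (by linarith)
    push_cast
    field_simp
    ring
  have eγ : ∑' k, (γ : ℂ) ^ 2 / ((lam k : ℂ) ^ 2 * (lam k + γ)) = -(r / γ + (2 * a * γ + b)) := by
    rw [genus2logDeriv] at hDγ
    linear_combination hDγ
  have eβ : ∑' k, (β : ℂ) ^ 2 / ((lam k : ℂ) ^ 2 * (lam k + β)) = -(r / β + (2 * a * β + b)) := by
    rw [genus2logDeriv] at hDβ
    linear_combination hDβ
  rw [genus2logDeriv, key, eγ, eβ, genus2quot]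
  push_cast
  field_simp
  ring

lemma le_clm_mul_genus2quot (hpos : ∀ k, 0 < lam k)
    (hsum : Summable (fun k => 1 / lam k ^ 3)) {γ β : ℝ} (hγ : 0 < γ) (hβ : 0 < β)
    {z : ℂ} (hz : 0 < z.re) (L : ℂ →L[ℝ] ℝ) (A : ℂ)
    (hL : ∀ c l : ℝ, 0 < c → 0 ≤ l → 0 ≤ L (A * (c / (l + z)))) :
    L (A * (((r / (γ * β) : ℝ) : ℂ) / z)) ≤ L (A * genus2quot r lam γ β z) := by
  have hs := (summable_genus2quot_term hpos hsum hγ hβ hz).mul_left A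
  rw [genus2quot, mul_add, map_add, ← tsum_mul_left, L.map_tsum hs]
  refine le_add_of_nonneg_right (tsum_nonneg fun k => hL _ _ ?_ (hpos k).le)
  have := hpos k
  positivity

lemma mul_sub_mul_sub_div_eq (γ β c : ℝ) {l : ℝ} {z : ℂ} (hw : (l : ℂ) + z ≠ 0) :
    (z - γ) * (z - β) * (c / (l + z)) =
      c * ((l + z) - ((γ + β + 2 * l : ℝ) : ℂ) + (((γ + l) * (β + l) : ℝ) : ℂ) * (l + z)⁻¹) := by
  push_cast
  field_simp
  ring

lemma im_mul_sub_mul_sub_div_pos {γ β c l : ℝ} (hγ : 0 < γ) (hγβ : γ < β) (hc : 0 < c)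
    (hl : 0 ≤ l) {z : ℂ} (hz : β ≤ z.re) (hy : 0 < z.im) :
    0 < ((z - γ) * (z - β) * (c / (l + z))).im := by
  have hw : (l : ℂ) + z ≠ 0 := ofReal_add_ne_zero_of_neg_lt_re (by linarith)
  have hN : (γ + l) * (β + l) < Complex.normSq (l + z) := by
    rw [Complex.normSq_apply]
    simp
    nlinarith [mul_pos hy hy]
  have hN0 : 0 < Complex.normSq (l + z) := Complex.normSq_pos.2 hw
  rw [mul_sub_mul_sub_div_eq γ β c hw, Complex.im_ofReal_mul, Complex.add_im, Complex.sub_im,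
    Complex.im_ofReal_mul, Complex.inv_im]
  have h2 : (γ + l) * (β + l) / Complex.normSq (l + z) < 1 := (div_lt_one hN0).2 hN
  have h3 : ((l : ℂ) + z).im - (((γ + β + 2 * l : ℝ) : ℂ)).im +
      (γ + l) * (β + l) * (-((l : ℂ) + z).im / Complex.normSq (l + z)) =
      z.im * (1 - (γ + l) * (β + l) / Complex.normSq (l + z)) := by
    simp only [Complex.add_im, Complex.ofReal_im]
    ring
  rw [h3]
  exact mul_pos hc (mul_pos hy (by linarith))

lemma re_mul_sub_mul_sub_div_nonpos {γ β c l : ℝ} (hγ : 0 < γ) (hγβ : γ < β) (hc : 0 < c)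
    (hl : 0 ≤ l) {z : ℂ} (hz : z.re = β) :
    ((z - γ) * (z - β) * (c / (l + z))).re ≤ 0 := by
  have hw : (l : ℂ) + z ≠ 0 := ofReal_add_ne_zero_of_neg_lt_re (by linarith)
  have hN : (β + l) * (β + l) ≤ Complex.normSq (l + z) := by
    rw [Complex.normSq_apply]
    simp
    nlinarith [mul_self_nonneg z.im]
  have hN0 : 0 < Complex.normSq (l + z) := Complex.normSq_pos.2 hw
  rw [mul_sub_mul_sub_div_eq γ β c hw, Complex.re_ofReal_mul, Complex.add_re, Complex.sub_re,
    Complex.re_ofReal_mul, Complex.inv_re]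
  have h2 : (β + l) * (β + l) / Complex.normSq (l + z) ≤ 1 := (div_le_one hN0).2 hN
  have h3 : ((l : ℂ) + z).re - (((γ + β + 2 * l : ℝ) : ℂ)).re +
      (γ + l) * (β + l) * (((l : ℂ) + z).re / Complex.normSq (l + z)) =
      -((γ + l) * (1 - (β + l) * (β + l) / Complex.normSq (l + z))) := by
    simp only [Complex.add_re, Complex.ofReal_re, hz]
    ring
  rw [h3]
  have h4 : 0 ≤ (γ + l) * (1 - (β + l) * (β + l) / Complex.normSq (l + z)) :=
    mul_nonneg (by linarith) (by linarith)
  nlinarith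

lemma re_mul_div_add_nonneg {c l : ℝ} (hc : 0 < c) (hl : 0 ≤ l) {z : ℂ} (hz : 0 < z.re) :
    0 ≤ (z * (c / (l + z))).re := by
  have h1 : z * (c / (l + z)) = c * (z * (l + z)⁻¹) := by ring
  rw [h1, Complex.re_ofReal_mul, Complex.mul_re, Complex.inv_re, Complex.inv_im]
  have h2 : z.re * ((l + z : ℂ).re / Complex.normSq (l + z)) -
      z.im * (-(l + z : ℂ).im / Complex.normSq (l + z)) =
      (z.re * (l + z.re) + z.im * z.im) / Complex.normSq (l + z) := by
    simp only [Complex.add_re, Complex.add_im, Complex.ofReal_re, Complex.ofReal_im]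
    ring
  rw [h2]
  have := Complex.normSq_nonneg (l + z)
  have := mul_self_nonneg z.im
  positivity

lemma div_le_norm_genus2quot (hpos : ∀ k, 0 < lam k)
    (hsum : Summable (fun k => 1 / lam k ^ 3)) {γ β : ℝ} (hγ : 0 < γ) (hβ : 0 < β)
    {z : ℂ} (hz : 0 < z.re) : r / (γ * β) ≤ ‖z‖ * ‖genus2quot r lam γ β z‖ := by
  have hz0 : z ≠ 0 := by rintro rfl; simp at hz
  have h := le_clm_mul_genus2quot (r := r) hpos hsum hγ hβ hz Complex.reCLM z
    fun c l hc hl => re_mul_div_add_nonneg hc hl hz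
  rw [mul_div_cancel₀ _ hz0] at h
  simp only [Complex.reCLM_apply, Complex.ofReal_re] at h
  rw [← norm_mul]
  exact h.trans (Complex.re_le_norm _)

section

variable (hr : 1 ≤ r) (hpos : ∀ k, 0 < lam k) (hmono : Monotone lam)
    (hsum : Summable (fun k => 1 / lam k ^ 3)) {γ β : ℝ} (hγ : 0 < γ) (hγβ : γ < β)
    (hDγ : genus2logDeriv r a b lam γ = 0) (hDβ : genus2logDeriv r a b lam β = 0)

include hr hpos hmono hsum hγ hγβ hDγ hDβ

lemma genus2logDeriv_im_pos {z : ℂ} (hz : β ≤ z.re) (hy : 0 < z.im) :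
    0 < (genus2logDeriv r a b lam z).im := by
  have hβ := hγ.trans hγβ
  have hz0 : 0 < z.re := hβ.trans_le hz
  rw [genus2logDeriv_eq hpos hmono hsum hγ hγβ hDγ hDβ hz0]
  refine lt_of_lt_of_le ?_ (le_clm_mul_genus2quot (r := r) hpos hsum hγ hβ hz0 Complex.imCLM
    ((z - γ) * (z - β)) fun c l hc hl => (im_mul_sub_mul_sub_div_pos hγ hγβ hc hl hz hy).le)
  have hr' : (0 : ℝ) < r := by exact_mod_cast hr
  simpa using im_mul_sub_mul_sub_div_pos hγ hγβ (div_pos hr' (mul_pos hγ hβ)) le_rfl hz hy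

lemma genus2logDeriv_re_nonpos {z : ℂ} (hz : z.re = β) :
    (genus2logDeriv r a b lam z).re ≤ 0 := by
  have hβ := hγ.trans hγβ
  have hz0 : 0 < z.re := hβ.trans_le hz.ge
  rw [genus2logDeriv_eq hpos hmono hsum hγ hγβ hDγ hDβ hz0]
  have h1 := le_clm_mul_genus2quot (r := r) hpos hsum hγ hβ hz0 (-Complex.reCLM)
    ((z - γ) * (z - β)) fun c l hc hl =>
      neg_nonneg.2 (re_mul_sub_mul_sub_div_nonpos hγ hγβ hc hl hz)
  have hr' : (0 : ℝ) < r := by exact_mod_cast hr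
  have h2 := re_mul_sub_mul_sub_div_nonpos hγ hγβ (div_pos hr' (mul_pos hγ hβ)) le_rfl hz
  simp only [Complex.ofReal_zero, zero_add] at h2
  simp only [neg_apply, Complex.reCLM_apply] at h1
  linarith

lemma genus2logDeriv_re_pos {x : ℝ} (hx : β < x) :
    0 < (genus2logDeriv r a b lam x).re := by
  have hβ := hγ.trans hγβ
  have hx0 : 0 < (x : ℂ).re := hβ.trans hx
  have key : ∀ c l : ℝ, 0 < c → 0 ≤ l →
      0 < (((x : ℂ) - γ) * (x - β) * (c / (l + x))).re := by
    intro c l hc hl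
    have h1 : ((x : ℂ) - γ) * (x - β) * (c / (l + x)) =
        (((x - γ) * (x - β) * (c / (l + x)) : ℝ) : ℂ) := by push_cast; ring
    rw [h1, Complex.ofReal_re]
    have h2 : 0 < x - γ := by linarith
    have h3 : 0 < x - β := by linarith
    have h4 : 0 < l + x := by linarith
    positivity
  rw [genus2logDeriv_eq hpos hmono hsum hγ hγβ hDγ hDβ hx0]
  refine lt_of_lt_of_le ?_ (le_clm_mul_genus2quot (r := r) hpos hsum hγ hβ hx0 Complex.reCLM
    ((x - γ) * (x - β)) fun c l hc hl => (key c l hc hl).le)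
  have hr' : (0 : ℝ) < r := by exact_mod_cast hr
  simpa using key _ 0 (div_pos hr' (mul_pos hγ hβ)) le_rfl

lemma exists_norm_sub_le_mul_norm_genus2logDeriv :
    ∃ M : ℝ, 0 < M ∧ ∀ z : ℂ, β ≤ z.re → ‖z - β‖ ≤ M * ‖genus2logDeriv r a b lam z‖ := by
  have hβ := hγ.trans hγβ
  have hr' : (0 : ℝ) < r := by exact_mod_cast hr
  have hd : 0 < β - γ := sub_pos.2 hγβ
  refine ⟨β / (β - γ) * (γ * β / r), by positivity, fun z hz => ?_⟩
  have hz0 : 0 < z.re := hβ.trans_le hz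
  rw [genus2logDeriv_eq hpos hmono hsum hγ hγβ hDγ hDβ hz0, norm_mul, norm_mul]
  have h1 := div_le_norm_genus2quot (r := r) hpos hsum hγ hβ hz0
  have h2 : β - γ ≤ ‖z - γ‖ := by
    refine le_trans ?_ (Complex.re_le_norm _)
    simpa using hz
  have h3 : ‖z‖ ≤ ‖z - γ‖ + γ := by
    have := norm_add_le (z - γ) γ
    simpa [abs_of_pos hγ] using this
  have h4 : ‖z‖ ≤ β / (β - γ) * ‖z - γ‖ := by
    rw [div_mul_eq_mul_div, le_div_iff₀ hd]
    nlinarith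
  have h5 : 1 ≤ γ * β / r * (‖z‖ * ‖genus2quot r lam γ β z‖) := by
    rw [div_le_iff₀ (by positivity)] at h1
    rw [div_mul_eq_mul_div, le_div_iff₀ hr']
    linarith
  calc ‖z - β‖ = ‖z - β‖ * 1 := (mul_one _).symm
    _ ≤ ‖z - β‖ * (γ * β / r * (‖z‖ * ‖genus2quot r lam γ β z‖)) := by gcongr
    _ ≤ ‖z - β‖ * (γ * β / r * (β / (β - γ) * ‖z - γ‖ * ‖genus2quot r lam γ β z‖)) := by gcongr
    _ = _ := by ring

end

lemma genus2logDeriv_ofReal (r : ℕ) (a b : ℝ) (lam : ℕ → ℝ) (x : ℝ) :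
    genus2logDeriv r a b lam x =
      ((r / x + (2 * a * x + b) + ∑' k, x ^ 2 / (lam k ^ 2 * (lam k + x)) : ℝ) : ℂ) := by
  rw [genus2logDeriv]
  push_cast
  rfl

lemma genus2log_ofReal_im (hpos : ∀ k, 0 < lam k) {x : ℝ} (hx : 0 < x) :
    (genus2log r a b lam x).im = 0 := by
  have h := genus2log_conj (r := r) (a := a) (b := b) hpos (z := (x : ℂ)) (by simpa using hx)
  rw [Complex.conj_ofReal] at h
  exact Complex.conj_eq_iff_im.1 h.symm

section

variable (hpos : ∀ k, 0 < lam k) (hmono : Monotone lam)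
    (hsum : Summable (fun k => 1 / lam k ^ 3))

include hpos hmono hsum

lemma continuousOn_genus2logDeriv :
    ContinuousOn (genus2logDeriv r a b lam) {z | 0 < z.re} := by
  have ho : IsOpen {z : ℂ | 0 < z.re} := isOpen_lt continuous_const Complex.continuous_re
  have hd : DifferentiableOn ℂ (genus2log r a b lam) {z | 0 < z.re} := fun z hz =>
    (hasDerivAt_genus2log hpos hmono hsum hz).differentiableAt.differentiableWithinAt
  exact (hd.deriv ho).continuousOn.congr fun z hz =>
    (hasDerivAt_genus2log hpos hmono hsum hz).deriv.symm

lemma genus2fun_ofReal {x : ℝ} (hx : 0 < x) :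
    genus2fun r a b lam x = (Real.exp (genus2log r a b lam x).re : ℝ) := by
  rw [← exp_genus2log hpos hmono hsum (z := (x : ℂ)) (by simpa using hx), Complex.ofReal_exp]
  congr 1
  exact Complex.ext rfl (by simpa using genus2log_ofReal_im hpos hx)

lemma genus2logDeriv_re_nonpos_of_strictAntiOn {s : Set ℝ} (hs : IsOpen s) (hs0 : ∀ x ∈ s, 0 < x)
    (h : StrictAntiOn (fun x : ℝ => (genus2fun r a b lam (x : ℂ)).re) s) {x : ℝ} (hx : x ∈ s) :
    (genus2logDeriv r a b lam x).re ≤ 0 := by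
  have hd := (hasDerivAt_genus2log (r := r) (a := a) (b := b) hpos hmono hsum
    (z := (x : ℂ)) (by simpa using hs0 x hx)).real_of_complex
  have ha : AntitoneOn (fun x : ℝ => (genus2log r a b lam x).re) s := by
    intro u hu v hv huv
    have := h.antitoneOn hu hv huv
    simpa only [genus2fun_ofReal hpos hmono hsum (hs0 _ hu),
      genus2fun_ofReal hpos hmono hsum (hs0 _ hv), Complex.ofReal_re, Real.exp_le_exp] using this
  have h1 := ha.derivWithin_nonpos (x := x)
  rwa [derivWithin_of_isOpen hs hx, hd.deriv] at h1

lemma genus2logDeriv_re_nonneg_of_strictMonoOn {s : Set ℝ} (hs : IsOpen s) (hs0 : ∀ x ∈ s, 0 < x)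
    (h : StrictMonoOn (fun x : ℝ => (genus2fun r a b lam (x : ℂ)).re) s) {x : ℝ} (hx : x ∈ s) :
    0 ≤ (genus2logDeriv r a b lam x).re := by
  have hd := (hasDerivAt_genus2log (r := r) (a := a) (b := b) hpos hmono hsum
    (z := (x : ℂ)) (by simpa using hs0 x hx)).real_of_complex
  have ha : MonotoneOn (fun x : ℝ => (genus2log r a b lam x).re) s := by
    intro u hu v hv huv
    have := h.monotoneOn hu hv huv
    simpa only [genus2fun_ofReal hpos hmono hsum (hs0 _ hu),
      genus2fun_ofReal hpos hmono hsum (hs0 _ hv), Complex.ofReal_re, Real.exp_le_exp] using this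
  have h1 := ha.derivWithin_nonneg (x := x)
  rwa [derivWithin_of_isOpen hs hx, hd.deriv] at h1

lemma exists_genus2logDeriv_eq_zero (hr : 1 ≤ r) {α β : ℝ} (hα : 0 < α) (hαβ : α < β)
    (hdec : StrictAntiOn (fun x : ℝ => (genus2fun r a b lam (x : ℂ)).re) (Set.Ioo α β))
    (hinc : StrictMonoOn (fun x : ℝ => (genus2fun r a b lam (x : ℂ)).re) (Set.Ioi β)) :
    genus2logDeriv r a b lam β = 0 ∧
      ∃ γ : ℝ, 0 < γ ∧ γ < β ∧ genus2logDeriv r a b lam γ = 0 := by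
  have hβ := hα.trans hαβ
  have hzero : ∀ x : ℝ, (genus2logDeriv r a b lam x).re = 0 → genus2logDeriv r a b lam x = 0 := by
    intro x hx
    rw [genus2logDeriv_ofReal, Complex.ofReal_re] at hx
    rw [genus2logDeriv_ofReal, hx, Complex.ofReal_zero]
  have hc : ContinuousOn (fun x : ℝ => (genus2logDeriv r a b lam x).re) (Set.Ioi 0) :=
    Complex.continuous_re.comp_continuousOn ((continuousOn_genus2logDeriv hpos hmono hsum).comp
      Complex.continuous_ofReal.continuousOn fun x hx => by simpa using hx)
  have hneg : ∀ x ∈ Set.Ioo α β, (genus2logDeriv r a b lam x).re ≤ 0 := fun x hx =>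
    genus2logDeriv_re_nonpos_of_strictAntiOn hpos hmono hsum isOpen_Ioo
      (fun y hy => hα.trans hy.1) hdec hx
  have hpl : ∀ x ∈ Set.Ioi β, 0 ≤ (genus2logDeriv r a b lam x).re := fun x hx =>
    genus2logDeriv_re_nonneg_of_strictMonoOn hpos hmono hsum isOpen_Ioi
      (fun y hy => hβ.trans hy) hinc hx
  have hcβ : ContinuousAt (fun x : ℝ => (genus2logDeriv r a b lam x).re) β :=
    hc.continuousAt (Ioi_mem_nhds hβ)
  refine ⟨hzero β (le_antisymm ?_ ?_), ?_⟩
  · refine le_of_tendsto (hcβ.tendsto.mono_left (nhdsWithin_le_nhds (s := Set.Iio β))) ?_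
    filter_upwards [Ioo_mem_nhdsLT hαβ] with x hx using hneg x hx
  · refine ge_of_tendsto (hcβ.tendsto.mono_left (nhdsWithin_le_nhds (s := Set.Ioi β))) ?_
    filter_upwards [self_mem_nhdsWithin] with x hx using hpl x hx
  · obtain ⟨m, hm⟩ := exists_between hαβ
    have hm0 : 0 < m := hα.trans hm.1
    set A : ℝ := 2 * |a| + |b| + 1 + 1 / m
    have hA1 : 1 ≤ A := by
      have : 0 < 1 / m := by positivity
      linarith [abs_nonneg a, abs_nonneg b]
    have hA0 : 0 < A := by linarith
    have hAm : 1 / A ≤ m := by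
      rw [div_le_comm₀ hA0 hm0]
      linarith [abs_nonneg a, abs_nonneg b]
    have hpA : 0 ≤ (genus2logDeriv r a b lam (1 / A : ℝ)).re := by
      rw [genus2logDeriv_ofReal, Complex.ofReal_re]
      have h1 : 0 ≤ ∑' k, (1 / A) ^ 2 / (lam k ^ 2 * (lam k + 1 / A)) :=
        tsum_nonneg fun k => by
          have := hpos k
          positivity
      have h2 : A ≤ r / (1 / A) := by
        have : (1 : ℝ) ≤ r := by exact_mod_cast hr
        rw [div_div_eq_mul_div, div_one]
        nlinarith
      have h3 : -(2 * |a|) ≤ 2 * a * (1 / A) := by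
        have h4 : |2 * a * (1 / A)| ≤ 2 * |a| := by
          rw [abs_mul, abs_mul, abs_of_pos (one_div_pos.2 hA0), abs_two]
          exact mul_le_of_le_one_right (by positivity) ((div_le_one hA0).2 hA1)
        linarith [neg_abs_le (2 * a * (1 / A))]
      have h5 : 0 < 1 / m := by positivity
      have h6 : A = 2 * |a| + |b| + 1 + 1 / m := rfl
      linarith [neg_abs_le b]
    obtain ⟨γ, hγ, hγ0⟩ := intermediate_value_Icc' hAm
      (hc.mono fun x hx => (one_div_pos.2 hA0).trans_le hx.1) ⟨hneg m hm, hpA⟩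
    exact ⟨γ, (one_div_pos.2 hA0).trans_le hγ.1, hγ.2.trans_lt hm.2, hzero γ hγ0⟩

end

end

lemma injOn_of_re_mul_deriv_pos {h D : ℂ → ℂ} {s : Set ℂ} (hs : Convex ℝ s)
    (hd : ∀ z ∈ s, HasDerivAt h (D z) z) (c : ℂ) (hc : ∀ z ∈ s, 0 < (c * D z).re) :
    Set.InjOn h s := by
  intro z₁ h₁ z₂ h₂ heq
  by_contra hne
  have hne' : z₂ - z₁ ≠ 0 := sub_ne_zero.2 (Ne.symm hne)
  have hmem : ∀ t ∈ Set.Icc (0 : ℝ) 1, z₁ + t * (z₂ - z₁) ∈ s := fun t ht => by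
    simpa using hs.add_smul_sub_mem h₁ h₂ ht
  have hg : ∀ t ∈ Set.Icc (0 : ℝ) 1,
      HasDerivAt (fun t : ℝ => (c * (z₂ - z₁)⁻¹ * h (z₁ + t * (z₂ - z₁))).re)
        (c * D (z₁ + t * (z₂ - z₁))).re t := by
    intro t ht
    have hl : HasDerivAt (fun t : ℂ => z₁ + t * (z₂ - z₁)) (z₂ - z₁) (t : ℂ) := by
      simpa using ((hasDerivAt_id (t : ℂ)).mul_const (z₂ - z₁)).const_add z₁
    refine ((((hd _ (hmem t ht)).comp (t : ℂ) hl).const_mul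
      (c * (z₂ - z₁)⁻¹)).congr_deriv ?_).real_of_complex
    field_simp
  have hmono : StrictMonoOn (fun t : ℝ => (c * (z₂ - z₁)⁻¹ * h (z₁ + t * (z₂ - z₁))).re)
      (Set.Icc 0 1) :=
    strictMonoOn_of_hasDerivWithinAt_pos (convex_Icc 0 1)
      (fun t ht => (hg t ht).continuousAt.continuousWithinAt)
      (fun t ht => (hg t (interior_subset ht)).hasDerivWithinAt)
      (fun t ht => hc _ (hmem t (interior_subset ht)))
  have := hmono (Set.left_mem_Icc.2 zero_le_one) (Set.right_mem_Icc.2 zero_le_one) zero_lt_one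
  simp [heq] at this

section HalfPlane

variable {h D : ℂ → ℂ} {β : ℝ} (hd : ∀ z, β ≤ z.re → HasDerivAt h (D z) z)
  (hreal : ∀ x : ℝ, β ≤ x → (h x).im = 0)

include hd hreal

lemma im_nonpos_of_re_eq (hline : ∀ z, z.re = β → (D z).re ≤ 0) {z : ℂ} (hz : z.re = β)
    (hy : 0 ≤ z.im) : (h z).im ≤ 0 := by
  have hre : ∀ y : ℝ, ((β : ℂ) + y * I).re = β := fun y => by simp
  have hg : ∀ y : ℝ, HasDerivAt (fun y : ℝ => (-I * h (β + y * I)).re) (D (β + y * I)).re y := by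
    intro y
    have hl : HasDerivAt (fun t : ℂ => (β : ℂ) + t * I) I (y : ℂ) := by
      simpa using ((hasDerivAt_id (y : ℂ)).mul_const I).const_add (β : ℂ)
    refine ((((hd _ (hre y).ge).comp (y : ℂ) hl).const_mul (-I)).congr_deriv ?_).real_of_complex
    linear_combination -D (β + y * I) * I_mul_I
  have hanti : Antitone (fun y : ℝ => (-I * h (β + y * I)).re) :=
    antitone_of_deriv_nonpos (fun y => (hg y).differentiableAt)
      fun y => by rw [(hg y).deriv]; exact hline _ (hre y)
  have h1 := hanti hy
  have h2 : (β : ℂ) + z.im * I = z := by rw [← hz]; exact re_add_im z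
  simpa [h2, hreal β le_rfl] using h1

lemma eventually_im_mul_im_pos {x₀ : ℝ} (hx₀ : β < x₀) (hD : 0 < (D x₀).re) :
    ∀ᶠ z in nhds (x₀ : ℂ), z.im = 0 ∨ 0 < z.im * (h z).im := by
  have hnhds : {z : ℂ | β < z.re} ∈ nhds (x₀ : ℂ) :=
    (isOpen_lt continuous_const Complex.continuous_re).mem_nhds (by simpa using hx₀)
  have hdiff : DifferentiableOn ℂ h {z : ℂ | β < z.re} := fun z hz =>
    (hd z (le_of_lt hz)).differentiableAt.differentiableWithinAt
  have hs : HasStrictDerivAt h (D x₀) x₀ := by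
    have := (hdiff.analyticAt hnhds).hasStrictDerivAt
    rwa [(hd x₀ (by simpa using hx₀.le)).deriv] at this
  have hDim : (D x₀).im = 0 := by
    have h1 := ((hd x₀ (by simpa using hx₀.le)).const_mul (-I)).real_of_complex
    have h2 : (fun x : ℝ => (-I * h x).re) =ᶠ[nhds x₀] fun _ => 0 := by
      filter_upwards [Ioi_mem_nhds hx₀] with x hx
      simp [hreal x (le_of_lt hx)]
    have h3 := h1.unique ((hasDerivAt_const x₀ (0 : ℝ)).congr_of_eventuallyEq h2)
    simpa using h3
  have ho := hs.hasStrictFDerivAt.isLittleO.def (half_pos hD)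
  have ht : Filter.Tendsto (fun z : ℂ => (z, (z.re : ℂ))) (nhds (x₀ : ℂ))
      (nhds ((x₀ : ℂ), (x₀ : ℂ))) := by
    have : Continuous (fun z : ℂ => (z, (z.re : ℂ))) := by fun_prop
    simpa using this.tendsto (x₀ : ℂ)
  filter_upwards [ht.eventually ho, hnhds] with z hz hzβ
  by_cases hy : z.im = 0
  · exact Or.inl hy
  right
  have hsub : z - (z.re : ℂ) = z.im * I := by
    apply Complex.ext <;> simp
  have h1 := (Complex.abs_im_le_norm _).trans hz
  simp only [hsub, ContinuousLinearMap.toSpanSingleton_apply] at h1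
  have h2 : (h z - h z.re - (z.im * I : ℂ) • D x₀).im = (h z).im - z.im * (D x₀).re := by
    simp [hreal z.re (le_of_lt hzβ)]
  have h3 : ‖(z.im * I : ℂ)‖ = |z.im| := by simp
  rw [h2, h3, abs_le] at h1
  rcases lt_or_gt_of_ne hy with hy' | hy'
  · rw [abs_of_neg hy'] at h1
    exact mul_pos_of_neg_of_neg hy' (by nlinarith)
  · rw [abs_of_pos hy'] at h1
    exact mul_pos hy' (by nlinarith)

/-- The image of the quarter plane to the upper right of `β` contains the upper half plane. -/
lemma exists_quarterPlane_eq (hline : ∀ z, z.re = β → (D z).re ≤ 0)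
    (him : ∀ z, β < z.re → 0 < z.im → 0 < (D z).im)
    (hre : ∀ x : ℝ, β < x → 0 < (D x).re)
    {M : ℝ} (hM0 : 0 < M) (hM : ∀ z : ℂ, β ≤ z.re → ‖z - β‖ ≤ M * ‖D z‖)
    {w : ℂ} (hw : 0 < w.im) : ∃ z : ℂ, β < z.re ∧ 0 < z.im ∧ h z = w := by
  set Q : Set ℂ := {z | β < z.re ∧ 0 < z.im}
  have hQo : IsOpen Q := (isOpen_lt continuous_const Complex.continuous_re).inter
    (isOpen_lt continuous_const Complex.continuous_im)
  have hQc : Convex ℝ Q := (convex_halfSpace_re_gt β).inter (convex_halfSpace_im_gt 0)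
  have hinj : Set.InjOn h Q := injOn_of_re_mul_deriv_pos hQc (fun z hz => hd z hz.1.le) (-I)
    fun z hz => by simpa using him z hz.1 hz.2
  have hD0 : ∀ z ∈ Q, D z ≠ 0 := fun z hz h0 => by
    have := him z hz.1 hz.2
    simp [h0] at this
  have hstrict : ∀ z ∈ Q, HasStrictDerivAt h (D z) z := fun z hz => by
    have hdiff : DifferentiableOn ℂ h Q := fun z hz =>
      (hd z hz.1.le).differentiableAt.differentiableWithinAt
    have := (hdiff.analyticAt (hQo.mem_nhds hz)).hasStrictDerivAt
    rwa [(hd z hz.1.le).deriv] at this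
  set G : ℂ → ℂ := Function.invFunOn h Q
  have hGh : ∀ z ∈ Q, G (h z) = z := fun z hz => hinj.leftInvOn_invFunOn hz
  have hG : ∀ z ∈ Q, HasDerivAt G (D z)⁻¹ (h z) := fun z hz =>
    ((hstrict z hz).to_local_left_inverse (hD0 z hz)
      (Filter.eventually_of_mem (hQo.mem_nhds hz) hGh)).hasDerivAt
  have himo : IsOpen (h '' Q) := by
    rw [isOpen_iff_mem_nhds]
    rintro _ ⟨z, hz, rfl⟩
    rw [← (hstrict z hz).map_nhds_eq (hD0 z hz)]
    exact Filter.image_mem_map (hQo.mem_nhds hz)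
  -- a point of the upper half plane in the image
  obtain ⟨z₀, hz₀Q, hz₀⟩ : ∃ z₀ ∈ Q, 0 < (h z₀).im := by
    have hx : β < β + 1 := by linarith
    have h1 := eventually_im_mul_im_pos hd hreal hx (hre _ hx)
    have ht : Filter.Tendsto (fun y : ℝ => ((β + 1 : ℝ) : ℂ) + y * I) (nhdsWithin 0 (Set.Ioi 0))
        (nhds ((β + 1 : ℝ) : ℂ)) := by
      have : Continuous (fun y : ℝ => ((β + 1 : ℝ) : ℂ) + y * I) := by fun_prop
      simpa using (this.tendsto 0).mono_left nhdsWithin_le_nhds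
    obtain ⟨y, hy, (hy0 : 0 < y)⟩ := ((ht.eventually h1).and self_mem_nhdsWithin).exists
    refine ⟨((β + 1 : ℝ) : ℂ) + y * I, ⟨by simp, by simpa using hy0⟩, ?_⟩
    rcases hy with hy | hy
    · simp at hy
      exact absurd hy hy0.ne'
    · exact (pos_iff_pos_of_mul_pos hy).1 (by simpa using hy0)
  -- lift the segment from `h z₀` to `w`
  set p : ℝ → ℂ := fun t => h z₀ + t * (w - h z₀) with hp
  have hpc : Continuous p := by fun_prop
  have hpim : ∀ t ∈ Set.Icc (0 : ℝ) 1, 0 < (p t).im := fun t ht => by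
    have h1 : (p t).im = (1 - t) * (h z₀).im + t * w.im := by simp [hp]; ring
    rw [h1]
    rcases ht.1.eq_or_lt with h0 | h0
    · simpa [← h0] using hz₀
    · have := mul_nonneg (sub_nonneg.2 ht.2) hz₀.le
      have := mul_pos h0 hw
      linarith
  suffices hall : ∀ t ∈ Set.Icc (0 : ℝ) 1, p t ∈ h '' Q by
    obtain ⟨z, hz, hzw⟩ := hall 1 (Set.right_mem_Icc.2 zero_le_one)
    exact ⟨z, hz.1, hz.2, by rw [hzw]; simp [hp]⟩
  by_contra! hex
  have hCc : IsCompact (Set.Icc (0 : ℝ) 1 ∩ p ⁻¹' (h '' Q)ᶜ) :=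
    isCompact_Icc.inter_right (himo.isClosed_compl.preimage hpc)
  obtain ⟨T, ⟨hT, hTn⟩, hmin⟩ := hCc.exists_isLeast
    (by obtain ⟨t, ht, ht'⟩ := hex; exact ⟨t, ht, ht'⟩)
  have hT0 : 0 < T := by
    rcases hT.1.eq_or_lt with h0 | h0
    · exact absurd ⟨z₀, hz₀Q, by simp [hp, ← h0]⟩ hTn
    · exact h0
  have hbelow : ∀ t ∈ Set.Ico 0 T, ∃ z ∈ Q, h z = p t := fun t ht => by
    by_contra hn
    exact absurd (hmin ⟨⟨ht.1, ht.2.le.trans hT.2⟩, hn⟩) (not_le.2 ht.2)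
  have hK : ∀ t ∈ Set.Ico 0 T, HasDerivWithinAt (fun t : ℝ => (G (p t) - β) ^ 2)
      (2 * (G (p t) - β) * ((D (G (p t)))⁻¹ * (w - h z₀))) (Set.Ico 0 T) t := by
    intro t ht
    obtain ⟨z, hz, hzt⟩ := hbelow t ht
    have hl : HasDerivAt (fun t : ℂ => h z₀ + t * (w - h z₀)) (w - h z₀) (t : ℂ) := by
      simpa using ((hasDerivAt_id (t : ℂ)).mul_const (w - h z₀)).const_add (h z₀)
    have hGt : HasDerivAt G (D (G (p t)))⁻¹ (h z₀ + t * (w - h z₀)) := by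
      have hGz : G (p t) = z := by rw [← hzt, hGh z hz]
      have := hG z hz
      rwa [hzt, ← hGz] at this
    have := (((hGt.comp (t : ℂ) hl).sub_const (β : ℂ)).pow 2).comp_ofReal
    refine (this.congr_deriv ?_).hasDerivWithinAt
    simp [hp]
  have hKb : ∀ t ∈ Set.Ico 0 T,
      ‖2 * (G (p t) - β) * ((D (G (p t)))⁻¹ * (w - h z₀))‖ ≤ 2 * M * ‖w - h z₀‖ := by
    intro t ht
    obtain ⟨z, hz, hzt⟩ := hbelow t ht
    rw [← hzt, hGh z hz]
    have h1 : 0 < ‖D z‖ := norm_pos_iff.2 (hD0 z hz)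
    have h2 : ‖z - β‖ * ‖D z‖⁻¹ ≤ M := by
      rw [← div_eq_mul_inv, div_le_iff₀ h1]
      exact hM z hz.1.le
    calc ‖2 * (z - β) * ((D z)⁻¹ * (w - h z₀))‖ = 2 * (‖z - β‖ * ‖D z‖⁻¹) * ‖w - h z₀‖ := by
          simp only [norm_mul, norm_inv, Complex.norm_ofNat]; ring
      _ ≤ 2 * M * ‖w - h z₀‖ := by gcongr
  set B : ℝ := ‖(G (p 0) - β) ^ 2‖ + 2 * M * ‖w - h z₀‖
  have hGb : ∀ t ∈ Set.Ico 0 T, ‖G (p t) - β‖ ≤ B + 1 := by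
    intro t ht
    have h1 := Convex.norm_image_sub_le_of_norm_hasDerivWithin_le hK hKb (convex_Ico 0 T)
      (Set.left_mem_Ico.2 hT0) ht
    have h2 : ‖t - 0‖ ≤ 1 := by
      rw [sub_zero, Real.norm_of_nonneg ht.1]
      exact ht.2.le.trans hT.2
    have h3 : ‖(G (p t) - β) ^ 2‖ ≤ B := by
      have h4 := norm_le_norm_add_norm_sub' ((G (p t) - β) ^ 2) ((G (p 0) - β) ^ 2)
      have h5 : 2 * M * ‖w - h z₀‖ * ‖t - 0‖ ≤ 2 * M * ‖w - h z₀‖ :=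
        mul_le_of_le_one_right (by positivity) h2
      linarith
    rw [norm_pow] at h3
    nlinarith [norm_nonneg (G (p t) - β)]
  set C : Set ℂ := {z | β ≤ z.re ∧ 0 ≤ z.im} ∩ Metric.closedBall (β : ℂ) (B + 1)
  have hCcomp : IsCompact C := (isCompact_closedBall _ _).inter_left
    ((isClosed_le continuous_const Complex.continuous_re).inter
      (isClosed_le continuous_const Complex.continuous_im))
  have himC : IsClosed (h '' C) := (hCcomp.image_of_continuousOn fun z hz =>
    (hd z hz.1.1).continuousAt.continuousWithinAt).isClosed
  have hTC : p T ∈ h '' C := by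
    have hcl : T ∈ closure (Set.Ico 0 T) := by
      rw [closure_Ico hT0.ne]
      exact Set.right_mem_Icc.2 hT0.le
    refine himC.closure_subset_iff.2 ?_ (image_closure_subset_closure_image hpc ⟨T, hcl, rfl⟩)
    rintro _ ⟨t, ht, rfl⟩
    obtain ⟨z, hz, hzt⟩ := hbelow t ht
    refine ⟨z, ⟨⟨hz.1.le, hz.2.le⟩, ?_⟩, hzt⟩
    have := hGb t ht
    rw [← hzt, hGh z hz] at this
    simpa [dist_eq_norm] using this
  obtain ⟨z, ⟨⟨hzre, hzim⟩, -⟩, hzT⟩ := hTC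
  have hpos := hpim T hT
  rw [← hzT] at hpos
  refine hTn ⟨z, ⟨hzre.lt_of_ne fun h0 => ?_, hzim.lt_of_ne fun h0 => ?_⟩, hzT⟩
  · exact absurd (im_nonpos_of_re_eq hd hreal hline h0.symm hzim) (not_le.2 hpos)
  · have h1 : (z.re : ℂ) = z := Complex.ext rfl (by simpa using h0)
    have := hreal z.re hzre
    rw [h1] at this
    exact hpos.ne' this

end HalfPlane

lemma surjOn_of_sub_le_mul_deriv {H H' : ℝ → ℝ} {β M : ℝ} (hM0 : 0 < M)
    (hH : ∀ x, β ≤ x → HasDerivAt H (H' x) x) (hM : ∀ x, β < x → x - β ≤ M * H' x) :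
    Set.SurjOn H (Set.Ioi β) (Set.Ioi (H β)) := by
  intro y hy
  have hy : H β < y := hy
  have hmono : MonotoneOn (fun x => H x - (x - β) ^ 2 / (2 * M)) (Set.Ici β) := by
    have hd : ∀ x, β ≤ x →
        HasDerivAt (fun x => H x - (x - β) ^ 2 / (2 * M)) (H' x - (x - β) / M) x := by
      intro x hx
      have h1 : HasDerivAt (fun x : ℝ => (x - β) ^ 2 / (2 * M)) ((x - β) / M) x := by
        refine ((((hasDerivAt_id x).sub_const β).pow 2).div_const (2 * M)).congr_deriv ?_
        simp
        field_simp
      exact (hH x hx).sub h1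
    refine monotoneOn_of_hasDerivWithinAt_nonneg (convex_Ici β)
      (fun x hx => (hd x hx).continuousAt.continuousWithinAt)
      (fun x hx => (hd x (interior_subset hx)).hasDerivWithinAt) fun x hx => ?_
    rw [interior_Ici] at hx
    rw [sub_nonneg, div_le_iff₀' hM0]
    exact hM x hx
  set s := 2 * M * (y - H β) + 1
  have hMs : 0 < 2 * M * (y - H β) := by have := sub_pos.2 hy; positivity
  have hs : 1 ≤ s := by linarith
  have h1 := hmono (Set.self_mem_Ici) (show β + s ∈ Set.Ici β by simp; linarith)
    (by linarith : β ≤ β + s)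
  have h2 : y - H β ≤ s ^ 2 / (2 * M) := by
    rw [le_div_iff₀ (by positivity)]
    nlinarith
  have h3 : y ≤ H (β + s) := by
    simp at h1
    linarith
  obtain ⟨x, hx, hxy⟩ := intermediate_value_Icc (by linarith : β ≤ β + s)
    (fun x hx => (hH x hx.1).continuousAt.continuousWithinAt) ⟨hy.le, h3⟩
  refine ⟨x, hx.1.lt_of_ne ?_, hxy⟩
  rintro rfl
  exact hy.ne hxy

section Inverse

variable {h D : ℂ → ℂ} {β : ℝ} (hd : ∀ z, β ≤ z.re → HasDerivAt h (D z) z)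
  (hconj : ∀ z, β ≤ z.re → h (starRingEnd ℂ z) = starRingEnd ℂ (h z))
  (hreal : ∀ x : ℝ, β ≤ x → (h x).im = 0)
  (him : ∀ z, β < z.re → 0 < z.im → 0 < (D z).im)
  (hre : ∀ x : ℝ, β < x → 0 < (D x).re)

/-- The part of the half plane `Re z > β` which `exp ∘ h` maps bijectively onto a cut plane. -/
def logPreimage (h : ℂ → ℂ) (β : ℝ) : Set ℂ :=
  {z | β < z.re ∧ |(h z).im| < Real.pi ∧ (z.im = 0 ∨ 0 < z.im * (h z).im)}

lemma ofReal_mem_logPreimage (hreal : ∀ x : ℝ, β ≤ x → (h x).im = 0) {x : ℝ} (hx : β < x) :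
    (x : ℂ) ∈ logPreimage h β :=
  ⟨by simpa using hx, by simp [hreal x hx.le, Real.pi_pos], Or.inl (by simp)⟩

include hd hreal hre in
lemma isOpen_logPreimage : IsOpen (logPreimage h β) := by
  rw [isOpen_iff_eventually]
  rintro z ⟨hz, hpi, hsgn⟩
  have hc : ContinuousAt h z := (hd z hz.le).continuousAt
  have hci : ContinuousAt (fun z => (h z).im) z := Complex.continuous_im.continuousAt.comp hc
  have h1 : ∀ᶠ w in nhds z, β < w.re :=
    (isOpen_lt continuous_const Complex.continuous_re).mem_nhds hz
  have h2 : ∀ᶠ w in nhds z, |(h w).im| < Real.pi := hci.abs.eventually_lt_const hpi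
  have h3 : ∀ᶠ w in nhds z, w.im = 0 ∨ 0 < w.im * (h w).im := by
    rcases hsgn with h0 | h0
    · have hzr : (z.re : ℂ) = z := Complex.ext rfl (by simpa using h0.symm)
      have := eventually_im_mul_im_pos hd hreal hz (hre _ hz)
      rwa [hzr] at this
    · filter_upwards [(Complex.continuous_im.continuousAt.mul hci).eventually_const_lt h0]
        with w hw using Or.inr hw
  filter_upwards [h1, h2, h3] with w k1 k2 k3 using ⟨k1, k2, k3⟩

include hreal in
lemma im_eq_zero_iff_of_mem_logPreimage {z : ℂ} (hz : z ∈ logPreimage h β) :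
    z.im = 0 ↔ (h z).im = 0 := by
  refine ⟨fun h0 => ?_, fun h0 => ?_⟩
  · have hzr : (z.re : ℂ) = z := Complex.ext rfl (by simpa using h0.symm)
    rw [← hzr]
    exact hreal _ hz.1.le
  · rcases hz.2.2 with h1 | h1
    · exact h1
    · simp [h0] at h1

include hreal in
lemma im_pos_iff_of_mem_logPreimage {z : ℂ} (hz : z ∈ logPreimage h β) :
    0 < z.im ↔ 0 < (h z).im := by
  rcases hz.2.2 with h1 | h1
  · simp [h1, (im_eq_zero_iff_of_mem_logPreimage hreal hz).1 h1]
  · exact pos_iff_pos_of_mul_pos h1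

include hd hconj hreal him hre in
lemma injOn_logPreimage : Set.InjOn h (logPreimage h β) := by
  have hQ : Set.InjOn h {z | β < z.re ∧ 0 < z.im} :=
    injOn_of_re_mul_deriv_pos ((convex_halfSpace_re_gt β).inter (convex_halfSpace_im_gt 0))
      (fun z hz => hd z hz.1.le) (-I) fun z hz => by simpa using him z hz.1 hz.2
  intro z₁ h₁ z₂ h₂ heq
  have e₁ := im_eq_zero_iff_of_mem_logPreimage hreal h₁
  have e₂ := im_eq_zero_iff_of_mem_logPreimage hreal h₂
  have p₁ := im_pos_iff_of_mem_logPreimage hreal h₁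
  have p₂ := im_pos_iff_of_mem_logPreimage hreal h₂
  rw [← heq] at e₂ p₂
  rcases lt_trichotomy z₁.im 0 with hy | hy | hy
  · have hy₂ : z₂.im < 0 :=
      lt_of_le_of_ne (not_lt.1 fun h0 => absurd (p₁.2 (p₂.1 h0)) hy.not_gt)
        fun h0 => hy.ne (e₁.2 (e₂.1 h0))
    refine (starRingEnd ℂ).injective (hQ ⟨by simpa using h₁.1, by simpa using hy⟩
      ⟨by simpa using h₂.1, by simpa using hy₂⟩ ?_)
    rw [hconj _ h₁.1.le, hconj _ h₂.1.le, heq]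
  · have hR : Set.InjOn h {z | β < z.re ∧ z.im = 0} := by
      refine injOn_of_re_mul_deriv_pos
        ((convex_halfSpace_re_gt β).inter (convex_hyperplane Complex.imLm.isLinear 0))
        (fun z hz => hd z hz.1.le) 1 fun z hz => ?_
      have hzr : (z.re : ℂ) = z := Complex.ext rfl (by simpa using hz.2.symm)
      have := hre z.re hz.1
      rwa [hzr, ← one_mul (D z)] at this
    exact hR ⟨h₁.1, hy⟩ ⟨h₂.1, e₂.2 (e₁.1 hy)⟩ heq
  · exact hQ ⟨h₁.1, hy⟩ ⟨h₂.1, p₂.2 (p₁.1 hy)⟩ heq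

lemma log_exp_of_mem_logPreimage {z : ℂ} (hz : z ∈ logPreimage h β) :
    Complex.log (Complex.exp (h z)) = h z :=
  Complex.log_exp (abs_lt.1 hz.2.1).1 (abs_lt.1 hz.2.1).2.le

include hd hconj hreal him hre in
lemma injOn_exp_logPreimage : Set.InjOn (fun z => Complex.exp (h z)) (logPreimage h β) := by
  intro z₁ h₁ z₂ h₂ heq
  refine injOn_logPreimage hd hconj hreal him hre h₁ h₂ ?_
  rw [← log_exp_of_mem_logPreimage h₁, ← log_exp_of_mem_logPreimage h₂]
  exact congrArg Complex.log heq

include hd hconj hreal him hre in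
lemma exists_mem_logPreimage_exp_eq (hline : ∀ z, z.re = β → (D z).re ≤ 0)
    (hDreal : ∀ x : ℝ, β < x → (D x).im = 0)
    {M : ℝ} (hM0 : 0 < M) (hM : ∀ z : ℂ, β ≤ z.re → ‖z - β‖ ≤ M * ‖D z‖)
    {w : ℂ} (hw : w.im ≠ 0 ∨ Real.exp (h β).re < w.re) :
    ∃ z ∈ logPreimage h β, Complex.exp (h z) = w := by
  have hpos : ∀ w : ℂ, 0 < w.im →
      ∃ z, β < z.re ∧ 0 < z.im ∧ h z = Complex.log w ∧ 0 < (h z).im ∧ (h z).im < Real.pi := by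
    intro w hw
    have h1 : 0 < (Complex.log w).im := by
      rw [Complex.log_im]
      refine (Complex.arg_nonneg_iff.2 hw.le).lt_of_ne fun h0 => ?_
      exact hw.ne' (Complex.arg_eq_zero_iff.1 h0.symm).2
    obtain ⟨z, hz, hy, hzw⟩ := exists_quarterPlane_eq hd hreal hline him hre hM0 hM h1
    refine ⟨z, hz, hy, hzw, hzw ▸ h1, ?_⟩
    rw [hzw, Complex.log_im]
    exact Complex.arg_lt_pi_iff.2 (Or.inr hw.ne')
  rcases lt_trichotomy w.im 0 with h0 | h0 | h0
  · obtain ⟨z, hz, hy, hzw, hv, hv'⟩ := hpos (starRingEnd ℂ w) (by simpa using h0)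
    have hc := hconj z hz.le
    refine ⟨starRingEnd ℂ z, ⟨by simpa using hz, ?_, Or.inr ?_⟩, ?_⟩
    · rw [hc, Complex.conj_im, abs_neg, abs_of_pos hv]
      exact hv'
    · rw [hc, Complex.conj_im, Complex.conj_im, neg_mul_neg]
      exact mul_pos hy hv
    · rw [hc, Complex.exp_conj, hzw, Complex.exp_log (by
        rintro h1
        simp [(map_eq_zero (starRingEnd ℂ)).1 h1] at h0), Complex.conj_conj]
  · have hw := hw.resolve_left (not_not.2 h0)
    have hw0 : 0 < w.re := (Real.exp_pos _).trans hw
    obtain ⟨x, hx, hxw⟩ := surjOn_of_sub_le_mul_deriv (H := fun x : ℝ => (h x).re)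
      (H' := fun x : ℝ => (D x).re) (β := β) hM0
      (fun x hx => (hd x (by simpa using hx)).real_of_complex)
      (fun x hx => by
        have h1 := hM x (by simpa using hx.le)
        have h2 : D x = ((D x).re : ℂ) := Complex.ext rfl (by simpa using hDreal x hx)
        rw [h2, Complex.norm_real, Real.norm_of_nonneg (hre x hx).le, ← Complex.ofReal_sub,
          Complex.norm_real, Real.norm_of_nonneg (sub_pos.2 hx).le] at h1
        exact h1)
      ((Real.lt_log_iff_exp_lt hw0).2 hw)
    have hx : β < x := hx
    refine ⟨x, ofReal_mem_logPreimage hreal hx, ?_⟩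
    have h1 : h x = ((Real.log w.re : ℝ) : ℂ) :=
      Complex.ext hxw (by simpa using hreal x hx.le)
    rw [h1, ← Complex.ofReal_exp, Real.exp_log hw0]
    exact Complex.ext rfl (by simpa using h0.symm)
  · obtain ⟨z, hz, hy, hzw, hv, hv'⟩ := hpos w h0
    refine ⟨z, ⟨hz, by rwa [abs_of_pos hv], Or.inr (mul_pos hy hv)⟩, ?_⟩
    rw [hzw, Complex.exp_log]
    rintro rfl
    simp at h0

end Inverse

/-- Let `r ≥ 1` and suppose `f` decreases strictly on `(α,β)` and
increases strictly on `(β,∞)` for some `0 < α < β`.  Then the inverse of `f` on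
`(f(β),∞)` extends to an injective holomorphic (univalent Pick) function `F` on
`ℂ ∖ (−∞, f(β)]`: `F` is real and strictly increasing on `(f(β),∞)` with image
`(β,∞)`, `f(F(w)) = w` on the cut plane, and `Im F(z) > 0` whenever `Im z > 0`. -/
theorem genus2_inverse_pick (r : ℕ) (hr : 1 ≤ r) (a b : ℝ) (lam : ℕ → ℝ)
    (hpos : ∀ k, 0 < lam k) (hmono : Monotone lam)
    (hdiv : ¬ Summable (fun k => 1 / lam k ^ 2))
    (hsum : Summable (fun k => 1 / lam k ^ 3))
    (α β : ℝ) (hα : 0 < α) (hαβ : α < β)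
    (hdec : StrictAntiOn (fun x : ℝ => (genus2fun r a b lam (x : ℂ)).re) (Set.Ioo α β))
    (hinc : StrictMonoOn (fun x : ℝ => (genus2fun r a b lam (x : ℂ)).re) (Set.Ioi β)) :
    ∃ F : ℂ → ℂ,
      Set.InjOn F {z : ℂ | z.im ≠ 0 ∨ (genus2fun r a b lam (β : ℂ)).re < z.re} ∧
      DifferentiableOn ℂ F
        {z : ℂ | z.im ≠ 0 ∨ (genus2fun r a b lam (β : ℂ)).re < z.re} ∧
      (∀ x : ℝ, (genus2fun r a b lam (β : ℂ)).re < x → (F (x : ℂ)).im = 0) ∧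
      StrictMonoOn (fun x : ℝ => (F (x : ℂ)).re)
        (Set.Ioi ((genus2fun r a b lam (β : ℂ)).re)) ∧
      (fun x : ℝ => (F (x : ℂ)).re) '' Set.Ioi ((genus2fun r a b lam (β : ℂ)).re) =
        Set.Ioi β ∧
      (∀ w : ℂ, (w.im ≠ 0 ∨ (genus2fun r a b lam (β : ℂ)).re < w.re) →
        genus2fun r a b lam (F w) = w) ∧
      (∀ z : ℂ, 0 < z.im → 0 < (F z).im) := by
  obtain ⟨hDβ, γ, hγ, hγβ, hDγ⟩ :=
    exists_genus2logDeriv_eq_zero hpos hmono hsum hr hα hαβ hdec hinc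
  have hβ : 0 < β := hα.trans hαβ
  set h := genus2log r a b lam
  set D := genus2logDeriv r a b lam with hD
  have hd : ∀ z, β ≤ z.re → HasDerivAt h (D z) z := fun z hz =>
    hasDerivAt_genus2log hpos hmono hsum (hβ.trans_le hz)
  have hconj : ∀ z, β ≤ z.re → h (starRingEnd ℂ z) = starRingEnd ℂ (h z) := fun z hz =>
    genus2log_conj hpos (hβ.trans_le hz)
  have hreal : ∀ x : ℝ, β ≤ x → (h x).im = 0 := fun x hx =>
    genus2log_ofReal_im hpos (hβ.trans_le hx)
  have him : ∀ z, β < z.re → 0 < z.im → 0 < (D z).im := fun z hz hy =>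
    genus2logDeriv_im_pos hr hpos hmono hsum hγ hγβ hDγ hDβ hz.le hy
  have hre : ∀ x : ℝ, β < x → 0 < (D x).re := fun x hx =>
    genus2logDeriv_re_pos hr hpos hmono hsum hγ hγβ hDγ hDβ hx
  have hline : ∀ z, z.re = β → (D z).re ≤ 0 := fun z hz =>
    genus2logDeriv_re_nonpos hr hpos hmono hsum hγ hγβ hDγ hDβ hz
  have hDreal : ∀ x : ℝ, β < x → (D x).im = 0 := fun x _ => by
    rw [hD, genus2logDeriv_ofReal, Complex.ofReal_im]
  obtain ⟨M, hM0, hM⟩ :=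
    exists_norm_sub_le_mul_norm_genus2logDeriv hr hpos hmono hsum hγ hγβ hDγ hDβ
  have hexp : ∀ z ∈ logPreimage h β, Complex.exp (h z) = genus2fun r a b lam z := fun z hz =>
    exp_genus2log hpos hmono hsum (hβ.trans hz.1)
  have hfre : ∀ x : ℝ, β ≤ x → (genus2fun r a b lam x).re = Real.exp (h x).re := fun x hx => by
    rw [genus2fun_ofReal hpos hmono hsum (hβ.trans_le hx), Complex.ofReal_re]
  rw [hfre β le_rfl]
  have hΩ := isOpen_logPreimage hd hreal hre
  have hinj := injOn_exp_logPreimage hd hconj hreal him hre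
  have hsurj := fun {w : ℂ} (hw : w.im ≠ 0 ∨ Real.exp (h β).re < w.re) =>
    exists_mem_logPreimage_exp_eq hd hconj hreal him hre hline hDreal hM0 hM hw
  set F : ℂ → ℂ := Function.invFunOn (fun z => Complex.exp (h z)) (logPreimage h β)
  have hFmem : ∀ w : ℂ, (w.im ≠ 0 ∨ Real.exp (h β).re < w.re) → F w ∈ logPreimage h β :=
    fun w hw => Function.invFunOn_mem (hsurj hw)
  have hFexp : ∀ w : ℂ, (w.im ≠ 0 ∨ Real.exp (h β).re < w.re) → Complex.exp (h (F w)) = w :=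
    fun w hw => Function.invFunOn_eq (hsurj hw)
  have hFleft : ∀ z ∈ logPreimage h β, F (Complex.exp (h z)) = z := fun z hz =>
    hinj.leftInvOn_invFunOn hz
  have hFlog : ∀ w : ℂ, (w.im ≠ 0 ∨ Real.exp (h β).re < w.re) → h (F w) = Complex.log w := by
    intro w hw
    rw [← log_exp_of_mem_logPreimage (hFmem w hw), hFexp w hw]
  have hFreal : ∀ x : ℝ, Real.exp (h β).re < x → (F x).im = 0 := fun x hx => by
    have hx' : (x : ℂ).im ≠ 0 ∨ Real.exp (h β).re < (x : ℂ).re := Or.inr (by simpa using hx)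
    rw [im_eq_zero_iff_of_mem_logPreimage hreal (hFmem x hx'), hFlog x hx', Complex.log_im]
    exact Complex.arg_ofReal_of_nonneg ((Real.exp_pos _).trans hx).le
  have hFre : ∀ x : ℝ, Real.exp (h β).re < x →
      β < (F x).re ∧ (genus2fun r a b lam ((F x).re : ℂ)).re = x := fun x hx => by
    have hx' : (x : ℂ).im ≠ 0 ∨ Real.exp (h β).re < (x : ℂ).re := Or.inr (by simpa using hx)
    have h1 : ((F x).re : ℂ) = F x := Complex.ext rfl (by simpa using (hFreal x hx).symm)
    refine ⟨(hFmem x hx').1, ?_⟩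
    rw [h1, ← hexp _ (hFmem x hx'), hFexp x hx', Complex.ofReal_re]
  refine ⟨F, ?_, ?_, hFreal, ?_, ?_, ?_, ?_⟩
  · intro w₁ h₁ w₂ h₂ heq
    rw [← hFexp w₁ h₁, ← hFexp w₂ h₂, heq]
  · intro w hw
    have hz := hFmem w hw
    have hdiff : DifferentiableOn ℂ h (logPreimage h β) := fun z hz =>
      (hd z hz.1.le).differentiableAt.differentiableWithinAt
    have hs := (hdiff.analyticAt (hΩ.mem_nhds hz)).hasStrictDerivAt.cexp
    rw [(hd _ hz.1.le).deriv] at hs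
    have hD0 : D (F w) ≠ 0 := by
      intro h0
      have h1 := hM _ hz.1.le
      rw [← hD, h0, norm_zero, mul_zero] at h1
      have h2 := sub_eq_zero.1 (norm_le_zero_iff.1 h1)
      have h3 := hz.1
      rw [h2, Complex.ofReal_re] at h3
      exact lt_irrefl _ h3
    have hF := hs.to_local_left_inverse (mul_ne_zero (Complex.exp_ne_zero _) hD0)
      (Filter.eventually_of_mem (hΩ.mem_nhds hz) hFleft)
    rw [hFexp w hw] at hF
    exact hF.hasDerivAt.differentiableAt.differentiableWithinAt
  · intro x hx y hy hxy
    obtain ⟨hx1, hx2⟩ := hFre x hx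
    obtain ⟨hy1, hy2⟩ := hFre y hy
    refine (hinc.lt_iff_lt hx1 hy1).1 ?_
    simpa only [hx2, hy2] using hxy
  · ext t
    refine ⟨?_, fun ht => ?_⟩
    · rintro ⟨x, hx, rfl⟩
      exact (hFre x hx).1
    · have ht : β < t := ht
      have hmem := ofReal_mem_logPreimage hreal ht
      have hHmono : StrictMonoOn (fun x : ℝ => (h x).re) (Set.Ici β) := by
        have hH : ∀ x : ℝ, β ≤ x → HasDerivAt (fun x : ℝ => (h x).re) (D x).re x := fun x hx =>
          (hd x (by simpa using hx)).real_of_complex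
        refine strictMonoOn_of_hasDerivWithinAt_pos (convex_Ici β)
          (fun x hx => (hH x hx).continuousAt.continuousWithinAt)
          (fun x hx => (hH x (interior_subset hx)).hasDerivWithinAt) fun x hx => ?_
        rw [interior_Ici] at hx
        exact hre x hx
      refine ⟨Real.exp (h t).re,
        Real.exp_lt_exp.2 (hHmono Set.self_mem_Ici ht.le ht), ?_⟩
      have h1 : ((Real.exp (h t).re : ℝ) : ℂ) = Complex.exp (h t) := by
        rw [hexp _ hmem, genus2fun_ofReal hpos hmono hsum (hβ.trans ht)]
      show (F ((Real.exp (h t).re : ℝ) : ℂ)).re = t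
      rw [h1, hFleft _ hmem, Complex.ofReal_re]
  · intro w hw
    rw [← hexp _ (hFmem w hw), hFexp w hw]
  · intro w hw
    have hw' : w.im ≠ 0 ∨ Real.exp (h β).re < w.re := Or.inl hw.ne'
    rw [im_pos_iff_of_mem_logPreimage hreal (hFmem w hw'), hFlog w hw', Complex.log_im]
    refine (Complex.arg_nonneg_iff.2 hw.le).lt_of_ne fun h0 => ?_
    exact hw.ne' (Complex.arg_eq_zero_iff.1 h0.symm).2
end

section
/- There exist 0 < α_G < β_G such that Barnes' G-function is strictly decreasing on (α_G, β_G) and strictly increasing on (β_G, ∞), and there exists an injective holomorphic function F on ℂ ∖ (−∞, G(β_G)] such that F is real-valued and strictly increasing on (G(β_G), ∞) with image (β_G, ∞), G(F(w)) = w for every w ∈ ℂ ∖ (−∞, G(β_G)], and Im F(z) > 0 whenever Im z > 0; i.e., the inverse of G on (G(β_G),∞) extends to a univalent Pick function. -/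
open Complex

/-- Barnes' `G`-function:
`G(z) = (2π)^{(z−1)/2} e^{−((1+γ)(z−1)² + (z−1))/2}
  ∏_k (1 + (z−1)/k)^k e^{−(z−1) + (z−1)²/(2k)}`. -/
noncomputable def barnesG (z : ℂ) : ℂ :=
  (2 * Real.pi : ℂ) ^ ((z - 1) / 2) *
    Complex.exp (-((1 + (Real.eulerMascheroniConstant : ℂ)) * (z - 1) ^ 2 + (z - 1)) / 2) *
    ∏' k : ℕ, ((1 + (z - 1) / ((k : ℂ) + 1)) ^ (k + 1) *
      Complex.exp (-(z - 1) + (z - 1) ^ 2 / (2 * ((k : ℂ) + 1))))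

open Filter Topology ComplexConjugate

/-! ### The logarithm of Barnes' function in the variable `ζ = z - 1` -/

/-- The logarithm of the `k`-th factor of the product defining `barnesG (1 + ζ)`. -/
noncomputable def logBarnesTerm (k : ℕ) (ζ : ℂ) : ℂ :=
  ((k : ℂ) + 1) * log (1 + ζ / ((k : ℂ) + 1)) + (-ζ + ζ ^ 2 / (2 * ((k : ℂ) + 1)))

/-- The branch of `log (barnesG (1 + ζ))` that is real on the positive half-line. -/
noncomputable def logBarnes (ζ : ℂ) : ℂ :=
  (Real.log (2 * Real.pi) : ℂ) * (ζ / 2) +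
    -((1 + (Real.eulerMascheroniConstant : ℂ)) * ζ ^ 2 + ζ) / 2 + ∑' k, logBarnesTerm k ζ

/-- The derivative of `logBarnes`. -/
noncomputable def logBarnesDeriv (ζ : ℂ) : ℂ :=
  ((Real.log (2 * Real.pi) - 1) / 2 : ℝ) - (1 + (Real.eulerMascheroniConstant : ℂ)) * ζ +
    ∑' k : ℕ, ζ ^ 2 / (((k : ℂ) + 1) * ((k : ℂ) + 1 + ζ))

lemma summable_const_div_succ_sq (C : ℝ) : Summable fun k : ℕ => C / ((k : ℝ) + 1) ^ 2 := by
  have h := (summable_nat_add_iff 1).2 (Real.summable_one_div_nat_pow.2 (one_lt_two))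
  simpa [div_eq_mul_inv] using h.mul_left C

lemma half_succ_le_norm_succ_add {ζ : ℂ} (h : -(1 / 2) < ζ.re) (k : ℕ) :
    ((k : ℝ) + 1) / 2 ≤ ‖(k : ℂ) + 1 + ζ‖ := by
  have h1 := re_le_norm ((k : ℂ) + 1 + ζ)
  have hk : (0 : ℝ) ≤ k := k.cast_nonneg
  simp at h1
  linarith

lemma succ_add_ne_zero {ζ : ℂ} (h : -(1 / 2) < ζ.re) (k : ℕ) : (k : ℂ) + 1 + ζ ≠ 0 := by
  have := half_succ_le_norm_succ_add h k
  rw [← norm_pos_iff]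
  have hk : (0 : ℝ) ≤ k := k.cast_nonneg
  linarith

lemma norm_logBarnesDeriv_term_le {ζ : ℂ} (h : -(1 / 2) < ζ.re) (k : ℕ) :
    ‖ζ ^ 2 / (((k : ℂ) + 1) * ((k : ℂ) + 1 + ζ))‖ ≤ 2 * ‖ζ‖ ^ 2 / ((k : ℝ) + 1) ^ 2 := by
  have h1 := half_succ_le_norm_succ_add h k
  have hk : (0 : ℝ) < (k : ℝ) + 1 := by positivity
  have hn : ‖(k : ℂ) + 1‖ = (k : ℝ) + 1 := by
    exact_mod_cast Complex.norm_natCast (k + 1)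
  rw [norm_div, norm_mul, norm_pow, hn, div_le_div_iff₀ (by nlinarith) (by positivity)]
  nlinarith [mul_le_mul_of_nonneg_left h1 (mul_nonneg (sq_nonneg ‖ζ‖) hk.le)]

lemma summable_logBarnesDeriv_term {ζ : ℂ} (h : -(1 / 2) < ζ.re) :
    Summable fun k : ℕ => ζ ^ 2 / (((k : ℂ) + 1) * ((k : ℂ) + 1 + ζ)) :=
  .of_norm_bounded (summable_const_div_succ_sq _) (norm_logBarnesDeriv_term_le h)

lemma one_add_div_succ_mem_slitPlane {ζ : ℂ} (h : -(1 / 2) < ζ.re) (k : ℕ) :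
    1 + ζ / ((k : ℂ) + 1) ∈ slitPlane := by
  left
  have hk : (0 : ℝ) ≤ k := k.cast_nonneg
  have : (ζ / ((k : ℂ) + 1)).re = ζ.re / ((k : ℝ) + 1) := by
    exact_mod_cast div_natCast_re ζ (k + 1)
  rw [add_re, one_re, this]
  have : -1 < ζ.re / ((k : ℝ) + 1) := by
    rw [lt_div_iff₀ (by positivity)]
    linarith
  linarith

lemma hasDerivAt_logBarnesTerm {ζ : ℂ} (h : -(1 / 2) < ζ.re) (k : ℕ) :
    HasDerivAt (logBarnesTerm k) (ζ ^ 2 / (((k : ℂ) + 1) * ((k : ℂ) + 1 + ζ))) ζ := by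
  have hk : (k : ℂ) + 1 ≠ 0 := Nat.cast_add_one_ne_zero k
  have h1 := succ_add_ne_zero h k
  have h2 := one_add_div_succ_mem_slitPlane h k
  have h3 := slitPlane_ne_zero h2
  have hd : HasDerivAt (fun ζ : ℂ => 1 + ζ / ((k : ℂ) + 1)) (1 / ((k : ℂ) + 1)) ζ :=
    ((hasDerivAt_id ζ).div_const _).const_add _
  have := ((hd.clog h2).const_mul ((k : ℂ) + 1)).add
    ((hasDerivAt_id ζ).neg.add ((hasDerivAt_pow 2 ζ).div_const (2 * ((k : ℂ) + 1))))
  refine this.congr_deriv ?_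
  have h4 : 1 + ζ / ((k : ℂ) + 1) = ((k : ℂ) + 1 + ζ) / ((k : ℂ) + 1) := by field_simp
  rw [h4]
  field_simp
  push_cast
  ring

lemma logBarnesTerm_zero (k : ℕ) : logBarnesTerm k 0 = 0 := by simp [logBarnesTerm]

/-- A bounded convex neighbourhood of `0` and `ζ` on which the logarithmic series can be
differentiated termwise. -/
lemma exists_bounded_domain {ζ : ℂ} (h : -(1 / 2) < ζ.re) :
    ∃ t : Set ℂ, IsOpen t ∧ IsPreconnected t ∧ 0 ∈ t ∧ ζ ∈ t ∧
      (∀ y ∈ t, -(1 / 2) < y.re) ∧ ∀ y ∈ t, ‖y‖ ≤ ‖ζ‖ + 1 := by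
  have hconv : Convex ℝ ({y : ℂ | -(1 / 2) < y.re} ∩ Metric.ball 0 (‖ζ‖ + 1)) :=
    (convex_halfSpace_re_gt _).inter (convex_ball _ _)
  refine ⟨_, (isOpen_lt continuous_const continuous_re).inter Metric.isOpen_ball,
    hconv.isPreconnected, ⟨by simp, ?_⟩, ⟨h, by simp⟩, fun y hy => hy.1, fun y hy => ?_⟩
  · simp only [Metric.mem_ball, dist_self]; positivity
  · simpa using (Metric.mem_ball.1 hy.2).le

lemma summable_logBarnesTerm {ζ : ℂ} (h : -(1 / 2) < ζ.re) :
    Summable fun k => logBarnesTerm k ζ := by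
  obtain ⟨t, ho, hc, h0, hζ, hre, hb⟩ := exists_bounded_domain h
  refine summable_of_summable_hasDerivAt_of_isPreconnected
    (summable_const_div_succ_sq (2 * (‖ζ‖ + 1) ^ 2)) ho hc
    (fun k y hy => hasDerivAt_logBarnesTerm (hre y hy) k) (fun k y hy => ?_) h0
    (by simp [logBarnesTerm_zero]) hζ
  refine (norm_logBarnesDeriv_term_le (hre y hy) k).trans ?_
  gcongr
  exact hb y hy

lemma hasDerivAt_logBarnes {ζ : ℂ} (h : -(1 / 2) < ζ.re) :
    HasDerivAt logBarnes (logBarnesDeriv ζ) ζ := by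
  obtain ⟨t, ho, hc, h0, hζ, hre, hb⟩ := exists_bounded_domain h
  have hs : HasDerivAt (fun ζ => ∑' k, logBarnesTerm k ζ)
      (∑' k : ℕ, ζ ^ 2 / (((k : ℂ) + 1) * ((k : ℂ) + 1 + ζ))) ζ := by
    refine hasDerivAt_tsum_of_isPreconnected
      (summable_const_div_succ_sq (2 * (‖ζ‖ + 1) ^ 2)) ho hc
      (fun k y hy => hasDerivAt_logBarnesTerm (hre y hy) k) (fun k y hy => ?_) h0
      (by simp [logBarnesTerm_zero]) hζ
    refine (norm_logBarnesDeriv_term_le (hre y hy) k).trans ?_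
    gcongr
    exact hb y hy
  have h1 := (((hasDerivAt_id ζ).div_const 2).const_mul (Real.log (2 * Real.pi) : ℂ)).add
    ((((hasDerivAt_pow 2 ζ).const_mul
      (1 + (Real.eulerMascheroniConstant : ℂ))).add (hasDerivAt_id ζ)).neg.div_const 2)
  refine (h1.add hs).congr_deriv ?_
  rw [logBarnesDeriv]
  push_cast
  ring

lemma barnesG_eq_exp_logBarnes {z : ℂ} (h : 1 / 2 < z.re) :
    barnesG z = exp (logBarnes (z - 1)) := by
  have hζ : -(1 / 2) < (z - 1).re := by simp; linarith
  have hp := (summable_logBarnesTerm hζ).hasSum.cexp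
  have hterm : (exp ∘ fun k => logBarnesTerm k (z - 1)) = fun k : ℕ =>
      (1 + (z - 1) / ((k : ℂ) + 1)) ^ (k + 1) *
      Complex.exp (-(z - 1) + (z - 1) ^ 2 / (2 * ((k : ℂ) + 1))) := by
    funext k
    have hne := slitPlane_ne_zero (one_add_div_succ_mem_slitPlane hζ k)
    have := exp_nat_mul (log (1 + (z - 1) / ((k : ℂ) + 1))) (k + 1)
    push_cast at this
    rw [Function.comp_apply, logBarnesTerm, exp_add, this, exp_log hne]
  rw [hterm] at hp
  have h2 : (2 * Real.pi : ℂ) = ((2 * Real.pi : ℝ) : ℂ) := by push_cast; rfl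
  have h2' : (2 * Real.pi : ℂ) ≠ 0 := by simp [Real.pi_ne_zero]
  rw [barnesG, hp.tprod_eq, logBarnes, exp_add, exp_add, cpow_def_of_ne_zero h2', h2,
    ofReal_log (by positivity)]

lemma logBarnes_conj {ζ : ℂ} (h : -(1 / 2) < ζ.re) :
    logBarnes (conj ζ) = conj (logBarnes ζ) := by
  have ht (k : ℕ) : logBarnesTerm k (conj ζ) = conj (logBarnesTerm k ζ) := by
    have h1 : (1 : ℂ) + conj ζ / ((k : ℂ) + 1) = conj (1 + ζ / ((k : ℂ) + 1)) := by simp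
    rw [logBarnesTerm, logBarnesTerm, h1,
      log_conj _ (slitPlane_arg_ne_pi (one_add_div_succ_mem_slitPlane h k))]
    simp [conj_ofNat]
  simp only [logBarnes, ht, ← conj_tsum]
  simp [conj_ofNat]

lemma logBarnes_ofReal_im {x : ℝ} (h : -(1 / 2) < x) : (logBarnes x).im = 0 := by
  have := logBarnes_conj (ζ := x) (by simpa using h)
  rw [conj_ofReal] at this
  exact conj_eq_iff_im.1 this.symm

/-- The restriction of `logBarnesDeriv` to the real line. -/
lemma logBarnesDeriv_ofReal (x : ℝ) : logBarnesDeriv x =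
    (((Real.log (2 * Real.pi) - 1) / 2 - (1 + Real.eulerMascheroniConstant) * x +
      ∑' k : ℕ, x ^ 2 / (((k : ℝ) + 1) * ((k : ℝ) + 1 + x)) : ℝ) : ℂ) := by
  rw [logBarnesDeriv]
  push_cast
  rfl

lemma logBarnesDeriv_one_re_neg : (logBarnesDeriv ((1 : ℝ) : ℂ)).re < 0 := by
  rw [logBarnesDeriv_ofReal, ofReal_re]
  have hγ := Real.one_half_lt_eulerMascheroniConstant
  have hlog : Real.log (2 * Real.pi) < 2 := by
    rw [Real.log_lt_iff_lt_exp (by positivity)]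
    have := Real.pi_lt_d2
    have he := Real.exp_one_gt_d9
    have : Real.exp 2 = Real.exp 1 * Real.exp 1 := by rw [← Real.exp_add]; norm_num
    nlinarith
  have hsum : ∑' k : ℕ, (1 : ℝ) ^ 2 / (((k : ℝ) + 1) * ((k : ℝ) + 1 + 1)) ≤ 1 := by
    refine Real.tsum_le_of_sum_range_le (fun k => by positivity) fun n => ?_
    have : ∑ k ∈ Finset.range n, (1 : ℝ) ^ 2 / (((k : ℝ) + 1) * ((k : ℝ) + 1 + 1)) =
        1 - 1 / ((n : ℝ) + 1) := by
      induction n with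
      | zero => simp
      | succ n ih => rw [Finset.sum_range_succ, ih]; push_cast; field_simp; ring
    rw [this]
    have : (0 : ℝ) ≤ 1 / ((n : ℝ) + 1) := by positivity
    linarith
  linarith

lemma logBarnesDeriv_three_re_pos : 0 < (logBarnesDeriv ((3 : ℝ) : ℂ)).re := by
  have hS := summable_logBarnesDeriv_term (ζ := ((3 : ℝ) : ℂ)) (by norm_num)
  rw [logBarnesDeriv_ofReal, ofReal_re]
  have hγ := Real.eulerMascheroniConstant_lt_two_thirds
  have hlog : 1 < Real.log (2 * Real.pi) := by
    rw [Real.lt_log_iff_exp_lt (by positivity)]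
    have := Real.pi_gt_three
    have he := Real.exp_one_lt_d9
    linarith
  have hS' : Summable fun k : ℕ => (3 : ℝ) ^ 2 / (((k : ℝ) + 1) * ((k : ℝ) + 1 + 3)) := by
    rw [← Complex.summable_ofReal]
    push_cast at hS ⊢
    exact hS
  have hsum := hS'.sum_le_tsum (Finset.range 30) (fun k _ => by positivity)
  have : (5 : ℝ) ≤ ∑ k ∈ Finset.range 30,
      (3 : ℝ) ^ 2 / (((k : ℝ) + 1) * ((k : ℝ) + 1 + 3)) := by
    simp only [Finset.sum_range_succ, Finset.sum_range_zero]
    norm_num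
  linarith

lemma differentiableOn_logBarnes : DifferentiableOn ℂ logBarnes {ζ | -(1 / 2) < ζ.re} :=
  fun _ h => (hasDerivAt_logBarnes h).differentiableAt.differentiableWithinAt

lemma isOpen_neg_half_lt_re : IsOpen {ζ : ℂ | -(1 / 2) < ζ.re} :=
  isOpen_lt continuous_const continuous_re

lemma exists_logBarnesDeriv_eq_zero : ∃ b : ℝ, 1 < b ∧ logBarnesDeriv b = 0 := by
  have hc : ContinuousOn (fun x : ℝ => (logBarnesDeriv x).re) (Set.Icc 1 3) := by
    have h1 := (differentiableOn_logBarnes.deriv isOpen_neg_half_lt_re).continuousOn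
    have h2 : ContinuousOn (fun x : ℝ => (deriv logBarnes (x : ℂ)).re) (Set.Icc 1 3) := by
      refine continuous_re.comp_continuousOn (h1.comp continuous_ofReal.continuousOn ?_)
      intro x hx
      simp only [Set.mem_ofPred_eq, ofReal_re]
      linarith [hx.1]
    refine h2.congr fun x hx => ?_
    simp only
    rw [(hasDerivAt_logBarnes (ζ := x) (by rw [ofReal_re]; linarith [hx.1])).deriv]
  obtain ⟨b, hb, hb0⟩ := intermediate_value_Ioo (by norm_num) hc
    ⟨logBarnesDeriv_one_re_neg, logBarnesDeriv_three_re_pos⟩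
  refine ⟨b, hb.1, ?_⟩
  simp only [logBarnesDeriv_ofReal, ofReal_re] at hb0 ⊢
  exact congrArg _ hb0

/-! ### Factoring the critical point out of the logarithmic derivative -/

/-- The `k`-th term of the quotient of `logBarnesDeriv ζ` by `ζ - b`. -/
noncomputable def logBarnesQuotTerm (b : ℝ) (k : ℕ) (ζ : ℂ) : ℂ :=
  1 / ((k : ℂ) + 1) - ((k : ℂ) + 1) / (((k : ℂ) + 1 + ζ) * ((k : ℂ) + 1 + b))

/-- The quotient of `logBarnesDeriv ζ` by `ζ - b`, where `b` is a zero of `logBarnesDeriv`. -/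
noncomputable def logBarnesQuot (b : ℝ) (ζ : ℂ) : ℂ :=
  -(1 + (Real.eulerMascheroniConstant : ℂ)) + ∑' k : ℕ, logBarnesQuotTerm b k ζ

lemma summable_logBarnesQuotTerm {b : ℝ} (hb : 1 < b) {ζ : ℂ} (h : 1 ≤ ζ.re) :
    Summable fun k => logBarnesQuotTerm b k ζ := by
  refine .of_norm_bounded (summable_const_div_succ_sq (‖ζ + b‖ + ‖ζ * b‖)) fun k => ?_
  have hk0 : (0 : ℝ) ≤ k := k.cast_nonneg
  have hk : (k : ℂ) + 1 ≠ 0 := Nat.cast_add_one_ne_zero k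
  have h1 : (k : ℝ) + 1 ≤ ‖(k : ℂ) + 1 + ζ‖ := by
    refine le_trans ?_ (re_le_norm _)
    simp; linarith
  have h2 : (k : ℝ) + 1 ≤ ‖(k : ℂ) + 1 + b‖ := by
    refine le_trans ?_ (re_le_norm _)
    simp; linarith
  have hn : ‖(k : ℂ) + 1‖ = (k : ℝ) + 1 := by
    exact_mod_cast Complex.norm_natCast (k + 1)
  have h1' : (k : ℂ) + 1 + ζ ≠ 0 := by rw [← norm_pos_iff]; linarith
  have h2' : (k : ℂ) + 1 + b ≠ 0 := by rw [← norm_pos_iff]; linarith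
  have heq : logBarnesQuotTerm b k ζ = (((k : ℂ) + 1) * (ζ + b) + ζ * b) /
      (((k : ℂ) + 1) * (((k : ℂ) + 1 + ζ) * ((k : ℂ) + 1 + b))) := by
    rw [logBarnesQuotTerm]
    field_simp
    ring
  have hnum : ‖((k : ℂ) + 1) * (ζ + b) + ζ * b‖ ≤
      ((k : ℝ) + 1) * (‖ζ + b‖ + ‖ζ * b‖) := by
    refine (norm_add_le _ _).trans ?_
    rw [norm_mul ((k : ℂ) + 1), hn]
    nlinarith [norm_nonneg (ζ * b)]
  rw [heq, norm_div, norm_mul, norm_mul, hn]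
  calc _ ≤ ((k : ℝ) + 1) * (‖ζ + b‖ + ‖ζ * b‖) /
        (((k : ℝ) + 1) * (((k : ℝ) + 1) * ((k : ℝ) + 1))) := by gcongr
    _ = _ := by field_simp

lemma logBarnesDeriv_eq_mul_quot {b : ℝ} (hb : 1 < b) (hb0 : logBarnesDeriv b = 0)
    {ζ : ℂ} (h : 1 ≤ ζ.re) : logBarnesDeriv ζ = (ζ - b) * logBarnesQuot b ζ := by
  have hζ : -(1 / 2) < ζ.re := by linarith
  have hb' : -(1 / 2) < (b : ℂ).re := by rw [ofReal_re]; linarith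
  have hsub := (summable_logBarnesDeriv_term hζ).tsum_sub (summable_logBarnesDeriv_term hb')
  have hterm (k : ℕ) : ζ ^ 2 / (((k : ℂ) + 1) * ((k : ℂ) + 1 + ζ)) -
      (b : ℂ) ^ 2 / (((k : ℂ) + 1) * ((k : ℂ) + 1 + b)) =
      (ζ - b) * logBarnesQuotTerm b k ζ := by
    have hk : (k : ℂ) + 1 ≠ 0 := Nat.cast_add_one_ne_zero k
    have h1 := succ_add_ne_zero hζ k
    have h2 := succ_add_ne_zero hb' k
    rw [logBarnesQuotTerm]
    field_simp
    ring
  simp only [hterm, tsum_mul_left] at hsub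
  have : logBarnesDeriv ζ = logBarnesDeriv ζ - logBarnesDeriv b := by rw [hb0, sub_zero]
  rw [this, logBarnesQuot, mul_add, hsub, logBarnesDeriv, logBarnesDeriv]
  ring

lemma logBarnesQuotTerm_eq (b : ℝ) (k : ℕ) (ζ : ℂ) : logBarnesQuotTerm b k ζ =
    ((1 / ((k : ℝ) + 1) : ℝ) : ℂ) -
      ((((k : ℝ) + 1) / ((k : ℝ) + 1 + b) : ℝ) : ℂ) * ((k : ℂ) + 1 + ζ)⁻¹ := by
  rw [logBarnesQuotTerm]
  push_cast
  rw [div_mul_eq_div_div_swap, div_eq_mul_inv (_ / _) ((k : ℂ) + 1 + ζ)]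

lemma re_logBarnesQuot_one_le {b : ℝ} (hb : 1 < b) {ζ : ℂ} (h : 1 ≤ ζ.re) :
    (logBarnesQuot b 1).re ≤ (logBarnesQuot b ζ).re := by
  have h1 := summable_logBarnesQuotTerm hb (ζ := 1) (by simp)
  have h2 := summable_logBarnesQuotTerm hb h
  rw [logBarnesQuot, logBarnesQuot, add_re, add_re, re_tsum h1, re_tsum h2]
  refine add_le_add le_rfl ((hasSum_re h1.hasSum).summable.tsum_le_tsum (fun k => ?_)
    (hasSum_re h2.hasSum).summable)
  rw [logBarnesQuotTerm_eq b, logBarnesQuotTerm_eq b, sub_re, sub_re, re_ofReal_mul,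
    re_ofReal_mul]
  have hk0 : (0 : ℝ) ≤ k := k.cast_nonneg
  refine sub_le_sub_left (mul_le_mul_of_nonneg_left ?_ (by positivity)) _
  have hone : ((k : ℂ) + 1 + 1)⁻¹.re = ((k : ℝ) + 1 + 1)⁻¹ := by
    have : ((k : ℂ) + 1 + 1)⁻¹ = ((((k : ℝ) + 1 + 1)⁻¹ : ℝ) : ℂ) := by push_cast; rfl
    rw [this, ofReal_re]
  rw [hone]
  refine (re_le_norm _).trans ?_
  rw [norm_inv]
  gcongr
  refine le_trans ?_ (re_le_norm _)
  simp; linarith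

lemma logBarnesQuot_one_re_pos {b : ℝ} (hb : 1 < b) (hb0 : logBarnesDeriv b = 0) :
    0 < (logBarnesQuot b 1).re := by
  have h1 := logBarnesDeriv_eq_mul_quot hb hb0 (ζ := 1) (by simp)
  have h2 := logBarnesDeriv_one_re_neg
  rw [ofReal_one, h1, ← ofReal_one, ← ofReal_sub, re_ofReal_mul, ofReal_one] at h2
  by_contra! h
  nlinarith

lemma im_logBarnesQuot_nonneg {b : ℝ} (hb : 1 < b) {ζ : ℂ} (h : 1 ≤ ζ.re) (hi : 0 ≤ ζ.im) :
    0 ≤ (logBarnesQuot b ζ).im := by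
  have h2 := summable_logBarnesQuotTerm hb h
  have him : (-(1 + (Real.eulerMascheroniConstant : ℂ))).im = 0 := by simp
  rw [logBarnesQuot, add_im, im_tsum h2, him, zero_add]
  refine tsum_nonneg fun k => ?_
  rw [logBarnesQuotTerm_eq b, sub_im, im_ofReal_mul, ofReal_im, zero_sub, inv_im, neg_div]
  have hk0 : (0 : ℝ) ≤ k := k.cast_nonneg
  have : ((k : ℂ) + 1 + ζ).im = ζ.im := by simp
  rw [this, mul_neg, neg_neg]
  have := normSq_nonneg ((k : ℂ) + 1 + ζ)
  positivity

lemma logBarnesQuot_re_pos {b : ℝ} (hb : 1 < b) (hb0 : logBarnesDeriv b = 0) {ζ : ℂ}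
    (h : 1 ≤ ζ.re) : 0 < (logBarnesQuot b ζ).re :=
  (logBarnesQuot_one_re_pos hb hb0).trans_le (re_logBarnesQuot_one_le hb h)

/-! ### Monotonicity on the real line -/

lemma re_barnesG_ofReal {x : ℝ} (h : 1 / 2 < x) :
    (barnesG x).re = Real.exp (logBarnes ((x - 1 : ℝ) : ℂ)).re := by
  rw [barnesG_eq_exp_logBarnes (by simpa using h), ← ofReal_one, ← ofReal_sub, exp_re,
    logBarnes_ofReal_im (by linarith), Real.cos_zero, mul_one]

lemma hasDerivAt_re_logBarnes {x : ℝ} (h : -(1 / 2) < x) :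
    HasDerivAt (fun x : ℝ => (logBarnes x).re) (logBarnesDeriv x).re x :=
  (hasDerivAt_logBarnes (by simpa using h)).real_of_complex

lemma continuousOn_re_logBarnes {s : Set ℝ} (hs : ∀ x ∈ s, -(1 / 2) < x) :
    ContinuousOn (fun x : ℝ => (logBarnes x).re) s :=
  fun x hx => (hasDerivAt_re_logBarnes (hs x hx)).continuousAt.continuousWithinAt

lemma logBarnesDeriv_ofReal_re {b : ℝ} (hb : 1 < b) (hb0 : logBarnesDeriv b = 0) {x : ℝ}
    (h : 1 ≤ x) : (logBarnesDeriv x).re = (x - b) * (logBarnesQuot b x).re := by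
  rw [logBarnesDeriv_eq_mul_quot hb hb0 (by simpa using h), ← ofReal_sub, re_ofReal_mul]

lemma strictMonoOn_re_logBarnes {b : ℝ} (hb : 1 < b) (hb0 : logBarnesDeriv b = 0) :
    StrictMonoOn (fun x : ℝ => (logBarnes x).re) (Set.Ici b) := by
  refine strictMonoOn_of_deriv_pos (convex_Ici b)
    (continuousOn_re_logBarnes fun x hx => by linarith [Set.mem_Ici.1 hx]) fun x hx => ?_
  rw [interior_Ici, Set.mem_Ioi] at hx
  rw [(hasDerivAt_re_logBarnes (by linarith)).deriv,
    logBarnesDeriv_ofReal_re hb hb0 (by linarith)]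
  exact mul_pos (by linarith)
    (logBarnesQuot_re_pos hb hb0 (by rw [ofReal_re]; linarith))

lemma strictAntiOn_re_logBarnes {b : ℝ} (hb : 1 < b) (hb0 : logBarnesDeriv b = 0) :
    StrictAntiOn (fun x : ℝ => (logBarnes x).re) (Set.Icc 1 b) := by
  refine strictAntiOn_of_deriv_neg (convex_Icc 1 b)
    (continuousOn_re_logBarnes fun x hx => by linarith [hx.1]) fun x hx => ?_
  rw [interior_Icc] at hx
  rw [(hasDerivAt_re_logBarnes (by linarith [hx.1])).deriv,
    logBarnesDeriv_ofReal_re hb hb0 (by linarith [hx.1])]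
  exact mul_neg_of_neg_of_pos (by linarith [hx.2])
    (logBarnesQuot_re_pos hb hb0 (by rw [ofReal_re]; linarith [hx.1]))

lemma strictMonoOn_re_barnesG {b : ℝ} (hb : 1 < b) (hb0 : logBarnesDeriv b = 0) :
    StrictMonoOn (fun x : ℝ => (barnesG x).re) (Set.Ici (b + 1)) := by
  intro x hx y hy hxy
  rw [Set.mem_Ici] at hx hy
  simp only
  rw [re_barnesG_ofReal (by linarith), re_barnesG_ofReal (by linarith), Real.exp_lt_exp]
  exact strictMonoOn_re_logBarnes hb hb0 (Set.mem_Ici.2 (by linarith))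
    (Set.mem_Ici.2 (by linarith)) (by linarith)

lemma strictAntiOn_re_barnesG {b : ℝ} (hb : 1 < b) (hb0 : logBarnesDeriv b = 0) :
    StrictAntiOn (fun x : ℝ => (barnesG x).re) (Set.Icc 2 (b + 1)) := by
  intro x hx y hy hxy
  simp only
  rw [re_barnesG_ofReal (by linarith [hy.1]), re_barnesG_ofReal (by linarith [hx.1]),
    Real.exp_lt_exp]
  exact strictAntiOn_re_logBarnes hb hb0 ⟨by linarith [hx.1], by linarith [hx.2]⟩
    ⟨by linarith [hy.1], by linarith [hy.2]⟩ (by linarith)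

/-! ### Expansion and surjectivity on a quadrant with corner at the critical point -/

lemma logBarnes_expand_of_pos {b : ℝ} (hb : 1 < b) (hb0 : logBarnesDeriv b = 0) {v₁ v₂ : ℂ}
    (hr₁ : 0 < v₁.re) (hi₁ : 0 < v₁.im) (hr₂ : 0 < v₂.re) (hi₂ : 0 < v₂.im) :
    (logBarnesQuot b 1).re / 2 * ‖v₁ ^ 2 - v₂ ^ 2‖ ^ 2 ≤
      ((logBarnes (b + v₁) - logBarnes (b + v₂)) * conj (v₁ ^ 2 - v₂ ^ 2)).re := by
  set d := v₁ ^ 2 - v₂ ^ 2 with hd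
  have him {v : ℂ} (hr : 0 < v.re) (hi : 0 < v.im) : 0 < (v ^ 2).im := by
    rw [sq, mul_im]; nlinarith [mul_pos hr hi]
  have hu {t : ℝ} (ht : t ∈ Set.Icc (0 : ℝ) 1) : 0 < (v₂ ^ 2 + t * d).im := by
    have : (v₂ ^ 2 + t * d).im = (1 - t) * (v₂ ^ 2).im + t * (v₁ ^ 2).im := by
      rw [hd, add_im, im_ofReal_mul, sub_im]; ring
    rw [this]
    rcases ht.1.eq_or_lt with h | h
    · rw [← h]; simpa using him hr₂ hi₂
    · have := mul_pos h (him hr₁ hi₁)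
      have := mul_nonneg (sub_nonneg.2 ht.2) (him hr₂ hi₂).le
      linarith
  have hsre {t : ℝ} (ht : t ∈ Set.Icc (0 : ℝ) 1) :
      0 < ((v₂ ^ 2 + t * d) ^ (2⁻¹ : ℂ)).re := by
    rw [cpow_inv_two_re, Real.sqrt_pos]
    have h1 := abs_re_lt_norm.2 (hu ht).ne'
    have h2 := neg_abs_le (v₂ ^ 2 + t * d).re
    linarith
  have hderiv {t : ℝ} (ht : t ∈ Set.Icc (0 : ℝ) 1) :
      HasDerivAt (fun t : ℝ => (logBarnes (b + (v₂ ^ 2 + t * d) ^ (2⁻¹ : ℂ)) * conj d).re)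
        ((logBarnesQuot b (b + (v₂ ^ 2 + t * d) ^ (2⁻¹ : ℂ))).re / 2 * ‖d‖ ^ 2) t := by
    have hs := hsre ht
    set s := (v₂ ^ 2 + t * d) ^ (2⁻¹ : ℂ) with hsdef
    have hs2 : s ^ 2 = v₂ ^ 2 + t * d := cpow_ofNat_inv_pow (v₂ ^ 2 + t * d) 2
    have hs0 : s ≠ 0 := fun h => by simp [h] at hs
    have hne : v₂ ^ 2 + t * d ≠ 0 := by rw [← hs2]; exact pow_ne_zero 2 hs0
    have hre : 1 ≤ ((b : ℂ) + s).re := by rw [add_re, ofReal_re]; linarith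
    have h1 : HasDerivAt (fun t : ℂ => v₂ ^ 2 + t * d) (1 * d) (t : ℂ) :=
      ((hasDerivAt_id (t : ℂ)).mul_const d).const_add _
    have h2 := (h1.cpow_const (c := 2⁻¹) (Or.inr (hu ht).ne')).const_add (b : ℂ)
    have h3 := (HasDerivAt.comp (t : ℂ) (hasDerivAt_logBarnes
      (ζ := b + (v₂ ^ 2 + t * d) ^ (2⁻¹ : ℂ)) (by rw [← hsdef]; linarith)) h2).mul_const (conj d)
    refine h3.real_of_complex.congr_deriv ?_
    have hp : (v₂ ^ 2 + t * d) ^ (2⁻¹ - 1 : ℂ) = s⁻¹ := by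
      rw [cpow_sub _ _ hne, cpow_one, ← hsdef, ← hs2]
      field_simp
    rw [hp, ← hsdef, logBarnesDeriv_eq_mul_quot hb hb0 hre]
    have : ((b : ℂ) + s - b) * logBarnesQuot b (b + s) * (2⁻¹ * s⁻¹ * (1 * d)) * conj d =
        ((‖d‖ ^ 2 / 2 : ℝ) : ℂ) * logBarnesQuot b (b + s) := by
      have hdd : d * conj d = ((‖d‖ ^ 2 : ℝ) : ℂ) := by rw [mul_conj, normSq_eq_norm_sq]
      push_cast at hdd ⊢
      rw [← hdd]
      field_simp
      ring
    rw [this, re_ofReal_mul]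
    ring
  obtain ⟨t, ht, hslope⟩ := exists_hasDerivAt_eq_slope _ _ zero_lt_one
    (fun t ht => (hderiv ht).continuousAt.continuousWithinAt)
    (fun t ht => hderiv (Set.Ioo_subset_Icc_self ht))
  have h1 : v₂ ^ 2 + ((1 : ℝ) : ℂ) * d = v₁ ^ 2 := by rw [hd]; push_cast; ring
  have h0 : v₂ ^ 2 + ((0 : ℝ) : ℂ) * d = v₂ ^ 2 := by push_cast; ring
  rw [h1, h0, sq_cpow_two_inv hr₁, sq_cpow_two_inv hr₂, sub_zero, div_one, ← sub_re,
    ← sub_mul] at hslope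
  rw [← hslope]
  have := re_logBarnesQuot_one_le hb (ζ := b + (v₂ ^ 2 + t * d) ^ (2⁻¹ : ℂ)) (by
    rw [add_re, ofReal_re]; linarith [hsre (Set.Ioo_subset_Icc_self ht)])
  gcongr

lemma continuousAt_logBarnes_add {b : ℝ} (hb : 1 < b) {v : ℂ} (h : 0 ≤ v.re) :
    ContinuousAt (fun v => logBarnes (b + v)) v :=
  ContinuousAt.comp (f := fun v : ℂ => (b : ℂ) + v)
    (hasDerivAt_logBarnes (by rw [add_re, ofReal_re]; linarith)).continuousAt
    (continuous_const.add continuous_id).continuousAt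

lemma logBarnes_expand {b : ℝ} (hb : 1 < b) (hb0 : logBarnesDeriv b = 0) {v₁ v₂ : ℂ}
    (hr₁ : 0 ≤ v₁.re) (hi₁ : 0 ≤ v₁.im) (hr₂ : 0 ≤ v₂.re) (hi₂ : 0 ≤ v₂.im) :
    (logBarnesQuot b 1).re / 2 * ‖v₁ ^ 2 - v₂ ^ 2‖ ^ 2 ≤
      ((logBarnes (b + v₁) - logBarnes (b + v₂)) * conj (v₁ ^ 2 - v₂ ^ 2)).re := by
  have hshift (v : ℂ) : Tendsto (fun ε : ℝ => v + ε * (1 + I)) (𝓝[>] 0) (𝓝 v) := by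
    have : Continuous fun ε : ℝ => v + ε * (1 + I) := by fun_prop
    simpa using (this.tendsto 0).mono_left nhdsWithin_le_nhds
  have hL {v : ℂ} (h : 0 ≤ v.re) := (continuousAt_logBarnes_add hb h).tendsto.comp (hshift v)
  have hsq := ((hshift v₁).pow 2).sub ((hshift v₂).pow 2)
  refine le_of_tendsto_of_tendsto ((hsq.norm.pow 2).const_mul _)
    ((continuous_re.tendsto _).comp
      (((hL hr₁).sub (hL hr₂)).mul ((continuous_conj.tendsto _).comp hsq))) ?_
  filter_upwards [self_mem_nhdsWithin] with ε hε
  have hε : 0 < ε := hε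
  exact logBarnes_expand_of_pos hb hb0 (by simp; linarith) (by simp; linarith)
    (by simp; linarith) (by simp; linarith)

lemma norm_sq_sub_sq_le {b : ℝ} (hb : 1 < b) (hb0 : logBarnesDeriv b = 0) {v₁ v₂ : ℂ}
    (hr₁ : 0 ≤ v₁.re) (hi₁ : 0 ≤ v₁.im) (hr₂ : 0 ≤ v₂.re) (hi₂ : 0 ≤ v₂.im) :
    ‖v₁ ^ 2 - v₂ ^ 2‖ ≤
      2 / (logBarnesQuot b 1).re * ‖logBarnes (b + v₁) - logBarnes (b + v₂)‖ := by
  have hc := logBarnesQuot_one_re_pos hb hb0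
  have h := (logBarnes_expand hb hb0 hr₁ hi₁ hr₂ hi₂).trans (re_le_norm _)
  rw [norm_mul, norm_conj] at h
  rcases (norm_nonneg (v₁ ^ 2 - v₂ ^ 2)).eq_or_lt with h0 | h0
  · rw [← h0]; positivity
  · rw [div_mul_eq_mul_div, le_div_iff₀ hc]
    have := le_of_mul_le_mul_right (a := ‖v₁ ^ 2 - v₂ ^ 2‖)
      (b := (logBarnesQuot b 1).re / 2 * ‖v₁ ^ 2 - v₂ ^ 2‖)
      (c := ‖logBarnes (b + v₁) - logBarnes (b + v₂)‖) (by linarith) h0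
    linarith

lemma im_logBarnes_vertical_nonpos {b : ℝ} (hb : 1 < b) (hb0 : logBarnesDeriv b = 0) {y : ℝ}
    (hy : 0 ≤ y) : (logBarnes (b + y * I)).im ≤ 0 := by
  have hre (t : ℝ) : ((b : ℂ) + t * I).re = b := by simp
  have hderiv (t : ℝ) : HasDerivAt (fun t : ℝ => (logBarnes (b + t * I)).im)
      (-t * (logBarnesQuot b (b + t * I)).im) t := by
    have h1 : HasDerivAt (fun t : ℝ => (b : ℂ) + t * I) (1 * I) t :=
      ((hasDerivAt_id t).ofReal_comp.mul_const I).const_add _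
    have h2 := HasDerivAt.comp t (hasDerivAt_logBarnes (ζ := b + t * I) (by rw [hre]; linarith)) h1
    have h3 := imCLM.hasFDerivAt.comp_hasDerivAt t h2
    refine h3.congr_deriv ?_
    rw [logBarnesDeriv_eq_mul_quot hb hb0 (by rw [hre]; linarith)]
    have : ((b : ℂ) + t * I - b) * logBarnesQuot b (b + t * I) * (1 * I) =
        ((-t : ℝ) : ℂ) * logBarnesQuot b (b + t * I) := by
      push_cast
      linear_combination (t : ℂ) * logBarnesQuot b (b + t * I) * I_sq
    rw [this, imCLM_apply, im_ofReal_mul]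
  have hanti : AntitoneOn (fun t : ℝ => (logBarnes (b + t * I)).im) (Set.Ici 0) := by
    refine antitoneOn_of_deriv_nonpos (convex_Ici 0)
      (fun t _ => (hderiv t).continuousAt.continuousWithinAt)
      (fun t _ => (hderiv t).differentiableAt.differentiableWithinAt) fun t ht => ?_
    rw [interior_Ici, Set.mem_Ioi] at ht
    rw [(hderiv t).deriv]
    have := im_logBarnesQuot_nonneg hb (ζ := b + t * I) (by rw [hre]; linarith)
      (by simpa using ht.le)
    nlinarith
  have := hanti (Set.mem_Ici.2 le_rfl) (Set.mem_Ici.2 hy) hy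
  simpa [logBarnes_ofReal_im (show -(1 / 2) < b by linarith)] using this

lemma logBarnesDeriv_ne_zero {b : ℝ} (hb : 1 < b) (hb0 : logBarnesDeriv b = 0) {ζ : ℂ}
    (h : b < ζ.re) : logBarnesDeriv ζ ≠ 0 := by
  rw [logBarnesDeriv_eq_mul_quot hb hb0 (by linarith)]
  refine mul_ne_zero (fun h0 => ?_) fun h0 => ?_
  · have := congrArg re h0
    simp at this
    linarith
  · have := logBarnesQuot_re_pos hb hb0 (ζ := ζ) (by linarith)
    simp [h0] at this

lemma isOpen_image_logBarnes_quadrant {b : ℝ} (hb : 1 < b) (hb0 : logBarnesDeriv b = 0) :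
    IsOpen ((fun v : ℂ => logBarnes (b + v)) '' {v | 0 < v.re ∧ 0 < v.im}) := by
  rw [isOpen_iff_mem_nhds]
  rintro _ ⟨v, ⟨hr, hi⟩, rfl⟩
  have hre : -(1 / 2) < ((b : ℂ) + v).re := by rw [add_re, ofReal_re]; linarith
  have hana : AnalyticAt ℂ logBarnes (b + v) :=
    differentiableOn_logBarnes.analyticAt (isOpen_neg_half_lt_re.mem_nhds hre)
  have hcomp : AnalyticAt ℂ (fun v : ℂ => logBarnes (b + v)) v :=
    hana.comp_of_eq (analyticAt_const.add analyticAt_id) rfl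
  have hne : deriv (fun v : ℂ => logBarnes (b + v)) v ≠ 0 := by
    rw [deriv_comp_const_add, (hasDerivAt_logBarnes hre).deriv]
    exact logBarnesDeriv_ne_zero hb hb0 (by rw [add_re, ofReal_re]; linarith)
  rw [← hcomp.hasStrictDerivAt.map_nhds_eq hne]
  exact image_mem_map (((isOpen_lt continuous_const continuous_re).inter
    (isOpen_lt continuous_const continuous_im)).mem_nhds ⟨hr, hi⟩)

lemma closure_image_logBarnes_quadrant_subset {b : ℝ} (hb : 1 < b)
    (hb0 : logBarnesDeriv b = 0) :
    closure ((fun v : ℂ => logBarnes (b + v)) '' {v | 0 < v.re ∧ 0 < v.im}) ⊆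
      (fun v : ℂ => logBarnes (b + v)) '' {v | 0 ≤ v.re ∧ 0 ≤ v.im} := by
  intro w hw
  have hc := logBarnesQuot_one_re_pos hb hb0
  set B := 2 / (logBarnesQuot b 1).re * (1 + ‖w - logBarnes b‖)
  have hB : 0 ≤ B := by positivity
  set K := {v : ℂ | 0 ≤ v.re ∧ 0 ≤ v.im} ∩ Metric.closedBall 0 (B + 1)
  have hK : IsCompact K := (isCompact_closedBall (0 : ℂ) (B + 1)).inter_left
    ((isClosed_le continuous_const continuous_re).inter
      (isClosed_le continuous_const continuous_im))
  have hcont : ContinuousOn (fun v : ℂ => logBarnes (b + v)) K :=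
    fun v hv => (continuousAt_logBarnes_add hb hv.1.1).continuousWithinAt
  have hw' := mem_closure_iff_nhds.1 hw
  suffices w ∈ closure ((fun v : ℂ => logBarnes (b + v)) '' K) by
    rw [(hK.image_of_continuousOn hcont).isClosed.closure_eq] at this
    exact Set.image_mono Set.inter_subset_left this
  rw [mem_closure_iff_nhds]
  intro t ht
  obtain ⟨_, ⟨hy, hball⟩, v, ⟨hr, hi⟩, rfl⟩ :=
    hw' _ (inter_mem ht (Metric.ball_mem_nhds w zero_lt_one))
  refine ⟨_, hy, v, ⟨⟨hr.le, hi.le⟩, ?_⟩, rfl⟩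
  have h1 := norm_sq_sub_sq_le hb hb0 hr.le hi.le (v₂ := 0) le_rfl le_rfl
  have h2 : ‖logBarnes (b + v) - logBarnes (b + 0)‖ ≤ 1 + ‖w - logBarnes b‖ := by
    rw [add_zero, ← sub_add_sub_cancel _ w]
    refine (norm_add_le _ _).trans ?_
    gcongr
    exact (mem_ball_iff_norm.1 hball).le
  have h3 : ‖v‖ ^ 2 ≤ B := by
    rw [← norm_pow]
    simpa using h1.trans (mul_le_mul_of_nonneg_left h2 (by positivity))
  rw [mem_closedBall_zero_iff]
  nlinarith [norm_nonneg v]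

lemma exists_logBarnes_eq_of_im_pos {b : ℝ} (hb : 1 < b) (hb0 : logBarnesDeriv b = 0) {w : ℂ}
    (hw : 0 < w.im) : ∃ v : ℂ, 0 < v.re ∧ 0 < v.im ∧ logBarnes (b + v) = w := by
  have hne : ({w : ℂ | 0 < w.im} ∩
      (fun v : ℂ => logBarnes (b + v)) '' {v | 0 < v.re ∧ 0 < v.im}).Nonempty := by
    refine ⟨_, ?_, ⟨5 + 3 * I, ⟨by simp, by simp⟩, rfl⟩⟩
    have h := logBarnes_expand hb hb0 (v₁ := 5 + 3 * I) (v₂ := 4)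
      (by simp) (by simp) (by simp) (by simp)
    have h1 : (5 + 3 * I) ^ 2 - 4 ^ 2 = ((30 : ℝ) : ℂ) * I := by
      push_cast
      linear_combination 9 * I_sq
    have h4 : (logBarnes (b + 4)).im = 0 := by
      have := logBarnes_ofReal_im (x := b + 4) (by linarith)
      simpa using this
    rw [h1, map_mul, conj_ofReal, conj_I] at h
    have hc := logBarnesQuot_one_re_pos hb hb0
    have h5 : ((logBarnes (b + (5 + 3 * I)) - logBarnes (b + 4)) * (((30 : ℝ) : ℂ) * -I)).re =
        30 * (logBarnes (b + (5 + 3 * I))).im := by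
      simp [h4, mul_comm]
    rw [h5] at h
    have : ‖((30 : ℝ) : ℂ) * I‖ = 30 := by simp
    rw [this] at h
    simp only [Set.mem_ofPred_eq]
    linarith
  obtain ⟨v, ⟨hr, hi⟩, hv⟩ :=
    (convex_halfSpace_im_gt 0).isPreconnected.subset_of_closure_inter_subset
      (isOpen_image_logBarnes_quadrant hb hb0) hne (by
        rintro x ⟨hx, hxi⟩
        have hxi : 0 < x.im := hxi
        obtain ⟨v, ⟨hr, hi⟩, rfl⟩ := closure_image_logBarnes_quadrant_subset hb hb0 hx
        refine ⟨v, ⟨hr.lt_of_ne fun h => ?_, hi.lt_of_ne fun h => ?_⟩, rfl⟩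
        · have hv : v = v.im * I := by
            apply Complex.ext <;> simp [← h]
          have := im_logBarnes_vertical_nonpos hb hb0 hi
          rw [← hv] at this
          exact absurd hxi this.not_gt
        · have hv : (b : ℂ) + v = ((b + v.re : ℝ) : ℂ) := by
            apply Complex.ext <;> simp [← h]
          simp only at hxi
          rw [hv, logBarnes_ofReal_im (by linarith)] at hxi
          exact lt_irrefl _ hxi) hw
  exact ⟨v, hr, hi, hv⟩

/-! ### The inverse branch -/

lemma exists_re_logBarnes_eq {b : ℝ} (hb : 1 < b) (hb0 : logBarnesDeriv b = 0) {s : ℝ}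
    (hs : (logBarnes b).re < s) : ∃ x : ℝ, 0 < x ∧ logBarnes (b + x) = s := by
  have hc := logBarnesQuot_one_re_pos hb hb0
  set R := 2 / (logBarnesQuot b 1).re * (s - (logBarnes b).re) + 1 with hR
  have hpos : 0 < 2 / (logBarnesQuot b 1).re := by positivity
  have hR1 : 1 < R := by
    have := mul_pos hpos (sub_pos.2 hs)
    linarith
  have hbR : b < b + R := by linarith
  have hmono := strictMonoOn_re_logBarnes hb hb0 Set.self_mem_Ici (Set.mem_Ici.2 hbR.le) hbR
  have hreal {x : ℝ} (hx : b ≤ x) : logBarnes x = (((logBarnes x).re : ℝ) : ℂ) :=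
    Complex.ext rfl (by rw [logBarnes_ofReal_im (by linarith), ofReal_im])
  have hbig : s < (logBarnes ((b + R : ℝ) : ℂ)).re := by
    have h := norm_sq_sub_sq_le hb hb0 (v₁ := R) (v₂ := 0) (by simp; linarith) (by simp)
      le_rfl le_rfl
    rw [add_zero, ← ofReal_add, hreal hbR.le, hreal le_rfl, ← ofReal_sub, norm_real,
      Real.norm_of_nonneg (sub_nonneg.2 hmono.le)] at h
    have h' : R ^ 2 ≤ 2 / (logBarnesQuot b 1).re *
        ((logBarnes ((b + R : ℝ) : ℂ)).re - (logBarnes b).re) := by simpa using h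
    have : 2 / (logBarnesQuot b 1).re * (s - (logBarnes b).re) <
        2 / (logBarnesQuot b 1).re *
          ((logBarnes ((b + R : ℝ) : ℂ)).re - (logBarnes b).re) := by nlinarith
    linarith [lt_of_mul_lt_mul_left this hpos.le]
  obtain ⟨x, hx, hxs⟩ := intermediate_value_Ioo hbR.le
    (continuousOn_re_logBarnes fun x hx => by linarith [hx.1]) ⟨hs, hbig⟩
  refine ⟨x - b, by linarith [hx.1], ?_⟩
  simp only at hxs
  rw [← ofReal_add, add_sub_cancel, hreal hx.1.le, hxs]

lemma exists_logBarnes_eq_log {b : ℝ} (hb : 1 < b) (hb0 : logBarnesDeriv b = 0) (w : ℂ)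
    (hi : 0 ≤ w.im) (hw : w.im ≠ 0 ∨ (barnesG ((b + 1 : ℝ) : ℂ)).re < w.re) :
    ∃ v : ℂ, 0 < v.re ∧ 0 ≤ v.im ∧ logBarnes (b + v) = log w ∧ (0 < w.im → 0 < v.im) ∧
      (w.im = 0 → v.im = 0) := by
  rcases hi.eq_or_lt with h0 | h0
  · have hlt := hw.resolve_left (not_not.2 h0.symm)
    rw [re_barnesG_ofReal (by linarith), add_sub_cancel_right] at hlt
    have hw0 : 0 < w.re := (Real.exp_pos _).trans hlt
    obtain ⟨x, hx, hxs⟩ := exists_re_logBarnes_eq hb hb0 ((Real.lt_log_iff_exp_lt hw0).2 hlt)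
    have hwr : w = (w.re : ℂ) := Complex.ext rfl (by rw [ofReal_im, h0])
    refine ⟨x, by simpa using hx, by simp, ?_, fun h => absurd h0 h.ne, fun _ => ofReal_im x⟩
    rw [hxs, hwr, ofReal_re, ofReal_log hw0.le]
  · have hlog : 0 < (log w).im := by
      rw [log_im]
      refine (arg_nonneg_iff.2 hi).lt_of_ne fun h => ?_
      exact h0.ne' (arg_eq_zero_iff.1 h.symm).2
    obtain ⟨v, hr, hvi, hv⟩ := exists_logBarnes_eq_of_im_pos hb hb0 hlog
    exact ⟨v, hr, hvi.le, hv, fun _ => hvi, fun h => absurd h h0.ne'⟩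

lemma barnesG_conj {z : ℂ} (h : 1 / 2 < z.re) : barnesG (conj z) = conj (barnesG z) := by
  have h1 : conj z - 1 = conj (z - 1) := by simp
  rw [barnesG_eq_exp_logBarnes h, barnesG_eq_exp_logBarnes (by simpa using h), h1,
    logBarnes_conj (by simp; linarith), exp_conj]

lemma hasDerivAt_barnesG {z : ℂ} (h : 1 / 2 < z.re) :
    HasDerivAt barnesG (exp (logBarnes (z - 1)) * logBarnesDeriv (z - 1)) z := by
  have h1 : -(1 / 2) < (z - 1).re := by simp; linarith
  have h2 : HasDerivAt (fun z : ℂ => z - 1) 1 z := (hasDerivAt_id z).sub_const 1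
  have h3 := (HasDerivAt.comp z (hasDerivAt_logBarnes h1) h2).cexp
  rw [mul_one] at h3
  refine h3.congr_of_eventuallyEq ?_
  filter_upwards [(isOpen_lt continuous_const continuous_re).mem_nhds h] with y hy
  exact barnesG_eq_exp_logBarnes hy

/-- A right inverse of `barnesG` on the slit plane that is symmetric under conjugation and takes
values to the right of the critical point. -/
lemma exists_barnesG_right_inverse {b : ℝ} (hb : 1 < b) (hb0 : logBarnesDeriv b = 0) :
    ∃ F : ℂ → ℂ, ∀ w : ℂ, (w.im ≠ 0 ∨ (barnesG ((b + 1 : ℝ) : ℂ)).re < w.re) →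
      ContinuousAt F w ∧ b + 1 < (F w).re ∧ barnesG (F w) = w ∧ (0 < w.im → 0 < (F w).im) ∧
        (w.im = 0 → (F w).im = 0) := by
  set g := (barnesG ((b + 1 : ℝ) : ℂ)).re with hg
  have hg0 : 0 < g := by rw [hg, re_barnesG_ofReal (by linarith)]; exact Real.exp_pos _
  choose! V hVr hVi hV hVpos hVreal using exists_logBarnes_eq_log hb hb0
  set S : Set ℂ := {w | 0 ≤ w.im ∧ (w.im ≠ 0 ∨ g < w.re)}
  have hne {w : ℂ} (hw : w.im ≠ 0 ∨ g < w.re) : w ∈ slitPlane :=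
    hw.symm.imp hg0.trans id
  have hconj {w : ℂ} (hw : w.im ≠ 0 ∨ g < w.re) : (conj w).im ≠ 0 ∨ g < (conj w).re := by
    simpa using hw
  have hVcont : ContinuousOn V S := by
    have hsq : ContinuousOn (fun w => V w ^ 2) S := by
      intro w hw
      have hlog : Tendsto (fun y => 2 / (logBarnesQuot b 1).re * ‖log y - log w‖) (𝓝[S] w)
          (𝓝 0) := by
        have h1 : ContinuousAt (fun y => 2 / (logBarnesQuot b 1).re * ‖log y - log w‖) w :=
          (((continuousAt_clog (hne hw.2)).sub continuousAt_const).norm).const_mul _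
        simpa using h1.tendsto.mono_left nhdsWithin_le_nhds
      refine tendsto_iff_norm_sub_tendsto_zero.2
        (squeeze_zero' (Eventually.of_forall fun _ => norm_nonneg _) ?_ hlog)
      filter_upwards [self_mem_nhdsWithin] with y hy
      rw [← hV y hy.1 hy.2, ← hV w hw.1 hw.2]
      exact norm_sq_sub_sq_le hb hb0 (hVr y hy.1 hy.2).le (hVi y hy.1 hy.2)
        (hVr w hw.1 hw.2).le (hVi w hw.1 hw.2)
    have hroot : ContinuousOn (fun w => (V w ^ 2) ^ (2⁻¹ : ℂ)) S := by
      refine hsq.cpow_const fun w hw => ?_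
      have hr := hVr w hw.1 hw.2
      rcases (hVi w hw.1 hw.2).eq_or_lt with h | h
      · left; rw [sq, mul_re, ← h]; nlinarith
      · right; rw [sq, mul_im]; nlinarith [mul_pos hr h]
    exact hroot.congr fun w hw => (sq_cpow_two_inv (hVr w hw.1 hw.2)).symm
  set F : ℂ → ℂ := fun w => if 0 ≤ w.im then b + 1 + V w else conj (b + 1 + V (conj w))
  have hup {w : ℂ} (hw : 0 ≤ w.im) : F w = b + 1 + V w := if_pos hw
  have hdown {w : ℂ} (hi : w.im ≤ 0) (hw : w.im ≠ 0 ∨ g < w.re) :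
      F w = conj (b + 1 + V (conj w)) := by
    rcases hi.eq_or_lt with h | h
    · have hwr : conj w = w := conj_eq_iff_im.2 h
      have hVr : conj (V w) = V w := conj_eq_iff_im.2 (hVreal w h.ge hw h)
      rw [hup h.ge, hwr]
      simp [hVr]
    · exact if_neg h.not_ge
  have hcontUp : ContinuousOn F S :=
    (continuousOn_const.add hVcont).congr fun w hw => hup hw.1
  have hcontDown : ContinuousOn F {w | w.im ≤ 0 ∧ (w.im ≠ 0 ∨ g < w.re)} := by
    have hmaps : Set.MapsTo conj {w : ℂ | w.im ≤ 0 ∧ (w.im ≠ 0 ∨ g < w.re)} S :=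
      fun w hw => ⟨by simpa using hw.1, hconj hw.2⟩
    exact (continuous_conj.comp_continuousOn (continuousOn_const.add
      (hVcont.comp continuous_conj.continuousOn hmaps))).congr fun w hw => hdown hw.1 hw.2
  have hopen : IsOpen {w : ℂ | w.im ≠ 0 ∨ g < w.re} :=
    (isOpen_ne_fun continuous_im continuous_const).union
      (isOpen_lt continuous_const continuous_re)
  refine ⟨F, fun w hw => ⟨?_, ?_⟩⟩
  · rcases lt_trichotomy w.im 0 with h | h | h
    · refine (hcontDown w ⟨h.le, hw⟩).continuousAt ?_
      filter_upwards [(isOpen_lt continuous_im continuous_const).mem_nhds h] with y hy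
      exact ⟨le_of_lt hy, Or.inl (ne_of_lt hy)⟩
    · have hu := (hcontUp w ⟨h.ge, hw⟩).union (hcontDown w ⟨h.le, hw⟩)
      refine hu.continuousAt ?_
      filter_upwards [hopen.mem_nhds hw] with y hy
      exact (le_total 0 y.im).imp (fun h => ⟨h, hy⟩) fun h => ⟨h, hy⟩
    · refine (hcontUp w ⟨h.le, hw⟩).continuousAt ?_
      filter_upwards [(isOpen_lt continuous_const continuous_im).mem_nhds h] with y hy
      exact ⟨le_of_lt hy, Or.inl (ne_of_gt hy)⟩
  · have hmain {w : ℂ} (hi : 0 ≤ w.im) (hw : w.im ≠ 0 ∨ g < w.re) :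
        b + 1 < ((b : ℂ) + 1 + V w).re ∧ barnesG (b + 1 + V w) = w := by
      have hr : b + 1 < ((b : ℂ) + 1 + V w).re := by
        have := hVr w hi hw
        simpa using this
      refine ⟨hr, ?_⟩
      have : (b : ℂ) + 1 + V w - 1 = b + V w := by ring
      rw [barnesG_eq_exp_logBarnes (by linarith), this, hV w hi hw,
        exp_log (slitPlane_ne_zero (hne hw))]
    rcases le_or_gt 0 w.im with h | h
    · rw [hup h]
      refine ⟨(hmain h hw).1, (hmain h hw).2, fun h' => ?_, fun h' => ?_⟩
      · simpa using hVpos w h hw h'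
      · simpa using hVreal w h hw h'
    · rw [hdown h.le hw]
      have := hmain (w := conj w) (by simpa using h.le) (hconj hw)
      refine ⟨?_, ?_, fun h' => absurd h' h.not_gt, fun h' => absurd h' h.ne⟩
      · rw [conj_re]; exact this.1
      · rw [barnesG_conj (by linarith [this.1]), this.2, conj_conj]

/-- There are `0 < α_G < β_G` such that Barnes' `G`-function strictly
decreases on `(α_G, β_G)` and strictly increases on `(β_G, ∞)`, and the inverse of `G`
on `(G(β_G),∞)` extends to a univalent Pick function on `ℂ ∖ (−∞, G(β_G)]`. -/
theorem barnesG_inverse_pick :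
    ∃ αG βG : ℝ, 0 < αG ∧ αG < βG ∧
      StrictAntiOn (fun x : ℝ => (barnesG (x : ℂ)).re) (Set.Ioo αG βG) ∧
      StrictMonoOn (fun x : ℝ => (barnesG (x : ℂ)).re) (Set.Ioi βG) ∧
      ∃ F : ℂ → ℂ,
        Set.InjOn F {z : ℂ | z.im ≠ 0 ∨ (barnesG (βG : ℂ)).re < z.re} ∧
        DifferentiableOn ℂ F {z : ℂ | z.im ≠ 0 ∨ (barnesG (βG : ℂ)).re < z.re} ∧
        (∀ x : ℝ, (barnesG (βG : ℂ)).re < x → (F (x : ℂ)).im = 0) ∧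
        StrictMonoOn (fun x : ℝ => (F (x : ℂ)).re)
          (Set.Ioi ((barnesG (βG : ℂ)).re)) ∧
        (fun x : ℝ => (F (x : ℂ)).re) '' Set.Ioi ((barnesG (βG : ℂ)).re) =
          Set.Ioi βG ∧
        (∀ w : ℂ, (w.im ≠ 0 ∨ (barnesG (βG : ℂ)).re < w.re) → barnesG (F w) = w) ∧
        (∀ z : ℂ, 0 < z.im → 0 < (F z).im) := by
  obtain ⟨b, hb, hb0⟩ := exists_logBarnesDeriv_eq_zero
  obtain ⟨F, hF⟩ := exists_barnesG_right_inverse hb hb0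
  have hmono := strictMonoOn_re_barnesG hb hb0
  have hreal {x : ℝ} (hx : (barnesG ((b + 1 : ℝ) : ℂ)).re < x) :
      F x = (((F x).re : ℝ) : ℂ) :=
    Complex.ext rfl (by rw [ofReal_im, (hF x (Or.inr hx)).2.2.2.2 (ofReal_im x)])
  have hinv {x : ℝ} (hx : (barnesG ((b + 1 : ℝ) : ℂ)).re < x) :
      (barnesG (((F x).re : ℝ) : ℂ)).re = x := by
    rw [← hreal hx, (hF x (Or.inr hx)).2.2.1, ofReal_re]
  have hgt {x : ℝ} (hx : (barnesG ((b + 1 : ℝ) : ℂ)).re < x) : b + 1 < (F x).re :=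
    (hF x (Or.inr hx)).2.1
  refine ⟨2, b + 1, two_pos, by linarith,
    (strictAntiOn_re_barnesG hb hb0).mono Set.Ioo_subset_Icc_self,
    hmono.mono Set.Ioi_subset_Ici_self, F, ?_, ?_, ?_, ?_, ?_, ?_, ?_⟩
  · intro w hw w' hw' h
    rw [← (hF w hw).2.2.1, h, (hF w' hw').2.2.1]
  · intro w hw
    obtain ⟨hcont, hre, -⟩ := hF w hw
    refine (HasDerivAt.of_local_left_inverse hcont (hasDerivAt_barnesG (by linarith))
      (mul_ne_zero (exp_ne_zero _) (logBarnesDeriv_ne_zero hb hb0 ?_))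
      ?_).differentiableAt.differentiableWithinAt
    · rw [sub_re, one_re]; linarith
    · have hopen : IsOpen {w : ℂ | w.im ≠ 0 ∨ (barnesG ((b + 1 : ℝ) : ℂ)).re < w.re} :=
        (isOpen_ne_fun continuous_im continuous_const).union
          (isOpen_lt continuous_const continuous_re)
      filter_upwards [hopen.mem_nhds hw] with y hy
      exact (hF y hy).2.2.1
  · exact fun x hx => (hF x (Or.inr hx)).2.2.2.2 (ofReal_im x)
  · intro x hx y hy hxy
    rw [Set.mem_Ioi] at hx hy
    refine (hmono.lt_iff_lt (hgt hx).le (hgt hy).le).1 ?_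
    rwa [hinv hx, hinv hy]
  · ext y
    constructor
    · rintro ⟨x, hx, rfl⟩
      exact hgt hx
    · intro hy
      have hlt := hmono Set.self_mem_Ici (Set.mem_Ici.2 (le_of_lt hy)) hy
      exact ⟨_, hlt, hmono.injOn (hgt hlt).le (Set.mem_Ici.2 (le_of_lt hy)) (hinv hlt)⟩
  · exact fun w hw => (hF w hw).2.2.1
  · exact fun z hz => (hF z (Or.inl hz.ne')).2.2.2.1 hz
end

section
/- Let H(z) = (2π)^{−z/2} G(z) be the reciprocal of Barnes' double gamma function Γ₂. There exist 0 < α₂ < β₂ such that H is strictly decreasing on (α₂, β₂) and strictly increasing on (β₂, ∞), and there exists an injective holomorphic function F on ℂ ∖ (−∞, H(β₂)] such that F is real-valued and strictly increasing on (H(β₂), ∞) with image (β₂, ∞), H(F(w)) = w for every w ∈ ℂ ∖ (−∞, H(β₂)], and Im F(z) > 0 whenever Im z > 0; i.e., the inverse of 1/Γ₂ on (1/Γ₂(β₂),∞) extends to a univalent Pick function. -/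
open Complex

/-- The reciprocal `H(z) = (2π)^{−z/2} G(z)` of Barnes' double gamma function
`Γ₂(z) = (2π)^{z/2}/G(z)`. -/
noncomputable def recipGamma2 (z : ℂ) : ℂ :=
  (2 * Real.pi : ℂ) ^ (-z / 2) * barnesG z

open Filter Topology Set

/-- The mean value theorem along a segment, applied to a real-linear functional of a holomorphic
function. -/
lemma exists_re_mul_sub_eq {f f' : ℂ → ℂ} {a b : ℂ}
    (hf : ∀ z ∈ segment ℝ a b, HasDerivAt f (f' z) z) (c : ℂ) :
    ∃ ξ ∈ openSegment ℝ a b, (c * (f b - f a)).re = (c * (f' ξ * (b - a))).re := by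
  have hmem : ∀ t ∈ Icc (0 : ℝ) 1, a + t * (b - a) ∈ segment ℝ a b := fun t ht => by
    rw [segment_eq_image']
    exact ⟨t, ht, by simp⟩
  have hd : ∀ t ∈ Icc (0 : ℝ) 1,
      HasDerivAt (fun t : ℝ => (c * f (a + t * (b - a))).re)
        (c * (f' (a + t * (b - a)) * (b - a))).re t := fun t ht => by
    have h1 : HasDerivAt (fun s : ℂ => a + s * (b - a)) (b - a) (t : ℂ) := by
      simpa using ((hasDerivAt_id (t : ℂ)).mul_const (b - a)).const_add a
    have h2 := ((hf _ (hmem t ht)).comp (t : ℂ) h1).const_mul c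
    exact h2.real_of_complex
  obtain ⟨t, ht, h⟩ := exists_hasDerivAt_eq_slope _ _ (zero_lt_one' ℝ)
    (fun t ht => (hd t ht).continuousAt.continuousWithinAt)
    (fun t ht => hd t (Ioo_subset_Icc_self ht))
  refine ⟨a + t * (b - a), ?_, ?_⟩
  · rw [openSegment_eq_image']
    exact ⟨t, ht, by simp⟩
  · rw [h]
    simp [mul_sub]

/-- The logarithm of the `k`-th factor of the Weierstrass product of Barnes' `G`-function,
centred at `1`. -/
noncomputable def logFactor (k : ℕ) (u : ℂ) : ℂ :=
  (k + 1) * log (1 + u / (k + 1)) + (-u + u ^ 2 / (2 * (k + 1)))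

/-- The branch of `log (recipGamma2 (1 + u))` that is real on the positive axis. -/
noncomputable def logRecipGamma2 (u : ℂ) : ℂ :=
  -(Real.log (2 * Real.pi) / 2 : ℝ) +
    (-((1 + (Real.eulerMascheroniConstant : ℂ)) * u ^ 2 + u) / 2) + ∑' k : ℕ, logFactor k u

/-- The function `ψ(1 + u) - 1 - 1 / (2 u)`, with the digamma function `ψ` given by its series. -/
noncomputable def logDerivQuotient (u : ℂ) : ℂ :=
  -(1 + (Real.eulerMascheroniConstant : ℂ)) - 1 / (2 * u) + ∑' k : ℕ, u / ((k + 1) * (k + 1 + u))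

lemma half_le_norm_add {u : ℂ} (hu : -(1 / 2) < u.re) (k : ℕ) :
    ((k : ℝ) + 1) / 2 ≤ ‖(k : ℂ) + 1 + u‖ := by
  refine le_trans ?_ (re_le_norm _)
  have : (0 : ℝ) ≤ k := k.cast_nonneg
  simp
  linarith

lemma add_ne_zero_of_re {u : ℂ} (hu : -(1 / 2) < u.re) (k : ℕ) : (k : ℂ) + 1 + u ≠ 0 := by
  rw [← norm_pos_iff]
  exact lt_of_lt_of_le (by positivity) (half_le_norm_add hu k)

lemma one_add_div_mem_slitPlane {u : ℂ} (hu : -(1 / 2) < u.re) (k : ℕ) :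
    1 + u / ((k : ℂ) + 1) ∈ slitPlane := by
  left
  have h : (u / ((k : ℂ) + 1)).re = u.re / (k + 1) := by
    rw [← ofReal_natCast, ← ofReal_one, ← ofReal_add, div_ofReal_re]
  have hk : (0 : ℝ) < (k : ℝ) + 1 := by positivity
  have hk0 : (0 : ℝ) ≤ k := k.cast_nonneg
  have : -1 < u.re / (k + 1) := by
    rw [lt_div_iff₀ hk]
    linarith
  rw [add_re, h, one_re]
  linarith

lemma hasDerivAt_logFactor {u : ℂ} (hu : -(1 / 2) < u.re) (k : ℕ) :
    HasDerivAt (logFactor k) (u ^ 2 / ((k + 1) * (k + 1 + u))) u := by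
  have hk : (k : ℂ) + 1 ≠ 0 := k.cast_add_one_ne_zero
  have hku := add_ne_zero_of_re hu k
  have h1 : HasDerivAt (fun u : ℂ => 1 + u / ((k : ℂ) + 1)) (1 / ((k : ℂ) + 1)) u :=
    ((hasDerivAt_id u).div_const _).const_add 1
  have h2 := (h1.clog (one_add_div_mem_slitPlane hu k)).const_mul ((k : ℂ) + 1)
  have h3 := (hasDerivAt_id u).neg.add (((hasDerivAt_id u).pow 2).div_const (2 * ((k : ℂ) + 1)))
  refine (h2.add h3).congr_deriv ?_
  have h4 : 1 + u / ((k : ℂ) + 1) ≠ 0 := slitPlane_ne_zero (one_add_div_mem_slitPlane hu k)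
  have h5 : 1 + u / ((k : ℂ) + 1) = (k + 1 + u) / (k + 1) := by field_simp
  rw [h5]
  simp
  field_simp
  ring

lemma norm_deriv_logFactor_le {u : ℂ} {R : ℝ} (hu : -(1 / 2) < u.re) (hR : ‖u‖ < R) (k : ℕ) :
    ‖u ^ 2 / ((k + 1) * (k + 1 + u))‖ ≤ 2 * R ^ 2 * (1 / ((k : ℝ) + 1) ^ 2) := by
  have h := half_le_norm_add hu k
  have hk : (0 : ℝ) < (k : ℝ) + 1 := by positivity
  have hkn : ‖(k : ℂ) + 1‖ = k + 1 := by
    rw [← ofReal_natCast, ← ofReal_one, ← ofReal_add, norm_real, Real.norm_of_nonneg hk.le]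
  rw [norm_div, norm_mul, norm_pow, hkn]
  calc ‖u‖ ^ 2 / ((k + 1) * ‖(k : ℂ) + 1 + u‖) ≤ R ^ 2 / ((k + 1) * ((k + 1) / 2)) := by
        gcongr
    _ = _ := by field_simp

lemma summable_one_div_succ_sq (c : ℝ) : Summable fun k : ℕ => c * (1 / ((k : ℝ) + 1) ^ 2) := by
  have h := (summable_nat_add_iff 1).2 (Real.summable_one_div_nat_pow.2 one_lt_two)
  exact (by simpa using h : Summable fun k : ℕ => 1 / ((k : ℝ) + 1) ^ 2).mul_left c

lemma logFactor_zero (k : ℕ) : logFactor k 0 = 0 := by simp [logFactor]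

lemma isOpen_halfDisc (R : ℝ) : IsOpen ({u : ℂ | -(1 / 2) < u.re} ∩ Metric.ball 0 R) :=
  (isOpen_lt continuous_const continuous_re).inter Metric.isOpen_ball

lemma isPreconnected_halfDisc (R : ℝ) :
    IsPreconnected ({u : ℂ | -(1 / 2) < u.re} ∩ Metric.ball 0 R) :=
  ((convex_halfSpace_re_gt _).inter (convex_ball _ _)).isPreconnected

lemma mem_halfDisc {u : ℂ} (hu : -(1 / 2) < u.re) :
    u ∈ {u : ℂ | -(1 / 2) < u.re} ∩ Metric.ball 0 (‖u‖ + 1) := ⟨hu, by simp⟩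

lemma zero_mem_halfDisc (u : ℂ) :
    (0 : ℂ) ∈ {u : ℂ | -(1 / 2) < u.re} ∩ Metric.ball 0 (‖u‖ + 1) :=
  ⟨by simp, by simp; positivity⟩

lemma summable_logFactor {u : ℂ} (hu : -(1 / 2) < u.re) : Summable fun k => logFactor k u :=
  summable_of_summable_hasDerivAt_of_isPreconnected
    (summable_one_div_succ_sq (2 * (‖u‖ + 1) ^ 2)) (isOpen_halfDisc _) (isPreconnected_halfDisc _)
    (fun k _ hv => hasDerivAt_logFactor hv.1 k)
    (fun k _ hv => norm_deriv_logFactor_le hv.1 (by simpa using hv.2) k) (zero_mem_halfDisc u)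
    (by simp [logFactor_zero, summable_zero]) (mem_halfDisc hu)

lemma hasDerivAt_tsum_logFactor {u : ℂ} (hu : -(1 / 2) < u.re) :
    HasDerivAt (fun u => ∑' k, logFactor k u) (∑' k : ℕ, u ^ 2 / ((k + 1) * (k + 1 + u))) u :=
  hasDerivAt_tsum_of_isPreconnected
    (summable_one_div_succ_sq (2 * (‖u‖ + 1) ^ 2)) (isOpen_halfDisc _) (isPreconnected_halfDisc _)
    (fun k _ hv => hasDerivAt_logFactor hv.1 k)
    (fun k _ hv => norm_deriv_logFactor_le hv.1 (by simpa using hv.2) k) (zero_mem_halfDisc u)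
    (by simp [logFactor_zero, summable_zero]) (mem_halfDisc hu)

lemma hasDerivAt_logRecipGamma2_aux {u : ℂ} (hu : -(1 / 2) < u.re) :
    HasDerivAt logRecipGamma2 (-(1 + (Real.eulerMascheroniConstant : ℂ)) * u - 1 / 2 +
      ∑' k : ℕ, u ^ 2 / ((k + 1) * (k + 1 + u))) u := by
  have h1 := ((((((hasDerivAt_id u).pow 2).const_mul
    (1 + (Real.eulerMascheroniConstant : ℂ))).add (hasDerivAt_id u)).neg.div_const 2).const_add
      (-((Real.log (2 * Real.pi) / 2 : ℝ) : ℂ))).add (hasDerivAt_tsum_logFactor hu)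
  refine h1.congr_deriv ?_
  simp
  ring

lemma hasDerivAt_logRecipGamma2 {u : ℂ} (hu : -(1 / 2) < u.re) (h0 : u ≠ 0) :
    HasDerivAt logRecipGamma2 (u * logDerivQuotient u) u := by
  refine (hasDerivAt_logRecipGamma2_aux hu).congr_deriv ?_
  rw [logDerivQuotient, mul_add, ← tsum_mul_left]
  congr 1
  · field_simp
  · congr 1 with k
    ring

lemma hasDerivAt_logRecipGamma2_zero : HasDerivAt logRecipGamma2 (-1 / 2) 0 := by
  refine (hasDerivAt_logRecipGamma2_aux (by simp)).congr_deriv ?_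
  simp
  ring

lemma analyticAt_logRecipGamma2 {u : ℂ} (hu : -(1 / 2) < u.re) : AnalyticAt ℂ logRecipGamma2 u :=
  DifferentiableOn.analyticAt (s := {u : ℂ | -(1 / 2) < u.re})
    (fun _ hv => (hasDerivAt_logRecipGamma2_aux hv).differentiableAt.differentiableWithinAt)
    ((isOpen_lt continuous_const continuous_re).mem_nhds hu)

lemma recipGamma2_one_add {u : ℂ} (hu : -(1 / 2) < u.re) :
    recipGamma2 (1 + u) = exp (logRecipGamma2 u) := by
  have hpi : (2 * Real.pi : ℂ) ≠ 0 := by exact_mod_cast Real.two_pi_pos.ne'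
  have hprod : ∏' k : ℕ, ((1 + u / ((k : ℂ) + 1)) ^ (k + 1) *
      exp (-u + u ^ 2 / (2 * ((k : ℂ) + 1)))) = exp (∑' k, logFactor k u) := by
    rw [← (summable_logFactor hu).hasSum.cexp.tprod_eq]
    congr 1 with k
    rw [Function.comp_apply, logFactor, exp_add (_ * _)]
    congr 1
    rw [← Nat.cast_add_one, exp_nat_mul, Nat.cast_add_one,
      exp_log (slitPlane_ne_zero (one_add_div_mem_slitPlane hu k))]
  have hlog : log (2 * Real.pi : ℂ) = (Real.log (2 * Real.pi) : ℝ) := by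
    rw [ofReal_log Real.two_pi_pos.le]
    simp
  rw [recipGamma2, barnesG, add_sub_cancel_left, hprod, cpow_def_of_ne_zero hpi,
    cpow_def_of_ne_zero hpi, hlog, ← exp_add, ← exp_add, ← exp_add, logRecipGamma2]
  congr 1
  push_cast
  ring

lemma logRecipGamma2_conj {u : ℂ} (hu : -(1 / 2) < u.re) :
    logRecipGamma2 (starRingEnd ℂ u) = starRingEnd ℂ (logRecipGamma2 u) := by
  have hk : ∀ k : ℕ, logFactor k (starRingEnd ℂ u) = starRingEnd ℂ (logFactor k u) := fun k => by
    have := log_conj _ (slitPlane_arg_ne_pi (one_add_div_mem_slitPlane hu k))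
    simp only [logFactor, map_add, map_mul, map_neg, map_pow, map_div₀, map_one, map_natCast,
      map_ofNat] at this ⊢
    rw [this]
  simp [logRecipGamma2, hk, conj_tsum, map_ofNat]

lemma logRecipGamma2_ofReal_im {x : ℝ} (hx : -(1 / 2) < x) : (logRecipGamma2 x).im = 0 := by
  have := logRecipGamma2_conj (u := x) (by simpa using hx)
  rw [conj_ofReal] at this
  exact conj_eq_iff_im.1 this.symm

lemma summable_logDerivQuotient {u : ℂ} (hu : -(1 / 2) < u.re) :
    Summable fun k : ℕ => u / (((k : ℂ) + 1) * (k + 1 + u)) := by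
  rcases eq_or_ne u 0 with rfl | h0
  · simp [summable_zero]
  have h : Summable fun k : ℕ => u ^ 2 / (((k : ℂ) + 1) * (k + 1 + u)) :=
    (summable_one_div_succ_sq (2 * (‖u‖ + 1) ^ 2)).of_norm_bounded
      (norm_deriv_logFactor_le hu (by linarith))
  refine (h.mul_left u⁻¹).congr fun k => ?_
  rw [sq, mul_div_assoc, inv_mul_cancel_left₀ h0]

lemma quotientTerm_eq {u : ℂ} (hu : -(1 / 2) < u.re) (k : ℕ) :
    u / (((k : ℂ) + 1) * (k + 1 + u)) = ((1 / ((k : ℝ) + 1) : ℝ) : ℂ) - ((k : ℂ) + 1 + u)⁻¹ := by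
  have hk : (k : ℂ) + 1 ≠ 0 := k.cast_add_one_ne_zero
  have hku := add_ne_zero_of_re hu k
  push_cast
  field_simp
  ring

lemma logDerivQuotient_im_pos {u : ℂ} (hu : -(1 / 2) < u.re) (hi : 0 < u.im) :
    0 < (logDerivQuotient u).im := by
  have h0 : u ≠ 0 := fun h => by simp [h] at hi
  have hsum : 0 ≤ (∑' k : ℕ, u / (((k : ℂ) + 1) * (k + 1 + u))).im := by
    rw [im_tsum (summable_logDerivQuotient hu)]
    refine tsum_nonneg fun k => ?_
    rw [quotientTerm_eq hu, sub_im, ofReal_im, inv_im]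
    have : 0 ≤ u.im / normSq ((k : ℂ) + 1 + u) := div_nonneg hi.le (normSq_nonneg _)
    simpa [neg_div] using this
  have h1 : 0 < (-(1 / (2 * u))).im := by
    rw [one_div, neg_im, inv_im]
    have : 0 < (2 * u).im / normSq (2 * u) :=
      div_pos (by simpa using hi) (normSq_pos.2 (by simpa using h0))
    simpa [neg_div] using this
  rw [logDerivQuotient, add_im, sub_eq_add_neg, add_im]
  have h2 : (-(1 + (Real.eulerMascheroniConstant : ℂ))).im = 0 := by simp
  linarith

lemma logDerivQuotient_ofReal (x : ℝ) : logDerivQuotient x =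
    ((-(1 + Real.eulerMascheroniConstant) - 1 / (2 * x) +
      ∑' k : ℕ, x / ((k + 1) * (k + 1 + x)) : ℝ) : ℂ) := by
  rw [logDerivQuotient]
  push_cast
  rfl

lemma logDerivQuotient_re_strictMonoOn :
    StrictMonoOn (fun x : ℝ => (logDerivQuotient x).re) (Ioi 0) := by
  intro x (hx : 0 < x) y (hy : 0 < y) hxy
  have hs : ∀ {x : ℝ}, 0 < x → Summable fun k : ℕ => x / (((k : ℝ) + 1) * (k + 1 + x)) := by
    intro x hx
    have h := summable_logDerivQuotient (u := x) (by rw [ofReal_re]; linarith)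
    exact_mod_cast h
  simp only [logDerivQuotient_ofReal, ofReal_re]
  have h1 : 1 / (2 * y) < 1 / (2 * x) := by gcongr
  have h2 : ∑' k : ℕ, x / (((k : ℝ) + 1) * (k + 1 + x)) ≤
      ∑' k : ℕ, y / (((k : ℝ) + 1) * (k + 1 + y)) := by
    refine (hs hx).tsum_le_tsum (fun k => ?_) (hs hy)
    have hk : (0 : ℝ) < (k : ℝ) + 1 := by positivity
    rw [div_le_div_iff₀ (by positivity) (by positivity)]
    have := mul_le_mul_of_nonneg_left hxy.le (sq_nonneg ((k : ℝ) + 1))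
    nlinarith
  linarith

/-- In the closed right half-plane the real part of `ψ(1 + u) - 1 - 1 / (2 u)` tends to infinity. -/
lemma exists_one_le_logDerivQuotient_re : ∃ R : ℝ, 1 ≤ R ∧
    ∀ u : ℂ, 0 ≤ u.re → R ≤ ‖u‖ → 1 ≤ (logDerivQuotient u).re := by
  obtain ⟨N, hN⟩ := (Real.tendsto_sum_range_one_div_nat_succ_atTop.eventually_ge_atTop
    (Real.eulerMascheroniConstant + 4)).exists
  refine ⟨N + 1, by simp, fun u hre hu => ?_⟩
  have hu' : -(1 / 2) < u.re := by linarith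
  have hu1 : 1 ≤ ‖u‖ := le_trans (by simp) hu
  have hterm : ∀ k : ℕ, (u / (((k : ℂ) + 1) * (k + 1 + u))).re =
      1 / ((k : ℝ) + 1) - (((k : ℂ) + 1 + u)⁻¹).re := fun k => by
    rw [quotientTerm_eq hu', sub_re, ofReal_re]
  have hnorm : ∀ k : ℕ, (((k : ℂ) + 1 + u)⁻¹).re ≤ ‖(k : ℂ) + 1 + u‖⁻¹ := fun k => by
    rw [← norm_inv]
    exact re_le_norm _
  have hnn : ∀ k : ℕ, 0 ≤ (u / (((k : ℂ) + 1) * (k + 1 + u))).re := fun k => by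
    have hk : (0 : ℝ) < (k : ℝ) + 1 := by positivity
    have h : (k : ℝ) + 1 ≤ ‖(k : ℂ) + 1 + u‖ := by
      refine le_trans ?_ (re_le_norm _)
      simpa using hre
    have := inv_anti₀ hk h
    rw [hterm, one_div]
    linarith [hnorm k]
  have hge : ∀ k : ℕ, 1 / ((k : ℝ) + 1) - 1 / ‖u‖ ≤ (u / (((k : ℂ) + 1) * (k + 1 + u))).re :=
    fun k => by
      have h : ‖u‖ ≤ ‖(k : ℂ) + 1 + u‖ := by
        rw [← sq_le_sq₀ (norm_nonneg _) (norm_nonneg _), Complex.sq_norm, Complex.sq_norm,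
          normSq_apply, normSq_apply]
        simp
        have hk : (0 : ℝ) ≤ (k : ℝ) := k.cast_nonneg
        nlinarith
      have := inv_anti₀ (by linarith) h
      rw [hterm, one_div ‖u‖]
      linarith [hnorm k]
  have hsum : ∑ k ∈ Finset.range N, (1 / ((k : ℝ) + 1) - 1 / ‖u‖) ≤
      (∑' k : ℕ, u / (((k : ℂ) + 1) * (k + 1 + u))).re := by
    rw [re_tsum (summable_logDerivQuotient hu')]
    exact (Finset.sum_le_sum fun k _ => hge k).trans
      ((hasSum_re (summable_logDerivQuotient hu').hasSum).summable.sum_le_tsum _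
        fun k _ => hnn k)
  rw [Finset.sum_sub_distrib, Finset.sum_const, Finset.card_range, nsmul_eq_mul,
    mul_one_div] at hsum
  have h1 : (N : ℝ) / ‖u‖ ≤ 1 := by
    rw [div_le_one (by linarith)]
    linarith
  have h2 : (1 / (2 * u)).re ≤ 1 := by
    refine (re_le_norm _).trans ?_
    rw [norm_div, norm_one, norm_mul, RCLike.norm_ofNat, div_le_one (by linarith)]
    linarith
  have h3 : (-(1 + (Real.eulerMascheroniConstant : ℂ))).re =
    -(1 + Real.eulerMascheroniConstant) := by simp
  rw [logDerivQuotient, add_re, sub_re, h3]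
  linarith

/-- On the closed right half-plane `logRecipGamma2` is proper. -/
lemma exists_le_norm_logRecipGamma2 (C : ℝ) : ∃ R : ℝ,
    ∀ u : ℂ, 0 ≤ u.re → R ≤ ‖u‖ → C ≤ ‖logRecipGamma2 u‖ := by
  obtain ⟨R, hR1, hR⟩ := exists_one_le_logDerivQuotient_re
  have hc : ContinuousOn logRecipGamma2 ({u : ℂ | 0 ≤ u.re} ∩ Metric.closedBall 0 R) :=
    fun u hu => (analyticAt_logRecipGamma2
      (lt_of_lt_of_le (by norm_num) hu.1)).continuousAt.continuousWithinAt
  obtain ⟨B, hB⟩ := ((isCompact_closedBall (0 : ℂ) R).inter_left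
    (isClosed_le continuous_const continuous_re)).exists_bound_of_continuousOn hc
  refine ⟨R + |C| + |B| + 1, fun u hre hu => ?_⟩
  have hRu : R < ‖u‖ := by
    have := abs_nonneg C
    have := abs_nonneg B
    linarith
  have hu0 : 0 < ‖u‖ := by linarith
  set e : ℂ := u / ‖u‖ with he
  have hue : u = ‖u‖ * e := by
    rw [he, mul_div_cancel₀]
    exact_mod_cast hu0.ne'
  have hne : ‖e‖ = 1 := by
    rw [he, norm_div, norm_real, norm_norm, div_self hu0.ne']
  have hee : e ≠ 0 := by
    rw [← norm_pos_iff, hne]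
    exact one_pos
  have here : 0 ≤ e.re := by
    rw [he, div_ofReal_re]
    positivity
  have hmem : ∀ z ∈ segment ℝ (R * e) u, ∃ t : ℝ, R ≤ t ∧ z = t * e := by
    rintro z ⟨a, b, ha, hb, hab, rfl⟩
    refine ⟨a * R + b * ‖u‖, by nlinarith, ?_⟩
    conv_lhs => rw [hue]
    push_cast
    simp only [real_smul]
    ring
  have hderiv : ∀ z ∈ segment ℝ (R * e) u,
      HasDerivAt logRecipGamma2 (z * logDerivQuotient z) z := by
    intro z hz
    obtain ⟨t, ht, rfl⟩ := hmem z hz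
    refine hasDerivAt_logRecipGamma2 ?_ ?_
    · rw [re_ofReal_mul]
      have := mul_nonneg (by linarith : 0 ≤ t) here
      linarith
    · exact mul_ne_zero (by exact_mod_cast (by linarith : (0 : ℝ) < t).ne') hee
  obtain ⟨ξ, hξ, h⟩ := exists_re_mul_sub_eq hderiv ((e ^ 2)⁻¹)
  obtain ⟨t, ht, rfl⟩ := hmem ξ (openSegment_subset_segment _ _ _ hξ)
  have hval : (e ^ 2)⁻¹ * (t * e * logDerivQuotient (t * e) * (u - R * e)) =
      ((t * (‖u‖ - R) : ℝ) : ℂ) * logDerivQuotient (t * e) := by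
    have hsub : u - R * e = (‖u‖ - R) * e := by rw [sub_mul, ← hue]
    rw [hsub]
    push_cast
    field_simp
  have hnt : ‖(t : ℂ) * e‖ = t := by
    rw [norm_mul, hne, norm_real, Real.norm_of_nonneg (by linarith), mul_one]
  have hP : 1 ≤ (logDerivQuotient (t * e)).re := by
    refine hR _ ?_ (by rwa [hnt])
    rw [re_ofReal_mul]
    exact mul_nonneg (by linarith) here
  have hBR : ‖logRecipGamma2 (R * e)‖ ≤ B := by
    refine hB _ ⟨?_, ?_⟩
    · change 0 ≤ (R * e).re
      rw [re_ofReal_mul]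
      exact mul_nonneg (by linarith) here
    · rw [mem_closedBall_zero_iff, norm_mul, hne, norm_real, Real.norm_of_nonneg (by linarith),
        mul_one]
  have hlow : ‖u‖ - R ≤ ‖logRecipGamma2 u - logRecipGamma2 (R * e)‖ := by
    calc ‖u‖ - R ≤ t * (‖u‖ - R) * (logDerivQuotient (t * e)).re := by
          have h1 : ‖u‖ - R ≤ t * (‖u‖ - R) := by nlinarith
          nlinarith
      _ = ((e ^ 2)⁻¹ * (logRecipGamma2 u - logRecipGamma2 (R * e))).re := by
          rw [h, hval, re_ofReal_mul]
      _ ≤ ‖(e ^ 2)⁻¹ * (logRecipGamma2 u - logRecipGamma2 (R * e))‖ := re_le_norm _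
      _ = _ := by rw [norm_mul, norm_inv, norm_pow, hne]; simp
  have := norm_sub_le (logRecipGamma2 u) (logRecipGamma2 (R * e))
  linarith [le_abs_self C, le_abs_self B]

lemma hasDerivAt_logRecipGamma2_cpow {s : ℂ} (hs : 0 < s.im) :
    HasDerivAt (fun s => logRecipGamma2 (s ^ (2⁻¹ : ℂ)))
      (logDerivQuotient (s ^ (2⁻¹ : ℂ)) / 2) s := by
  have hs0 : s ≠ 0 := fun h => by simp [h] at hs
  have hre : -(1 / 2) < (s ^ (2⁻¹ : ℂ)).re := by
    rw [cpow_inv_two_re]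
    exact lt_of_lt_of_le (by norm_num) (Real.sqrt_nonneg _)
  have hv0 : s ^ (2⁻¹ : ℂ) ≠ 0 := by simp [cpow_eq_zero_iff, hs0]
  have hsq : s ^ (2⁻¹ : ℂ) * s ^ (2⁻¹ : ℂ) = s := by
    rw [← cpow_add _ _ hs0]
    norm_num
  have h1 := (hasDerivAt_id s).cpow_const (c := 2⁻¹) (Or.inr hs.ne')
  refine ((hasDerivAt_logRecipGamma2 hre hv0).comp s h1).congr_deriv ?_
  simp only [id]
  rw [cpow_sub _ _ hs0, cpow_one, mul_one]
  calc _ = s ^ (2⁻¹ : ℂ) * s ^ (2⁻¹ : ℂ) * logDerivQuotient (s ^ (2⁻¹ : ℂ)) / 2 / s := by ring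
    _ = _ := by rw [hsq]; field_simp

lemma cpow_inv_two_mem_quadrant {s : ℂ} (hs : 0 < s.im) :
    0 < (s ^ (2⁻¹ : ℂ)).re ∧ 0 < (s ^ (2⁻¹ : ℂ)).im := by
  have hs0 : s ≠ 0 := fun h => by simp [h] at hs
  have hre : 0 < (s ^ (2⁻¹ : ℂ)).re := by
    rw [cpow_inv_two_re, Real.sqrt_pos]
    have := (abs_lt.1 (abs_re_lt_norm.2 hs.ne')).1
    linarith
  have hsq : s ^ (2⁻¹ : ℂ) * s ^ (2⁻¹ : ℂ) = s := by
    rw [← cpow_add _ _ hs0]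
    norm_num
  refine ⟨hre, ?_⟩
  have h := congrArg im hsq
  rw [mul_im] at h
  nlinarith

lemma sq_im_pos {u : ℂ} (hre : 0 < u.re) (him : 0 < u.im) : 0 < (u ^ 2).im := by
  rw [sq, mul_im]
  have := mul_pos hre him
  linarith

/-- As a function of `u²`, `logRecipGamma2` has a derivative with positive imaginary part on the
upper half-plane, so it is injective on the first quadrant. -/
lemma injOn_logRecipGamma2_quadrant : InjOn logRecipGamma2 {u : ℂ | 0 < u.re ∧ 0 < u.im} := by
  rintro u ⟨hur, hui⟩ v ⟨hvr, hvi⟩ huv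
  by_contra hne
  have hsqrt : ∀ {u : ℂ}, 0 < u.re → (u ^ 2) ^ (2⁻¹ : ℂ) = u := fun h => sq_cpow_two_inv h
  have hsub : v ^ 2 - u ^ 2 ≠ 0 := fun h => hne (by
    rw [← hsqrt hur, ← hsqrt hvr, sub_eq_zero.1 h])
  have hseg : ∀ z ∈ segment ℝ (u ^ 2) (v ^ 2), 0 < z.im := fun z hz =>
    (convex_halfSpace_im_gt 0).segment_subset (sq_im_pos hur hui) (sq_im_pos hvr hvi) hz
  obtain ⟨ξ, hξ, h⟩ := exists_re_mul_sub_eq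
    (fun z hz => hasDerivAt_logRecipGamma2_cpow (hseg z hz)) (-I * starRingEnd ℂ (v ^ 2 - u ^ 2))
  have hξ' := cpow_inv_two_mem_quadrant (hseg ξ (openSegment_subset_segment _ _ _ hξ))
  have hP := logDerivQuotient_im_pos (by linarith [hξ'.1]) hξ'.2
  set P := logDerivQuotient (ξ ^ (2⁻¹ : ℂ))
  have hval : -I * starRingEnd ℂ (v ^ 2 - u ^ 2) * (P / 2 * (v ^ 2 - u ^ 2)) =
      ((normSq (v ^ 2 - u ^ 2) / 2 : ℝ) : ℂ) * (-I * P) := by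
    push_cast
    rw [← mul_conj]
    ring
  rw [hsqrt hur, hsqrt hvr, huv, sub_self, mul_zero, zero_re, hval, re_ofReal_mul] at h
  have h1 : (-I * P).re = P.im := by simp
  rw [h1] at h
  have := mul_pos (half_pos (normSq_pos.2 hsub)) hP
  linarith

lemma logRecipGamma2_im_nonpos_of_re_eq_zero {u : ℂ} (hre : u.re = 0) (him : 0 < u.im) :
    (logRecipGamma2 u).im ≤ 0 := by
  have hmem : ∀ t : ℝ, -(1 / 2) < ((t : ℂ) * I).re := fun t => by simp
  have huI : u = u.im * I := by
    apply Complex.ext <;> simp [hre]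
  have hseg : ∀ z ∈ segment ℝ (0 : ℂ) u, -(1 / 2) < z.re := fun z hz =>
    (convex_halfSpace_re_gt _).segment_subset (by simp) (by simp [hre]) hz
  obtain ⟨ξ, hξ, h⟩ := exists_re_mul_sub_eq (fun z hz =>
    (analyticAt_logRecipGamma2 (hseg z hz)).differentiableAt.hasDerivAt) (-I)
  rw [openSegment_eq_image'] at hξ
  obtain ⟨t, ⟨ht0, ht1⟩, hξ⟩ := hξ
  replace hξ : (((t * u.im : ℝ)) : ℂ) * I = ξ := by
    rw [← hξ]
    simp only [zero_add, sub_zero, real_smul]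
    conv_rhs => rw [huI]
    push_cast
    ring
  subst hξ
  have hpos : 0 < t * u.im := mul_pos ht0 him
  have h0 : ((t * u.im : ℝ) : ℂ) * I ≠ 0 :=
    mul_ne_zero (by exact_mod_cast hpos.ne') I_ne_zero
  rw [(hasDerivAt_logRecipGamma2 (hmem _) h0).deriv] at h
  have hP := logDerivQuotient_im_pos (hmem (t * u.im)) (by simpa using hpos)
  set P := logDerivQuotient (((t * u.im : ℝ) : ℂ) * I)
  have hval : -I * (((t * u.im : ℝ) : ℂ) * I * P * (u - 0)) =
      ((t * u.im * u.im : ℝ) : ℂ) * (I * P) := by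
    conv_lhs => rw [sub_zero, huI]
    push_cast
    simp only [mul_im, ofReal_re, I_im, ofReal_im, I_re]
    ring_nf
    rw [I_pow_three]
    ring
  have h00 : (logRecipGamma2 0).im = 0 := by
    exact_mod_cast logRecipGamma2_ofReal_im (x := 0) (by norm_num)
  have hl : (-I * (logRecipGamma2 u - logRecipGamma2 0)).re = (logRecipGamma2 u).im := by
    simp [h00]
  have hr : (I * P).re = -P.im := by simp
  rw [hl, hval, re_ofReal_mul, hr] at h
  rw [h]
  have := mul_pos (mul_pos hpos him) hP
  linarith

lemma exists_logDerivQuotient_eq_zero : ∃ b : ℝ, 0 < b ∧ (logDerivQuotient b).re = 0 := by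
  have hderiv : ∀ {x : ℝ}, 0 < x → deriv logRecipGamma2 x = x * logDerivQuotient x := fun hx =>
    (hasDerivAt_logRecipGamma2 (by rw [ofReal_re]; linarith) (by exact_mod_cast hx.ne')).deriv
  have hcont : ∀ {x : ℝ}, 0 ≤ x → ContinuousAt (fun x : ℝ => (deriv logRecipGamma2 x).re) x :=
    fun {x} hx => continuous_re.continuousAt.comp
      ((analyticAt_logRecipGamma2 (u := (x : ℂ))
        (by rw [ofReal_re]; linarith)).deriv.continuousAt.comp continuous_ofReal.continuousAt)
  have hneg : (deriv logRecipGamma2 ((0 : ℝ) : ℂ)).re < 0 := by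
    rw [ofReal_zero, hasDerivAt_logRecipGamma2_zero.deriv]
    norm_num
  obtain ⟨a, ha0, ha⟩ := (((hcont le_rfl).eventually_lt_const hneg).filter_mono
    (nhdsWithin_le_nhds (s := Ioi 0)) |>.and self_mem_nhdsWithin).exists.imp fun a h => h.symm
  replace ha0 : 0 < a := ha0
  rw [hderiv ha0, re_ofReal_mul] at ha
  have haP : (logDerivQuotient a).re < 0 := by
    by_contra! h
    exact absurd ha (not_lt.2 (mul_nonneg ha0.le h))
  obtain ⟨R, hR1, hR⟩ := exists_one_le_logDerivQuotient_re
  have hRP := hR (R : ℂ) (by rw [ofReal_re]; linarith)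
    (by rw [norm_real]; exact le_abs_self R)
  have haR : a ≤ R := by
    by_contra! h
    have := logDerivQuotient_re_strictMonoOn (show R ∈ Ioi 0 from by rw [mem_Ioi]; linarith)
      (show a ∈ Ioi 0 from ha0) h
    simp only at this
    linarith
  have hc : ContinuousOn (fun x : ℝ => (logDerivQuotient x).re) (Icc a R) := by
    have hd : ContinuousOn (fun x : ℝ => (deriv logRecipGamma2 x).re / x) (Icc a R) := fun x hx =>
      ((hcont (ha0.le.trans hx.1)).div continuousAt_id
        (ha0.trans_le hx.1).ne').continuousWithinAt
    refine hd.congr fun x hx => ?_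
    have hx0 : 0 < x := ha0.trans_le hx.1
    simp only [hderiv hx0, re_ofReal_mul]
    rw [mul_div_cancel_left₀ _ hx0.ne']
  obtain ⟨b, hb, hb0⟩ := intermediate_value_Icc haR hc ⟨haP.le, by linarith⟩
  exact ⟨b, ha0.trans_le hb.1, hb0⟩

lemma hasDerivAt_logRecipGamma2_re {x : ℝ} (hx : 0 < x) :
    HasDerivAt (fun x : ℝ => (logRecipGamma2 x).re) (x * (logDerivQuotient x).re) x := by
  have := (hasDerivAt_logRecipGamma2 (u := x) (by rw [ofReal_re]; linarith)
    (by exact_mod_cast hx.ne')).real_of_complex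
  rwa [re_ofReal_mul] at this

lemma strictAntiOn_logRecipGamma2_re {b : ℝ} (hb : (logDerivQuotient b).re = 0) :
    StrictAntiOn (fun x : ℝ => (logRecipGamma2 x).re) (Ioo 0 b) := by
  refine strictAntiOn_of_deriv_neg (convex_Ioo 0 b)
    (fun x hx => (hasDerivAt_logRecipGamma2_re hx.1).continuousAt.continuousWithinAt)
    fun x hx => ?_
  rw [interior_Ioo] at hx
  rw [(hasDerivAt_logRecipGamma2_re hx.1).deriv]
  have := logDerivQuotient_re_strictMonoOn hx.1 (hx.1.trans hx.2) hx.2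
  simp only [hb] at this
  exact mul_neg_of_pos_of_neg hx.1 this

lemma logDerivQuotient_re_pos {b x : ℝ} (hb0 : 0 < b) (hb : (logDerivQuotient b).re = 0)
    (hx : b < x) : 0 < (logDerivQuotient x).re := by
  have := logDerivQuotient_re_strictMonoOn hb0 (hb0.trans hx) hx
  simpa only [hb] using this

lemma strictMonoOn_logRecipGamma2_re {b : ℝ} (hb0 : 0 < b) (hb : (logDerivQuotient b).re = 0) :
    StrictMonoOn (fun x : ℝ => (logRecipGamma2 x).re) (Ici b) := by
  refine strictMonoOn_of_deriv_pos (convex_Ici b) (fun x hx =>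
    (hasDerivAt_logRecipGamma2_re (hb0.trans_le hx)).continuousAt.continuousWithinAt)
    fun x hx => ?_
  rw [interior_Ici] at hx
  rw [(hasDerivAt_logRecipGamma2_re (hb0.trans hx)).deriv]
  exact mul_pos (hb0.trans hx) (logDerivQuotient_re_pos hb0 hb hx)

/-- The region which `logRecipGamma2` maps biholomorphically onto the plane slit along a
negative half-line. -/
def univalenceRegion (b : ℝ) : Set ℂ :=
  {u | 0 < u.re ∧ ((0 < u.im ∧ 0 < (logRecipGamma2 u).im) ∨ (u.im = 0 ∧ b < u.re) ∨
    (u.im < 0 ∧ (logRecipGamma2 u).im < 0))}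

lemma logRecipGamma2_im_mul_im_pos_eventually {b x : ℝ} (hb0 : 0 < b)
    (hb : (logDerivQuotient b).re = 0) (hx : b < x) :
    ∀ᶠ u : ℂ in 𝓝 (x : ℂ), u.im ≠ 0 → 0 < (logRecipGamma2 u).im * u.im := by
  have hx0 : 0 < x := hb0.trans hx
  have hxre : -(1 / 2) < (x : ℂ).re := by rw [ofReal_re]; linarith
  have hpos : 0 < (deriv logRecipGamma2 x).re := by
    rw [(hasDerivAt_logRecipGamma2 hxre (by exact_mod_cast hx0.ne')).deriv, re_ofReal_mul]
    exact mul_pos hx0 (logDerivQuotient_re_pos hb0 hb hx)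
  have hev : ∀ᶠ u : ℂ in 𝓝 (x : ℂ), 0 < (deriv logRecipGamma2 u).re ∧ -(1 / 2) < u.re :=
    ((continuous_re.continuousAt.comp
      (analyticAt_logRecipGamma2 hxre).deriv.continuousAt).eventually_const_lt hpos).and
      (continuous_re.continuousAt.eventually_const_lt hxre)
  obtain ⟨ε, hε, hball⟩ := Metric.eventually_nhds_iff_ball.1 hev
  filter_upwards [Metric.ball_mem_nhds (x : ℂ) hε] with u hu hui
  have hre : (u.re : ℂ) ∈ Metric.ball (x : ℂ) ε := by
    rw [Metric.mem_ball, dist_eq, ← ofReal_sub, norm_real, Real.norm_eq_abs] at *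
    have := abs_re_le_norm (u - x)
    rw [sub_re, ofReal_re] at this
    exact this.trans_lt hu
  have hseg := (convex_ball (x : ℂ) ε).segment_subset hre hu
  obtain ⟨ξ, hξ, h⟩ := exists_re_mul_sub_eq (fun z hz =>
    (analyticAt_logRecipGamma2 (hball z (hseg hz)).2).differentiableAt.hasDerivAt)
    (-I * u.im)
  have hξ' := (hball ξ (hseg (openSegment_subset_segment _ _ _ hξ))).1
  have hsub : u - u.re = u.im * I := by
    apply Complex.ext <;> simp
  have hval : -I * u.im * (deriv logRecipGamma2 ξ * (u - u.re)) =
      ((u.im ^ 2 : ℝ) : ℂ) * deriv logRecipGamma2 ξ := by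
    rw [hsub]
    push_cast
    linear_combination (-(u.im : ℂ) ^ 2 * deriv logRecipGamma2 ξ) * I_mul_I
  have h0 := logRecipGamma2_ofReal_im (x := u.re) (hball u hu).2
  have hl : (-I * u.im * (logRecipGamma2 u - logRecipGamma2 u.re)).re =
      (logRecipGamma2 u).im * u.im := by
    simp [h0]
    ring
  rw [hl, hval, re_ofReal_mul] at h
  rw [h]
  exact mul_pos (by positivity) hξ'

lemma isOpen_univalenceRegion {b : ℝ} (hb0 : 0 < b) (hb : (logDerivQuotient b).re = 0) :
    IsOpen (univalenceRegion b) := by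
  rw [isOpen_iff_mem_nhds]
  rintro u ⟨hre, h⟩
  have hre' := continuous_re.continuousAt.eventually_const_lt hre
  have hc : ContinuousAt (fun u => (logRecipGamma2 u).im) u := continuous_im.continuousAt.comp
    (analyticAt_logRecipGamma2 (u := u) (by linarith)).continuousAt
  rcases h with ⟨hi, hL⟩ | ⟨hi, hb'⟩ | ⟨hi, hL⟩
  · filter_upwards [hre', continuous_im.continuousAt.eventually_const_lt hi,
      hc.eventually_const_lt hL] with v h1 h2 h3 using ⟨h1, Or.inl ⟨h2, h3⟩⟩
  · have hu : u = (u.re : ℂ) := by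
      apply Complex.ext <;> simp [hi]
    have hev := logRecipGamma2_im_mul_im_pos_eventually hb0 hb hb'
    rw [← hu] at hev
    filter_upwards [hre', continuous_re.continuousAt.eventually_const_lt hb', hev]
      with v h1 h2 h3
    refine ⟨h1, ?_⟩
    rcases lt_trichotomy v.im 0 with hv | hv | hv
    · exact Or.inr (Or.inr ⟨hv, neg_of_mul_pos_left (h3 hv.ne) hv.le⟩)
    · exact Or.inr (Or.inl ⟨hv, h2⟩)
    · exact Or.inl ⟨hv, pos_of_mul_pos_left (h3 hv.ne') hv.le⟩
  · filter_upwards [hre', continuous_im.continuousAt.eventually_lt_const hi,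
      hc.eventually_lt_const hL] with v h1 h2 h3 using ⟨h1, Or.inr (Or.inr ⟨h2, h3⟩)⟩

lemma logDerivQuotient_conj (u : ℂ) :
    logDerivQuotient (starRingEnd ℂ u) = starRingEnd ℂ (logDerivQuotient u) := by
  simp [logDerivQuotient, conj_tsum, map_ofNat]

lemma conj_mem_univalenceRegion {b : ℝ} {u : ℂ} (hu : u ∈ univalenceRegion b) :
    starRingEnd ℂ u ∈ univalenceRegion b := by
  obtain ⟨hre, h⟩ := hu
  have hL := logRecipGamma2_conj (u := u) (by linarith)
  refine ⟨by simpa using hre, ?_⟩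
  simp only [hL, conj_im, conj_re, neg_eq_zero, Left.neg_pos_iff, Left.neg_neg_iff]
  tauto

lemma deriv_logRecipGamma2_ne_zero {b : ℝ} (hb0 : 0 < b) (hb : (logDerivQuotient b).re = 0)
    {u : ℂ} (hu : u ∈ univalenceRegion b) : deriv logRecipGamma2 u ≠ 0 := by
  obtain ⟨hre, h⟩ := hu
  have h0 : u ≠ 0 := fun h0 => by simp [h0] at hre
  rw [(hasDerivAt_logRecipGamma2 (by linarith) h0).deriv]
  refine mul_ne_zero h0 fun hP => ?_
  rcases h with ⟨hi, -⟩ | ⟨hi, hb'⟩ | ⟨hi, -⟩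
  · have := logDerivQuotient_im_pos (by linarith) hi
    simp [hP] at this
  · have hu : u = (u.re : ℂ) := by
      apply Complex.ext <;> simp [hi]
    have := logDerivQuotient_re_pos hb0 hb hb'
    rw [← hu, hP] at this
    simp at this
  · have := logDerivQuotient_im_pos (u := starRingEnd ℂ u) (by rw [conj_re]; linarith)
      (by simpa using hi)
    rw [logDerivQuotient_conj, hP] at this
    simp at this

lemma injOn_logRecipGamma2 {b : ℝ} (hb0 : 0 < b) (hb : (logDerivQuotient b).re = 0) :
    InjOn logRecipGamma2 (univalenceRegion b) := by
  have hreal : ∀ {u : ℂ}, 0 < u.re → u.im = 0 → (logRecipGamma2 u).im = 0 := fun {u} hr hi => by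
    have hu : u = (u.re : ℂ) := by
      apply Complex.ext <;> simp [hi]
    rw [hu]
    exact logRecipGamma2_ofReal_im (by linarith)
  rintro u ⟨hur, hu⟩ v ⟨hvr, hv⟩ huv
  have him := congrArg im huv
  rcases hu with ⟨hui, hu⟩ | ⟨hui, hu⟩ | ⟨hui, hu⟩ <;>
    rcases hv with ⟨hvi, hv⟩ | ⟨hvi, hv⟩ | ⟨hvi, hv⟩
  · exact injOn_logRecipGamma2_quadrant ⟨hur, hui⟩ ⟨hvr, hvi⟩ huv
  · linarith [hreal hvr hvi]
  · linarith
  · linarith [hreal hur hui]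
  · have hu' : u = (u.re : ℂ) := by
      apply Complex.ext <;> simp [hui]
    have hv' : v = (v.re : ℂ) := by
      apply Complex.ext <;> simp [hvi]
    rw [hu', hv'] at huv ⊢
    exact congrArg _ ((strictMonoOn_logRecipGamma2_re hb0 hb).injOn hu.le hv.le
      (congrArg re huv))
  · linarith [hreal hur hui]
  · linarith
  · linarith [hreal hvr hvi]
  · have h := injOn_logRecipGamma2_quadrant (x₁ := starRingEnd ℂ u) (x₂ := starRingEnd ℂ v)
      ⟨by simpa using hur, by simpa using hui⟩ ⟨by simpa using hvr, by simpa using hvi⟩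
      (by rw [logRecipGamma2_conj (by linarith), logRecipGamma2_conj (by linarith), huv])
    exact (starRingEnd ℂ).injective h

lemma map_nhds_logRecipGamma2 {b : ℝ} (hb0 : 0 < b) (hb : (logDerivQuotient b).re = 0)
    {u : ℂ} (hu : u ∈ univalenceRegion b) :
    map logRecipGamma2 (𝓝 u) = 𝓝 (logRecipGamma2 u) :=
  (analyticAt_logRecipGamma2 (by linarith [hu.1])).hasStrictDerivAt.map_nhds_eq
    (deriv_logRecipGamma2_ne_zero hb0 hb hu)

lemma exists_logRecipGamma2_eq_of_im_pos {b : ℝ} (hb0 : 0 < b) (hb : (logDerivQuotient b).re = 0)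
    {w : ℂ} (hw : 0 < w.im) : ∃ u ∈ univalenceRegion b, logRecipGamma2 u = w := by
  set Q : Set ℂ := univalenceRegion b ∩ {u | 0 < u.im}
  have hQo : IsOpen Q :=
    (isOpen_univalenceRegion hb0 hb).inter (isOpen_lt continuous_const continuous_im)
  have hpos : ∀ u ∈ Q, 0 < (logRecipGamma2 u).im := by
    rintro u ⟨⟨-, ⟨-, h⟩ | ⟨h, -⟩ | ⟨h, -⟩⟩, hi : 0 < u.im⟩
    · exact h
    · exact absurd h hi.ne'
    · exact absurd h hi.not_gt
  have himage : IsOpen (logRecipGamma2 '' Q) := by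
    rw [isOpen_iff_mem_nhds]
    rintro _ ⟨u, hu, rfl⟩
    rw [← map_nhds_logRecipGamma2 hb0 hb hu.1]
    exact image_mem_map (hQo.mem_nhds hu)
  have hne : ({w : ℂ | 0 < w.im} ∩ logRecipGamma2 '' Q).Nonempty := by
    have hmem : ((b + 1 : ℝ) : ℂ) ∈ univalenceRegion b :=
      ⟨by rw [ofReal_re]; linarith, Or.inr (Or.inl ⟨ofReal_im _, by rw [ofReal_re]; linarith⟩)⟩
    have htend : Tendsto (fun t : ℝ => ((b + 1 : ℝ) : ℂ) + t * I) (𝓝[>] 0)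
        (𝓝 ((b + 1 : ℝ) : ℂ)) := by
      have : Continuous fun t : ℝ => ((b + 1 : ℝ) : ℂ) + t * I := by fun_prop
      exact ((this.tendsto' 0 _ (by simp)).mono_left nhdsWithin_le_nhds)
    obtain ⟨t, ht, ht0⟩ := ((htend.eventually
      ((isOpen_univalenceRegion hb0 hb).mem_nhds hmem)).and self_mem_nhdsWithin).exists
    have hu : ((b + 1 : ℝ) : ℂ) + t * I ∈ Q := ⟨ht, by simpa using ht0⟩
    exact ⟨_, hpos _ hu, mem_image_of_mem _ hu⟩
  have hclosed : closure (logRecipGamma2 '' Q) ∩ {w : ℂ | 0 < w.im} ⊆ logRecipGamma2 '' Q := by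
    rintro v ⟨hv, hvi : 0 < v.im⟩
    obtain ⟨R, hR⟩ := exists_le_norm_logRecipGamma2 (‖v‖ + 1)
    set K : Set ℂ := ({u | 0 ≤ u.re} ∩ {u | 0 ≤ u.im}) ∩ Metric.closedBall 0 R
    have hK : IsCompact K := (isCompact_closedBall 0 R).inter_left
      ((isClosed_le continuous_const continuous_re).inter
        (isClosed_le continuous_const continuous_im))
    have hLK : IsClosed (logRecipGamma2 '' K) := (hK.image_of_continuousOn fun u hu =>
      (analyticAt_logRecipGamma2
        (lt_of_lt_of_le (by norm_num) hu.1.1)).continuousAt.continuousWithinAt).isClosed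
    have hsub : Metric.ball v 1 ∩ logRecipGamma2 '' Q ⊆ logRecipGamma2 '' K := by
      rintro _ ⟨hball, u, hu, rfl⟩
      refine ⟨u, ⟨⟨hu.1.1.le, (show 0 < u.im from hu.2).le⟩, ?_⟩, rfl⟩
      rw [mem_closedBall_zero_iff]
      by_contra! h
      have h1 := hR u hu.1.1.le h.le
      have h2 := norm_sub_norm_le (logRecipGamma2 u) v
      rw [Metric.mem_ball, dist_eq_norm] at hball
      linarith
    obtain ⟨u, ⟨⟨hre, him⟩, -⟩, rfl⟩ := hLK.closure_subset_iff.2 hsub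
      (Metric.isOpen_ball.inter_closure ⟨Metric.mem_ball_self one_pos, hv⟩)
    replace hre : 0 ≤ u.re := hre
    replace him : 0 ≤ u.im := him
    have him' : 0 < u.im := by
      refine him.lt_of_ne fun h => ?_
      have hu : u = (u.re : ℂ) := by
        apply Complex.ext <;> simp [← h]
      rw [hu, logRecipGamma2_ofReal_im (by linarith)] at hvi
      exact hvi.false
    have hre' : 0 < u.re := by
      refine hre.lt_of_ne fun h => ?_
      linarith [logRecipGamma2_im_nonpos_of_re_eq_zero h.symm him']
    exact ⟨u, ⟨⟨hre', Or.inl ⟨him', hvi⟩⟩, him'⟩, rfl⟩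
  obtain ⟨u, hu, h⟩ := (convex_halfSpace_im_gt 0).isPreconnected.subset_of_closure_inter_subset
    himage hne hclosed hw
  exact ⟨u, hu.1, h⟩

lemma exists_logRecipGamma2_re_eq {b y : ℝ} (hb0 : 0 < b) (hb : (logDerivQuotient b).re = 0)
    (hy : (logRecipGamma2 b).re < y) : ∃ x : ℝ, b < x ∧ (logRecipGamma2 x).re = y := by
  obtain ⟨R, hR⟩ := exists_le_norm_logRecipGamma2 (|y| + |(logRecipGamma2 b).re| + 1)
  set X := max R b
  have hbX : b ≤ X := le_max_right _ _
  have hX0 : 0 < X := hb0.trans_le hbX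
  have hmono := strictMonoOn_logRecipGamma2_re hb0 hb
  have hX := hR (X : ℂ) (by rw [ofReal_re]; exact hX0.le)
    (by rw [norm_real, Real.norm_of_nonneg hX0.le]; exact le_max_left _ _)
  have hXre : logRecipGamma2 X = ((logRecipGamma2 X).re : ℂ) := by
    apply Complex.ext
    · simp
    · simpa using logRecipGamma2_ofReal_im (by linarith : -(1 / 2) < X)
  rw [hXre, norm_real, Real.norm_eq_abs] at hX
  have hle : (logRecipGamma2 b).re ≤ (logRecipGamma2 X).re :=
    hmono.monotoneOn self_mem_Ici hbX hbX
  have hyX : y ≤ (logRecipGamma2 X).re := by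
    rcases abs_cases (logRecipGamma2 X).re with h | h
    · linarith [le_abs_self y, abs_nonneg (logRecipGamma2 b).re]
    · linarith [neg_abs_le (logRecipGamma2 b).re, abs_nonneg y]
  obtain ⟨x, hx, h⟩ := intermediate_value_Icc hbX (f := fun x : ℝ => (logRecipGamma2 x).re)
    (fun x hx => (hasDerivAt_logRecipGamma2_re
      (hb0.trans_le hx.1)).continuousAt.continuousWithinAt) ⟨hy.le, hyX⟩
  refine ⟨x, hx.1.lt_of_ne fun hbx => ?_, h⟩
  simp only [← hbx] at h
  linarith

lemma exists_logRecipGamma2_eq {b : ℝ} (hb0 : 0 < b) (hb : (logDerivQuotient b).re = 0)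
    {w : ℂ} (hw : w.im ≠ 0 ∨ (logRecipGamma2 b).re < w.re) :
    ∃ u ∈ univalenceRegion b, logRecipGamma2 u = w := by
  rcases lt_trichotomy w.im 0 with h | h | h
  · obtain ⟨u, hu, hL⟩ := exists_logRecipGamma2_eq_of_im_pos hb0 hb
      (w := starRingEnd ℂ w) (by simpa using h)
    refine ⟨_, conj_mem_univalenceRegion hu, ?_⟩
    rw [logRecipGamma2_conj (by linarith [hu.1]), hL, conj_conj]
  · obtain ⟨x, hx, hL⟩ := exists_logRecipGamma2_re_eq hb0 hb (hw.resolve_left (not_not.2 h))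
    refine ⟨x, ⟨by rw [ofReal_re]; linarith,
      Or.inr (Or.inl ⟨ofReal_im _, by rwa [ofReal_re]⟩)⟩, ?_⟩
    apply Complex.ext
    · exact hL
    · rw [h, logRecipGamma2_ofReal_im (by linarith)]
  · exact exists_logRecipGamma2_eq_of_im_pos hb0 hb h

lemma differentiableAt_of_rightInverse {b : ℝ} (hb0 : 0 < b) (hb : (logDerivQuotient b).re = 0)
    {g : ℂ → ℂ} {T : Set ℂ} (hT : IsOpen T) (hg : ∀ w ∈ T, g w ∈ univalenceRegion b)
    (hLg : ∀ w ∈ T, logRecipGamma2 (g w) = w) {w : ℂ} (hw : w ∈ T) : DifferentiableAt ℂ g w := by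
  have hcont : ContinuousAt g w := by
    rw [ContinuousAt, tendsto_def]
    intro V hV
    have hU : V ∩ univalenceRegion b ∈ 𝓝 (g w) :=
      inter_mem hV ((isOpen_univalenceRegion hb0 hb).mem_nhds (hg w hw))
    have himg := image_mem_map (m := logRecipGamma2) hU
    rw [map_nhds_logRecipGamma2 hb0 hb (hg w hw), hLg w hw] at himg
    filter_upwards [himg, hT.mem_nhds hw] with v hv hvT
    obtain ⟨u, hu, huv⟩ := hv
    have : g v = u := injOn_logRecipGamma2 hb0 hb (hg v hvT) hu.2 (by rw [hLg v hvT, huv])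
    rw [mem_preimage, this]
    exact hu.1
  exact (HasDerivAt.of_local_left_inverse hcont (analyticAt_logRecipGamma2
    (by linarith [(hg w hw).1])).differentiableAt.hasDerivAt
    (deriv_logRecipGamma2_ne_zero hb0 hb (hg w hw))
    (eventually_of_mem (hT.mem_nhds hw) hLg)).differentiableAt

lemma recipGamma2_one_add_re {x : ℝ} (hx : 0 < x) :
    (recipGamma2 ((1 + x : ℝ) : ℂ)).re = Real.exp (logRecipGamma2 x).re := by
  have hx' : -(1 / 2) < x := by linarith
  rw [ofReal_add, ofReal_one, recipGamma2_one_add (by rwa [ofReal_re]), exp_re,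
    logRecipGamma2_ofReal_im hx', Real.cos_zero, mul_one]

/-- There are `0 < α₂ < β₂` such that `H = 1/Γ₂` strictly decreases
on `(α₂, β₂)` and strictly increases on `(β₂, ∞)`, and the inverse of `H` on
`(H(β₂),∞)` extends to a univalent Pick function on `ℂ ∖ (−∞, H(β₂)]`. -/
theorem recipGamma2_inverse_pick :
    ∃ α₂ β₂ : ℝ, 0 < α₂ ∧ α₂ < β₂ ∧
      StrictAntiOn (fun x : ℝ => (recipGamma2 (x : ℂ)).re) (Set.Ioo α₂ β₂) ∧
      StrictMonoOn (fun x : ℝ => (recipGamma2 (x : ℂ)).re) (Set.Ioi β₂) ∧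
      ∃ F : ℂ → ℂ,
        Set.InjOn F {z : ℂ | z.im ≠ 0 ∨ (recipGamma2 (β₂ : ℂ)).re < z.re} ∧
        DifferentiableOn ℂ F {z : ℂ | z.im ≠ 0 ∨ (recipGamma2 (β₂ : ℂ)).re < z.re} ∧
        (∀ x : ℝ, (recipGamma2 (β₂ : ℂ)).re < x → (F (x : ℂ)).im = 0) ∧
        StrictMonoOn (fun x : ℝ => (F (x : ℂ)).re)
          (Set.Ioi ((recipGamma2 (β₂ : ℂ)).re)) ∧
        (fun x : ℝ => (F (x : ℂ)).re) '' Set.Ioi ((recipGamma2 (β₂ : ℂ)).re) =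
          Set.Ioi β₂ ∧
        (∀ w : ℂ, (w.im ≠ 0 ∨ (recipGamma2 (β₂ : ℂ)).re < w.re) →
          recipGamma2 (F w) = w) ∧
        (∀ z : ℂ, 0 < z.im → 0 < (F z).im) := by
  obtain ⟨b, hb0, hb⟩ := exists_logDerivQuotient_eq_zero
  have hmono := strictMonoOn_logRecipGamma2_re hb0 hb
  have hHb := recipGamma2_one_add_re hb0
  have hH : ∀ {x : ℝ}, 1 < x →
      (recipGamma2 (x : ℂ)).re = Real.exp (logRecipGamma2 (x - 1 : ℝ)).re := fun {x} hx => by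
    rw [← recipGamma2_one_add_re (by linarith), add_sub_cancel]
  set T : Set ℂ := {w | w.im ≠ 0 ∨ (logRecipGamma2 b).re < w.re}
  have hT : IsOpen T := (isOpen_ne_fun continuous_im continuous_const).union
    (isOpen_lt continuous_const continuous_re)
  choose! g hg hLg using fun w (hw : w ∈ T) => exists_logRecipGamma2_eq hb0 hb hw
  have hHmono : StrictMonoOn (fun x : ℝ => (recipGamma2 (x : ℂ)).re) (Ioi (1 + b)) := by
    intro x hx y hy hxy
    rw [mem_Ioi] at hx hy
    simp only [hH (by linarith : 1 < x), hH (by linarith : 1 < y), Real.exp_lt_exp]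
    exact hmono (by rw [mem_Ici]; linarith) (by rw [mem_Ici]; linarith) (by linarith)
  refine ⟨1, 1 + b, one_pos, by linarith, ?_, hHmono, fun w => 1 + g (log w), ?_⟩
  · intro x hx y hy hxy
    simp only [hH hx.1, hH hy.1, Real.exp_lt_exp]
    exact strictAntiOn_logRecipGamma2_re hb ⟨by linarith [hx.1], by linarith [hx.2]⟩
      ⟨by linarith [hy.1], by linarith [hy.2]⟩ (by linarith)
  rw [hHb]
  set m := Real.exp (logRecipGamma2 b).re with hm
  have hm0 : 0 < m := Real.exp_pos _
  have hslit : ∀ {w : ℂ}, w.im ≠ 0 ∨ m < w.re → w ∈ slitPlane := fun hw =>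
    hw.elim Or.inr fun h => Or.inl (hm0.trans h)
  have hlog : ∀ {w : ℂ}, w.im ≠ 0 ∨ m < w.re → log w ∈ T := fun {w} hw => by
    by_cases hi : w.im = 0
    · have hre : m < w.re := hw.resolve_left (not_not.2 hi)
      right
      rw [log_re, Real.lt_log_iff_exp_lt (by linarith [re_le_norm w])]
      exact hre.trans_le (re_le_norm w)
    · left
      rw [log_im, Ne, arg_eq_zero_iff]
      exact fun h => hi h.2
  have hinv : ∀ w : ℂ, w.im ≠ 0 ∨ m < w.re → recipGamma2 (1 + g (log w)) = w := fun w hw => by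
    rw [recipGamma2_one_add (by linarith [(hg _ (hlog hw)).1]), hLg _ (hlog hw),
      exp_log (slitPlane_ne_zero (hslit hw))]
  have hreal : ∀ x : ℝ, m < x →
      (g (log x)).im = 0 ∧ b < (g (log x)).re := fun x hx => by
    have hx' : (x : ℂ).im ≠ 0 ∨ m < (x : ℂ).re := Or.inr (by rwa [ofReal_re])
    have hL : (logRecipGamma2 (g (log x))).im = 0 := by
      rw [hLg _ (hlog hx'), log_im, arg_ofReal_of_nonneg (by linarith)]
    rcases (hg _ (hlog hx')).2 with ⟨-, h⟩ | h | ⟨-, h⟩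
    · exact absurd hL h.ne'
    · exact h
    · exact absurd hL h.ne
  have hrealH : ∀ x : ℝ, m < x → (recipGamma2 (((1 + g (log x)).re : ℝ) : ℂ)).re = x :=
    fun x hx => by
      have h : (((1 + g (log x)).re : ℝ) : ℂ) = 1 + g (log x) := by
        apply Complex.ext <;> simp [(hreal x hx).1]
      rw [h, hinv x (Or.inr (by rwa [ofReal_re])), ofReal_re]
  have hrange : ∀ x : ℝ, m < x → 1 + b < (1 + g (log x)).re := fun x hx => by
    rw [add_re, one_re]
    linarith [(hreal x hx).2]
  refine ⟨fun w hw v hv h => ?_, fun w hw => ?_, fun x hx => ?_, fun x hx y hy hxy => ?_, ?_,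
    hinv, fun w hw => ?_⟩
  · rw [← hinv w hw, ← hinv v hv]
    exact congrArg recipGamma2 h
  · have h := (differentiableAt_of_rightInverse hb0 hb hT hg hLg (hlog hw)).comp w
      (differentiableAt_log (hslit hw))
    exact (h.const_add 1).differentiableWithinAt
  · simpa using (hreal x hx).1
  · rw [← hHmono.lt_iff_lt (hrange x hx) (hrange y hy)]
    simpa only [hrealH x hx, hrealH y hy] using hxy
  · ext y
    constructor
    · rintro ⟨x, hx, rfl⟩
      exact hrange x hx
    · intro hy
      rw [mem_Ioi] at hy
      have hmy : m < (recipGamma2 (y : ℂ)).re := by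
        rw [hH (by linarith : 1 < y), hm, Real.exp_lt_exp]
        exact hmono self_mem_Ici (by rw [mem_Ici]; linarith) (by linarith)
      exact ⟨_, hmy, hHmono.injOn (hrange _ hmy) hy (hrealH _ hmy)⟩
  · have hw' : w.im ≠ 0 ∨ m < w.re := Or.inl hw.ne'
    have hL : 0 < (logRecipGamma2 (g (log w))).im := by
      rw [hLg _ (hlog hw'), log_im]
      exact (arg_nonneg_iff.2 hw.le).lt_of_ne fun h => hw.ne' (arg_eq_zero_iff.1 h.symm).2
    obtain ⟨hre, ⟨hi, -⟩ | ⟨hi, -⟩ | ⟨-, hi⟩⟩ := hg _ (hlog hw')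
    · simpa using hi
    · have hu : g (log w) = ((g (log w)).re : ℂ) := by
        apply Complex.ext <;> simp [hi]
      rw [hu, logRecipGamma2_ofReal_im (by linarith)] at hL
      exact absurd hL (lt_irrefl 0)
    · exact absurd hL hi.not_gt
end
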